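/- arXiv:1010.0627 — 3 statements merged into one kernel-verified Lean document; each statement's English description precedes it below -/
import Mathlib

section
/- Let $0<\theta<1$ and $\bar{c}=(1-\theta)/\theta$. For all sufficiently small $\lambda>0$ there exist constants $c>\bar{c}$ and $\overline{s}>1$ and a twice continuously differentiable function $g:[1,\overline{s}]\to[1,(1-\lambda)\overline{s}]$ satisfying the ODE $g''(y)=\frac{2g'(y)^2}{c+g(y)}-\frac{2\theta g'(y)}{y}+\frac{2\delta}{\sigma^2}\left(1+\frac{g(y)}{c}\right)\left(\frac{g(y)}{y^2}-\frac{g'(y)}{y}\right)$ on $[1,\overline{s}]$ together with the boundary conditions $g(1)=1$, $g'(1)=1$, $g(\overline{s})=(1-\lambda)\overline{s}$, $g'(\overline{s})=1-\lambda$. -/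
open Set

open Filter Topology Metric

/-- A scalar second order ODE with a parameter `c`, whose right-hand side is `C¹` near the initial
data, has solutions near the initial time, jointly continuous in `c` and time, together with their
first derivative. -/
theorem exists_secondOrder_family {Φ : ℝ × ℝ × ℝ × ℝ → ℝ} {c₀ y₀ g₀ p₀ : ℝ}
    (hΦ : ContDiffAt ℝ 1 Φ (c₀, y₀, g₀, p₀)) :
    ∃ ε > (0 : ℝ), ∃ G P : ℝ × ℝ → ℝ,
      (∀ c ∈ Icc (c₀ - ε) (c₀ + ε), G (c, y₀) = g₀ ∧ P (c, y₀) = p₀ ∧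
        ∀ y ∈ Ioo (y₀ - ε) (y₀ + ε), HasDerivAt (fun y ↦ G (c, y)) (P (c, y)) y ∧
          HasDerivAt (fun y ↦ P (c, y)) (Φ (c, y, G (c, y), P (c, y))) y) ∧
      ContinuousOn G (Icc (c₀ - ε) (c₀ + ε) ×ˢ Icc (y₀ - ε) (y₀ + ε)) ∧
      ContinuousOn P (Icc (c₀ - ε) (c₀ + ε) ×ˢ Icc (y₀ - ε) (y₀ + ε)) := by
  have hf : ContDiffAt ℝ 1 (fun X : ℝ × ℝ × ℝ × ℝ ↦ ((0 : ℝ), (1 : ℝ), X.2.2.2, Φ X))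
      (c₀, y₀, g₀, p₀) := by fun_prop
  obtain ⟨ε, hε, a, r, L, K, hr, hpl⟩ := IsPicardLindelof.of_contDiffAt_one hf
  obtain ⟨α, hα, hcont⟩ :=
    (hpl y₀).exists_forall_mem_closedBall_eq_hasDerivWithinAt_continuousOn
  replace hr : (0 : ℝ) < r := hr
  have hball : ∀ c ∈ Icc (c₀ - r) (c₀ + r),
      (c, y₀, g₀, p₀) ∈ closedBall (c₀, y₀, g₀, p₀) (r : ℝ) := by
    intro c hc
    rw [← Real.closedBall_eq_Icc, mem_closedBall] at hc
    simp [Prod.dist_eq, hc]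
  have hy₀ : y₀ ∈ Icc (y₀ - ε) (y₀ + ε) := ⟨by linarith, by linarith⟩
  have key : ∀ c ∈ Icc (c₀ - r) (c₀ + r), ∀ y ∈ Icc (y₀ - ε) (y₀ + ε),
      (α ((c, y₀, g₀, p₀), y)).1 = c ∧ (α ((c, y₀, g₀, p₀), y)).2.1 = y := by
    intro c hc y hy
    obtain ⟨h0, hd⟩ := hα _ (hball c hc)
    have hconst : ∀ u : ℝ → ℝ, (∀ t ∈ Icc (y₀ - ε) (y₀ + ε),
        HasDerivWithinAt u 0 (Icc (y₀ - ε) (y₀ + ε)) t) → u y = u y₀ := by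
      intro u hu
      have h := (convex_Icc (y₀ - ε) (y₀ + ε)).norm_image_sub_le_of_norm_hasDerivWithin_le
        (C := 0) hu (by simp) hy₀ hy
      simpa [sub_eq_zero] using h
    constructor
    · have h := hconst _ fun t ht ↦ (hd t ht).fst
      simpa [h0] using h
    · have h := hconst (fun t ↦ (α ((c, y₀, g₀, p₀), t)).2.1 - t) fun t ht ↦ by
        have h1 : HasDerivWithinAt (fun t ↦ (α ((c, y₀, g₀, p₀), t)).2.1) 1
          (Icc (y₀ - ε) (y₀ + ε)) t := (hd t ht).snd.fst
        exact (h1.fun_sub (hasDerivWithinAt_id t _)).congr_deriv (sub_self 1)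
      simpa [h0, sub_eq_zero] using h
  have hmap : MapsTo (fun x : ℝ × ℝ ↦ ((x.1, y₀, g₀, p₀), x.2))
      (Icc (c₀ - min ε r) (c₀ + min ε r) ×ˢ Icc (y₀ - min ε r) (y₀ + min ε r))
      (closedBall (c₀, y₀, g₀, p₀) (r : ℝ) ×ˢ Icc (y₀ - ε) (y₀ + ε)) := by
    rintro ⟨c, y⟩ ⟨hc, hy⟩
    have h1 := min_le_left ε (r : ℝ)
    have h2 := min_le_right ε (r : ℝ)
    exact ⟨hball c ⟨by linarith [hc.1], by linarith [hc.2]⟩,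
      by linarith [hy.1], by linarith [hy.2]⟩
  have hcomp := hcont.comp (by fun_prop) hmap
  refine ⟨min ε r, lt_min hε hr, fun x ↦ (α ((x.1, y₀, g₀, p₀), x.2)).2.2.1,
    fun x ↦ (α ((x.1, y₀, g₀, p₀), x.2)).2.2.2, ?_, hcomp.snd.snd.fst, hcomp.snd.snd.snd⟩
  intro c hc
  have h1 := min_le_left ε (r : ℝ)
  have h2 := min_le_right ε (r : ℝ)
  have hc' : c ∈ Icc (c₀ - r) (c₀ + r) := ⟨by linarith [hc.1], by linarith [hc.2]⟩
  obtain ⟨h0, hd⟩ := hα _ (hball c hc')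
  simp only at h0
  refine ⟨by simp [h0], by simp [h0], fun y hy ↦ ?_⟩
  have hy' : y ∈ Ioo (y₀ - ε) (y₀ + ε) := ⟨by linarith [hy.1], by linarith [hy.2]⟩
  have hdy := (hd y (Ioo_subset_Icc_self hy')).hasDerivAt (Icc_mem_nhds hy'.1 hy'.2)
  obtain ⟨e1, e2⟩ := key c hc' y (Ioo_subset_Icc_self hy')
  have e : (c, y, (α ((c, y₀, g₀, p₀), y)).2.2.1, (α ((c, y₀, g₀, p₀), y)).2.2.2) =
      α ((c, y₀, g₀, p₀), y) := by
    ext <;> simp [e1, e2]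
  refine ⟨hdy.snd.snd.fst, ?_⟩
  rw [e]
  exact hdy.snd.snd.snd

/-- A function with positive derivative at `b` takes values smaller than `f b` to the left. -/
theorem HasDerivAt.exists_lt_of_pos {f : ℝ → ℝ} {f' a b : ℝ} (hf : HasDerivAt f f' b)
    (hf' : 0 < f') (hab : a < b) : ∃ x ∈ Ioo a b, f x < f b := by
  have h := (hasDerivAt_iff_tendsto_slope.mp hf).mono_left (nhdsLT_le_nhdsNE b)
  obtain ⟨x, hx, hxI⟩ := ((h.eventually (eventually_gt_nhds hf')).and
    (Ioo_mem_nhdsLT hab)).exists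
  refine ⟨x, hxI, ?_⟩
  rw [slope_comm] at hx
  exact (slope_pos_iff_of_le hxI.2.le).mp hx

/-- In a continuous family `h c`, `c ∈ [c₀, c₁]`, of functions on `[a, b]` starting from `1` and
increasing at `b`, such that `h c₀ ≥ 1` and `h c₁` takes a value below `1`, each value slightly
below `1` is an interior local minimum of some `h c`. -/
theorem exists_isLocalMin_eq {h : ℝ × ℝ → ℝ} {a b c₀ c₁ : ℝ} (hab : a < b) (hc : c₀ ≤ c₁)
    (hcont : ContinuousOn h (Icc c₀ c₁ ×ˢ Icc a b))
    (ha : ∀ c ∈ Icc c₀ c₁, h (c, a) = 1)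
    (hb : ∀ c ∈ Icc c₀ c₁, ∃ d > (0 : ℝ), HasDerivAt (fun y ↦ h (c, y)) d b)
    (h₀ : ∀ y ∈ Icc a b, 1 ≤ h (c₀, y)) (h₁ : ∃ y ∈ Icc a b, h (c₁, y) < 1) :
    ∃ l₀ > (0 : ℝ), ∀ l, 0 < l → l < l₀ → ∃ c ∈ Ioc c₀ c₁, ∃ s ∈ Ioo a b,
      h (c, s) = 1 - l ∧ IsLocalMin (fun y ↦ h (c, y)) s := by
  have hcont' : Continuous fun x : Icc c₀ c₁ × Icc a b ↦ h (x.1, x.2) :=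
    hcont.comp_continuous (by fun_prop) fun x ↦ ⟨x.1.2, x.2.2⟩
  have : Nonempty (Icc a b) := ⟨⟨a, le_rfl, hab.le⟩⟩
  set m : Icc c₀ c₁ → ℝ := fun c ↦ sInf ((fun y : Icc a b ↦ h (c, y)) '' univ) with hm
  have hmc : Continuous m := isCompact_univ.continuous_sInf hcont'
  have hmin : ∀ c : Icc c₀ c₁, ∃ s : Icc a b, m c = h (c, s) ∧ ∀ y : Icc a b, m c ≤ h (c, y) := by
    intro c
    obtain ⟨s, -, hs, hs'⟩ := isCompact_univ.exists_sInf_image_eq_and_le univ_nonempty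
      (hcont'.comp (by fun_prop : Continuous fun y : Icc a b ↦ (c, y))).continuousOn
    exact ⟨s, hs, fun y ↦ hs.le.trans (hs' y (mem_univ y))⟩
  have hm₀ : 1 ≤ m ⟨c₀, le_rfl, hc⟩ := by
    obtain ⟨s, hs, -⟩ := hmin ⟨c₀, le_rfl, hc⟩
    rw [hs]
    exact h₀ s s.2
  have hm₁ : m ⟨c₁, hc, le_rfl⟩ < 1 := by
    obtain ⟨y, hy, hlt⟩ := h₁
    obtain ⟨s, -, hs⟩ := hmin ⟨c₁, hc, le_rfl⟩
    exact (hs ⟨y, hy⟩).trans_lt hlt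
  refine ⟨1 - m ⟨c₁, hc, le_rfl⟩, by linarith, fun l hl hl' ↦ ?_⟩
  have : PreconnectedSpace (Icc c₀ c₁) := Subtype.preconnectedSpace isPreconnected_Icc
  obtain ⟨c, hcl⟩ := intermediate_value_univ ⟨c₁, hc, le_rfl⟩ ⟨c₀, le_rfl, hc⟩ hmc
    (show 1 - l ∈ Icc _ _ from ⟨by linarith, by linarith⟩)
  obtain ⟨s, hs, hmin⟩ := hmin c
  have hcc : c₀ < c := by
    refine lt_of_le_of_ne c.2.1 fun h ↦ ?_
    have : c = ⟨c₀, le_rfl, hc⟩ := Subtype.ext h.symm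
    rw [this] at hcl
    linarith
  have has : a < s := by
    refine lt_of_le_of_ne s.2.1 fun h ↦ ?_
    rw [← h, ha c c.2] at hs
    linarith
  have hsb : s < b := by
    refine lt_of_le_of_ne s.2.2 fun h ↦ ?_
    obtain ⟨d, hd, hder⟩ := hb c c.2
    obtain ⟨x, hx, hlt⟩ := hder.exists_lt_of_pos hd hab
    have := hmin ⟨x, Ioo_subset_Icc_self hx⟩
    rw [hs, h] at this
    exact absurd hlt this.not_gt
  refine ⟨c, ⟨hcc, c.2.2⟩, s, ⟨has, hsb⟩, hs.symm.trans hcl, ?_⟩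
  filter_upwards [Icc_mem_nhds has hsb] with y hy
  exact hs ▸ hmin ⟨y, hy⟩

/-- If `g'' > 0` on `(1, T)` and `g 1 = g' 1 = 1`, then `g` lies above the diagonal and `g y / y`
is increasing. -/
theorem lt_and_lt_mul_of_deriv_deriv_pos {g p q : ℝ → ℝ} {T : ℝ}
    (hg : ∀ y ∈ Icc 1 T, HasDerivAt g (p y) y) (hp : ∀ y ∈ Icc 1 T, HasDerivAt p (q y) y)
    (hq : ∀ y ∈ Ioo 1 T, 0 < q y) (hg₁ : g 1 = 1) (hp₁ : p 1 = 1) :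
    ∀ y ∈ Ioc 1 T, y < g y ∧ g y < y * p y := by
  have hpos : ∀ u u' : ℝ → ℝ, (∀ y ∈ Icc 1 T, HasDerivAt u (u' y) y) →
      (∀ y ∈ Ioo 1 T, 0 < u' y) → ∀ y ∈ Ioc 1 T, u 1 < u y := by
    intro u u' hu hu' y hy
    refine strictMonoOn_of_deriv_pos (convex_Icc 1 T)
      (fun x hx ↦ (hu x hx).continuousAt.continuousWithinAt) (fun x hx ↦ ?_)
      ⟨le_rfl, hy.1.le.trans hy.2⟩ (Ioc_subset_Icc_self hy) hy.1
    rw [interior_Icc] at hx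
    rw [(hu x (Ioo_subset_Icc_self hx)).deriv]
    exact hu' x hx
  intro y hy
  have hp_gt : ∀ y ∈ Ioo 1 T, 1 < p y := fun y hy ↦
    hp₁ ▸ hpos p q hp hq y (Ioo_subset_Ioc_self hy)
  have h1 := hpos (fun y ↦ g y - y) (fun y ↦ p y - 1)
    (fun y hy ↦ (hg y hy).sub (hasDerivAt_id y)) (fun y hy ↦ by linarith [hp_gt y hy]) y hy
  have h2 := hpos (fun y ↦ y * p y - g y) (fun y ↦ y * q y)
    (fun y hy ↦ (((hasDerivAt_id' y).fun_mul (hp y hy)).fun_sub (hg y hy)).congr_deriv (by ring))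
    (fun y hy ↦ mul_pos (by linarith [hy.1]) (hq y hy)) y hy
  simp only [hg₁, hp₁] at h1 h2
  constructor <;> linarith

/-- The right-hand side of the shadow price ODE at `X = (c, y, g, g')`. -/
noncomputable def shadowRHS (θ k : ℝ) (X : ℝ × ℝ × ℝ × ℝ) : ℝ :=
  2 * X.2.2.2 ^ 2 / (X.1 + X.2.2.1) - 2 * θ * X.2.2.2 / X.2.1
    + k * (1 + X.2.2.1 / X.1) * (X.2.2.1 / X.2.1 ^ 2 - X.2.2.2 / X.2.1)

theorem contDiffAt_shadowRHS (θ k : ℝ) {c y g p : ℝ} (hc : 0 < c) (hy : 0 < y) (hg : 0 < g) :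
    ContDiffAt ℝ 1 (shadowRHS θ k) (c, y, g, p) := by
  unfold shadowRHS
  have h : c + g ≠ 0 := (add_pos hc hg).ne'
  have := hc.ne'
  have := hy.ne'
  have : y ^ 2 ≠ 0 := pow_ne_zero 2 this
  fun_prop (disch := assumption)

/-- At the critical parameter `(1 - θ) / θ`, the second derivative vanishes at `1` and has
positive derivative there. -/
theorem hasDerivAt_shadowRHS {θ : ℝ} (k : ℝ) (hθ : θ ∈ Ioo (0 : ℝ) 1) {g p : ℝ → ℝ}
    (hg₁ : g 1 = 1) (hp₁ : p 1 = 1) (hg : HasDerivAt g 1 1) (hp : HasDerivAt p 0 1) :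
    HasDerivAt (fun y ↦ shadowRHS θ k ((1 - θ) / θ, y, g y, p y)) (2 * θ * (1 - θ)) 1 := by
  obtain ⟨h0, h1⟩ := hθ
  have hθ1 : 1 - θ ≠ 0 := by linarith
  have hc : (1 - θ) / θ + 1 = θ⁻¹ := by field_simp; ring
  have hid := hasDerivAt_id (1 : ℝ)
  have h := ((((hp.pow 2).const_mul 2).div (hg.const_add ((1 - θ) / θ))
    (by rw [hg₁, hc]; positivity)).sub ((hp.const_mul (2 * θ)).div hid (by simp))).add
    ((((hg.div_const ((1 - θ) / θ)).const_add 1).const_mul k).mul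
      ((hg.div (hid.pow 2) (by simp)).sub (hp.div hid (by simp))))
  convert! h using 1
  simp [hg₁, hp₁, hc]
  field_simp
  ring

/-- A twice differentiable function whose second derivative is continuous is `C²`. -/
theorem contDiffOn_two_of_hasDerivAt {g p q : ℝ → ℝ} {U : Set ℝ} (hU : IsOpen U)
    (hg : ∀ y ∈ U, HasDerivAt g (p y) y) (hp : ∀ y ∈ U, HasDerivAt p (q y) y)
    (hq : ContinuousOn q U) : ContDiffOn ℝ 2 g U := by
  have h1 : ContDiffOn ℝ 1 p U := by
    rw [show (1 : WithTop ℕ∞) = 0 + 1 from rfl, contDiffOn_succ_iff_deriv_of_isOpen hU]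
    refine ⟨fun y hy ↦ (hp y hy).differentiableAt.differentiableWithinAt, by simp, ?_⟩
    exact contDiffOn_zero.mpr (hq.congr fun y hy ↦ (hp y hy).deriv)
  rw [show (2 : WithTop ℕ∞) = 1 + 1 from rfl, contDiffOn_succ_iff_deriv_of_isOpen hU]
  exact ⟨fun y hy ↦ (hg y hy).differentiableAt.differentiableWithinAt, by simp,
    h1.congr fun y hy ↦ (hg y hy).deriv⟩

theorem shadowRHS_one {θ k c g p : ℝ} (hg : g = 1) (hp : p = 1) :
    shadowRHS θ k (c, 1, g, p) = 2 / (c + 1) - 2 * θ := by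
  simp [shadowRHS, hg, hp]

/-- Solutions of the shadow price ODE with `g 1 = g' 1 = 1`, for parameters near `c₀` and on a
common neighbourhood of `1`; they are positive and increasing. -/
theorem exists_shadow_family (θ k : ℝ) {c₀ : ℝ} (hc₀ : 0 < c₀) :
    ∃ r > (0 : ℝ), ∃ G P : ℝ × ℝ → ℝ,
      (∀ c ∈ Ioo (c₀ - r) (c₀ + r), G (c, 1) = 1 ∧ P (c, 1) = 1 ∧ ∀ y ∈ Ioo (1 - r) (1 + r),
        0 < P (c, y) ∧ HasDerivAt (fun y ↦ G (c, y)) (P (c, y)) y ∧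
        HasDerivAt (fun y ↦ P (c, y)) (shadowRHS θ k (c, y, G (c, y), P (c, y))) y ∧
        ContinuousAt (fun y ↦ shadowRHS θ k (c, y, G (c, y), P (c, y))) y) ∧
      ContinuousOn G (Ioo (c₀ - r) (c₀ + r) ×ˢ Ioo (1 - r) (1 + r)) ∧
      ContinuousOn P (Ioo (c₀ - r) (c₀ + r) ×ˢ Ioo (1 - r) (1 + r)) := by
  obtain ⟨ε, hε, G, P, hsol, hGc, hPc⟩ := exists_secondOrder_family
    (contDiffAt_shadowRHS θ k (p := 1) hc₀ one_pos one_pos)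
  have hmem : Icc (c₀ - ε) (c₀ + ε) ×ˢ Icc (1 - ε) (1 + ε) ∈ 𝓝 (c₀, (1 : ℝ)) :=
    prod_mem_nhds (Icc_mem_nhds (by linarith) (by linarith))
      (Icc_mem_nhds (by linarith) (by linarith))
  obtain ⟨hG₀, hP₀, -⟩ := hsol c₀ ⟨by linarith, by linarith⟩
  have hev : ∀ᶠ x in 𝓝 (c₀, (1 : ℝ)), 0 < x.1 ∧ 0 < x.2 ∧ 0 < G x ∧ 0 < P x := by
    refine (continuousAt_fst (p := (c₀, (1 : ℝ))) |>.eventually_const_lt hc₀).and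
      ((continuousAt_snd (p := (c₀, (1 : ℝ))) |>.eventually_const_lt one_pos).and
        (((hGc.continuousAt hmem).eventually_const_lt ?_).and
          ((hPc.continuousAt hmem).eventually_const_lt ?_)))
    · rw [hG₀]; exact one_pos
    · rw [hP₀]; exact one_pos
  obtain ⟨η, hη, hball⟩ := Metric.eventually_nhds_iff_ball.mp hev
  have h1 := min_le_left ε η
  have h2 := min_le_right ε η
  refine ⟨min ε η, lt_min hε hη, G, P, ?_⟩
  have hI : Ioo (c₀ - min ε η) (c₀ + min ε η) ⊆ Icc (c₀ - ε) (c₀ + ε) := fun c hc ↦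
    ⟨by linarith [hc.1], by linarith [hc.2]⟩
  have hJ : Ioo (1 - min ε η) (1 + min ε η) ⊆ Ioo (1 - ε) (1 + ε) :=
    Ioo_subset_Ioo (by linarith) (by linarith)
  have hpos : ∀ c ∈ Ioo (c₀ - min ε η) (c₀ + min ε η), ∀ y ∈ Ioo (1 - min ε η) (1 + min ε η),
      0 < c ∧ 0 < y ∧ 0 < G (c, y) ∧ 0 < P (c, y) := by
    intro c hc y hy
    refine hball (c, y) ?_
    rw [← ball_prod_same, Real.ball_eq_Ioo, Real.ball_eq_Ioo]
    exact ⟨Ioo_subset_Ioo (by linarith) (by linarith) hc,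
      Ioo_subset_Ioo (by linarith) (by linarith) hy⟩
  refine ⟨fun c hc ↦ ⟨(hsol c (hI hc)).1, (hsol c (hI hc)).2.1, fun y hy ↦ ?_⟩,
    hGc.mono (prod_mono hI (hJ.trans Ioo_subset_Icc_self)),
    hPc.mono (prod_mono hI (hJ.trans Ioo_subset_Icc_self))⟩
  obtain ⟨hc', hy', hg', hp'⟩ := hpos c hc y hy
  obtain ⟨hGd, hPd⟩ := (hsol c (hI hc)).2.2 y (hJ hy)
  refine ⟨hp', hGd, hPd, ?_⟩
  exact (contDiffAt_shadowRHS θ k hc' hy' hg').continuousAt.comp'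
    (f := fun y ↦ (c, y, G (c, y), P (c, y)))
    (continuousAt_const.prodMk (continuousAt_id.prodMk (hGd.continuousAt.prodMk hPd.continuousAt)))

/-- Existence of a solution to the free boundary value problem determining the
shadow price (Lemma 4.1): for sufficiently small transaction cost `λ` there are
constants `c > (1-θ)/θ`, `s̄ > 1` and a `C²` function `g : [1,s̄] → [1,(1-λ)s̄]`
solving the shadow-price ODE with smooth pasting boundary conditions. -/
theorem free_boundary_existence
    (μ σ δ θ : ℝ) (hμ : 0 < μ) (hσ : 0 < σ) (hδ : 0 < δ)
    (hθdef : θ = μ / σ ^ 2) (hθ : θ ∈ Ioo (0:ℝ) 1) :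
    ∃ lam₀ > (0:ℝ), ∀ lam : ℝ, 0 < lam → lam < lam₀ →
      ∃ (c sbar : ℝ) (g : ℝ → ℝ),
        (1 - θ) / θ < c ∧ 1 < sbar ∧
        (∀ y ∈ Icc (1:ℝ) sbar, g y ∈ Icc (1:ℝ) ((1 - lam) * sbar)) ∧
        ContDiffOn ℝ 2 g (Icc 1 sbar) ∧
        (∀ y ∈ Icc (1:ℝ) sbar,
          deriv (deriv g) y = 2 * (deriv g y) ^ 2 / (c + g y)
            - 2 * θ * deriv g y / y
            + 2 * δ / σ ^ 2 * (1 + g y / c) * (g y / y ^ 2 - deriv g y / y)) ∧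
        g 1 = 1 ∧ deriv g 1 = 1 ∧
        g sbar = (1 - lam) * sbar ∧ deriv g sbar = 1 - lam := by
  set k := 2 * δ / σ ^ 2
  have hθ0 := hθ.1
  have hθ1 := hθ.2
  set c₀ := (1 - θ) / θ with hc₀
  have hc₀_pos : 0 < c₀ := div_pos (by linarith) hθ0
  have hc₀θ : (c₀ + 1) * θ = 1 := by rw [hc₀]; field_simp; ring
  obtain ⟨r, hr, G, P, hfam, hGc, hPc⟩ := exists_shadow_family θ k hc₀_pos
  have hG₁ c hc := (hfam c hc).1
  have hP₁ c hc := (hfam c hc).2.1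
  have hpos c hc y hy := ((hfam c hc).2.2 y hy).1
  have hG c hc y hy := ((hfam c hc).2.2 y hy).2.1
  have hP c hc y hy := ((hfam c hc).2.2 y hy).2.2.1
  have hRHS c hc y hy := ((hfam c hc).2.2 y hy).2.2.2
  have hcI {c : ℝ} (hc : c ∈ Ico c₀ (c₀ + r)) : c ∈ Ioo (c₀ - r) (c₀ + r) :=
    ⟨by linarith [hc.1], hc.2⟩
  have hc₀I : c₀ ∈ Ioo (c₀ - r) (c₀ + r) := hcI ⟨le_rfl, by linarith⟩
  have h1I : (1 : ℝ) ∈ Ioo (1 - r) (1 + r) := ⟨by linarith, by linarith⟩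
  -- choice of the end point `T`: at `c₀`, the second derivative is positive on `(1, T]`
  obtain ⟨T, hT1, hTr, hT⟩ : ∃ T, 1 < T ∧ T < 1 + r ∧
      ∀ y ∈ Ioc 1 T, 0 < shadowRHS θ k (c₀, y, G (c₀, y), P (c₀, y)) := by
    have hd1 : HasDerivAt (fun y ↦ P (c₀, y)) 0 1 := by
      refine (hP c₀ hc₀I 1 h1I).congr_deriv ?_
      rw [shadowRHS_one (hG₁ c₀ hc₀I) (hP₁ c₀ hc₀I)]
      field_simp
      linarith
    have hd := hasDerivAt_shadowRHS k hθ (hG₁ c₀ hc₀I) (hP₁ c₀ hc₀I)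
      ((hG c₀ hc₀I 1 h1I).congr_deriv (hP₁ c₀ hc₀I)) hd1
    have hsign := eventually_nhdsWithin_sign_eq_of_deriv_pos
      (f := fun y ↦ shadowRHS θ k (c₀, y, G (c₀, y), P (c₀, y)))
      (by rw [hd.deriv]; exact mul_pos (by linarith) (by linarith))
      ((hP c₀ hc₀I 1 h1I).unique hd1)
    obtain ⟨T, hT, hTs⟩ := mem_nhdsGT_iff_exists_Ioc_subset.mp
      ((hsign.filter_mono nhdsWithin_le_nhds).and
        (Ioo_mem_nhdsGT (show (1 : ℝ) < 1 + r by linarith)))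
    refine ⟨T, hT, (hTs ⟨hT, le_rfl⟩).2.2, fun y hy ↦ ?_⟩
    have := (hTs hy).1
    rwa [sign_pos (sub_pos.mpr hy.1), sign_eq_one_iff] at this
  have hIT {y : ℝ} (hy : y ∈ Icc 1 T) : y ∈ Ioo (1 - r) (1 + r) :=
    ⟨by linarith [hy.1], by linarith [hy.2]⟩
  have hTT : T ∈ Icc 1 T := ⟨hT1.le, le_rfl⟩
  have hbase := lt_and_lt_mul_of_deriv_deriv_pos (fun y hy ↦ hG c₀ hc₀I y (hIT hy))
    (fun y hy ↦ hP c₀ hc₀I y (hIT hy)) (fun y hy ↦ hT y (Ioo_subset_Ioc_self hy))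
    (hG₁ c₀ hc₀I) (hP₁ c₀ hc₀I)
  -- choice of the largest parameter `c₁`
  obtain ⟨c₁, hc₁, hc₁r, hend⟩ : ∃ c₁, c₀ < c₁ ∧ c₁ < c₀ + r ∧
      ∀ c ∈ Icc c₀ c₁, G (c, T) < T * P (c, T) := by
    have hmem : Ioo (c₀ - r) (c₀ + r) ×ˢ Ioo (1 - r) (1 + r) ∈ 𝓝 (c₀, T) :=
      prod_mem_nhds (isOpen_Ioo.mem_nhds hc₀I) (isOpen_Ioo.mem_nhds (hIT hTT))
    have hGT : ContinuousAt (fun c ↦ G (c, T)) c₀ :=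
      (hGc.continuousAt hmem).comp' (f := fun c : ℝ ↦ (c, T)) (by fun_prop)
    have hPT : ContinuousAt (fun c ↦ T * P (c, T)) c₀ :=
      ((hPc.continuousAt hmem).comp' (f := fun c : ℝ ↦ (c, T)) (by fun_prop)).const_mul T
    have hev := hGT.eventually_lt hPT (hbase T ⟨hT1, le_rfl⟩).2
    obtain ⟨c₁, hc₁, hs⟩ := mem_nhdsGE_iff_exists_Icc_subset.mp
      ((hev.filter_mono nhdsWithin_le_nhds).and
        (Ico_mem_nhdsGE (show c₀ < c₀ + r by linarith)))
    exact ⟨c₁, hc₁, (hs ⟨(mem_Ioi.mp hc₁).le, le_rfl⟩).2.2, fun c hc ↦ (hs hc).1⟩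
  have hcI' {c : ℝ} (hc : c ∈ Icc c₀ c₁) : c ∈ Ioo (c₀ - r) (c₀ + r) :=
    hcI ⟨hc.1, hc.2.trans_lt hc₁r⟩
  have hc₁I : c₁ ∈ Ioo (c₀ - r) (c₀ + r) := hcI' ⟨hc₁.le, le_rfl⟩
  have hquot : ∀ c ∈ Icc c₀ c₁, ∀ y ∈ Icc 1 T, HasDerivAt (fun y ↦ G (c, y) / y)
      ((P (c, y) * y - G (c, y) * 1) / y ^ 2) y := fun c hc y hy ↦
    (hG c (hcI' hc) y (hIT hy)).fun_div (hasDerivAt_id' y) (by linarith [hy.1])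
  obtain ⟨l₀, hl₀, H⟩ := exists_isLocalMin_eq (h := fun x ↦ G x / x.2) hT1 hc₁.le
    (((hGc.mono (prod_mono (fun c hc ↦ hcI' hc) fun y hy ↦ hIT hy))).div (by fun_prop)
      fun x hx ↦ by linarith [hx.2.1])
    (fun c hc ↦ by simp [hG₁ c (hcI' hc)])
    (fun c hc ↦ ⟨_, div_pos (by linarith [hend c hc]) (by positivity), hquot c hc T hTT⟩)
    (fun y hy ↦ by
      rcases hy.1.eq_or_lt with rfl | h
      · simp [hG₁ c₀ hc₀I]
      · rw [one_le_div (by linarith)]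
        exact (hbase y ⟨h, hy.2⟩).1.le)
    (by
      have hneg : shadowRHS θ k (c₁, 1, G (c₁, 1), P (c₁, 1)) < 0 := by
        rw [shadowRHS_one (hG₁ c₁ hc₁I) (hP₁ c₁ hc₁I), sub_neg, div_lt_iff₀ (by linarith)]
        nlinarith
      have hev := (hRHS c₁ hc₁I 1 h1I).tendsto.eventually_lt_const hneg
      obtain ⟨t, ht, hs⟩ := mem_nhdsGE_iff_exists_Icc_subset.mp
        ((hev.filter_mono nhdsWithin_le_nhds).and (Ico_mem_nhdsGE hT1))
      have htI : t ∈ Icc 1 t := ⟨(mem_Ioi.mp ht).le, le_rfl⟩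
      have hIt : ∀ y ∈ Icc 1 t, y ∈ Ioo (1 - r) (1 + r) := fun y hy ↦
        hIT ⟨hy.1, (hs hy).2.2.le⟩
      have h := lt_and_lt_mul_of_deriv_deriv_pos
        (fun y hy ↦ ((hasDerivAt_id' y).const_mul 2).fun_sub (hG c₁ hc₁I y (hIt y hy)))
        (fun y hy ↦ (hP c₁ hc₁I y (hIt y hy)).const_sub (2 * 1))
        (fun y hy ↦ neg_pos.mpr (hs (Ioo_subset_Icc_self hy)).1)
        (by rw [hG₁ c₁ hc₁I]; norm_num) (by rw [hP₁ c₁ hc₁I]; norm_num) t ⟨ht, le_rfl⟩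
      refine ⟨t, ⟨htI.1, (hs htI).2.2.le⟩, ?_⟩
      have : 0 < t := by linarith [htI.1]
      rw [div_lt_one this]
      linarith [h.1])
  refine ⟨l₀, hl₀, fun l hl hl' ↦ ?_⟩
  obtain ⟨c, hc, s, hs, hval, hmin⟩ := H l hl hl'
  have hcI₁ := hcI' (Ioc_subset_Icc_self hc)
  have hs0 : 0 < s := by linarith [hs.1]
  have hGs : G (c, s) = (1 - l) * s := (div_eq_iff hs0.ne').mp hval
  have hPs : P (c, s) = 1 - l := by
    have h := hmin.hasDerivAt_eq_zero
      (hquot c (Ioc_subset_Icc_self hc) s (Ioo_subset_Icc_self hs))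
    rw [div_eq_zero_iff, or_iff_left (by positivity), hGs] at h
    exact mul_right_cancel₀ hs0.ne' (by linarith)
  have hsub : Icc 1 s ⊆ Ioo (1 - r) (1 + r) := fun y hy ↦ hIT ⟨hy.1, hy.2.trans hs.2.le⟩
  have hderiv : ∀ y ∈ Ioo (1 - r) (1 + r), deriv (fun y ↦ G (c, y)) y = P (c, y) :=
    fun y hy ↦ (hG c hcI₁ y hy).deriv
  have hs1 : s ∈ Icc 1 s := ⟨hs.1.le, le_rfl⟩
  have h1s : (1 : ℝ) ∈ Icc 1 s := ⟨le_rfl, hs.1.le⟩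
  have hmono : MonotoneOn (fun y ↦ G (c, y)) (Icc 1 s) :=
    monotoneOn_of_hasDerivWithinAt_nonneg (convex_Icc 1 s)
      (fun y hy ↦ (hG c hcI₁ y (hsub hy)).continuousAt.continuousWithinAt)
      (fun y hy ↦ (hG c hcI₁ y (hsub (interior_subset hy))).hasDerivWithinAt)
      fun y hy ↦ (hpos c hcI₁ y (hsub (interior_subset hy))).le
  refine ⟨c, s, fun y ↦ G (c, y), hc.1, hs.1, fun y hy ↦ ⟨?_, ?_⟩, ?_, fun y hy ↦ ?_,
    hG₁ c hcI₁, ?_, hGs, ?_⟩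
  · exact hG₁ c hcI₁ ▸ hmono h1s hy hy.1
  · exact hGs ▸ hmono hy hs1 hy.2
  · exact (contDiffOn_two_of_hasDerivAt isOpen_Ioo (hG c hcI₁) (hP c hcI₁)
      fun y hy ↦ (hRHS c hcI₁ y hy).continuousWithinAt).mono hsub
  · have h : deriv (fun y ↦ G (c, y)) =ᶠ[𝓝 y] fun y ↦ P (c, y) := by
      filter_upwards [isOpen_Ioo.mem_nhds (hsub hy)] using hderiv
    rw [h.deriv_eq, (hP c hcI₁ y (hsub hy)).deriv, hderiv y (hsub hy)]
    rfl
  · rw [hderiv 1 (hsub h1s), hP₁ c hcI₁]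
  · rw [hderiv s (hsub hs1), hPs]
end

section
/- With $\theta\in(0,1)$, $\delta,\sigma>0$, and $\bar{c}=(1-\theta)/\theta$, the solution $c=c(\lambda)$ of the free boundary problem satisfies, as $\lambda\downarrow 0$: $c=\bar{c}+\frac{1-\theta}{2\theta}\left(\frac{6}{\theta(1-\theta)}\right)^{1/3}\lambda^{1/3}+\frac{2\delta/\sigma^2+3(1-\theta)^2}{12\theta}\left(\frac{6}{\theta(1-\theta)}\right)^{2/3}\lambda^{2/3}+O(\lambda)$. In particular, $c>\bar{c}$ for all sufficiently small $\lambda>0$. -/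
open Set Filter Asymptotics Real

theorem abs_sub_le_of_hasDerivWithinAt_Icc {f f' : ℝ → ℝ} {a b C s t : ℝ}
    (hf : ∀ x ∈ Icc a b, HasDerivWithinAt f (f' x) (Icc a b) x)
    (hC : ∀ x ∈ Icc a b, |f' x| ≤ C) (hs : s ∈ Icc a b) (ht : t ∈ Icc a b) :
    |f s - f t| ≤ C * |s - t| := by
  simpa using (convex_Icc a b).norm_image_sub_le_of_norm_hasDerivWithin_le hf hC ht hs

theorem exists_hasDerivWithinAt_Icc {f : ℝ → ℝ} {a b c : ℝ} (hab : a ≤ b)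
    (hf : ContinuousOn f (Icc a b)) :
    ∃ F : ℝ → ℝ, F c = 0 ∧ ∀ t ∈ Icc a b, HasDerivWithinAt F (f t) (Icc a b) t := by
  have hcont : Continuous (IccExtend hab ((Icc a b).domRestrict f)) :=
    hf.domRestrict.Icc_extend'
  refine ⟨fun t => ∫ x in c..t, IccExtend hab ((Icc a b).domRestrict f) x, by simp, fun t ht => ?_⟩
  have := (hcont.integral_hasStrictDerivAt c t).hasDerivAt.hasDerivWithinAt (s := Icc a b)
  rwa [IccExtend_of_mem _ _ ht] at this

theorem exists_solution_family {G : ℝ × ℝ × ℝ → ℝ} {R ε₀ L : ℝ} {K : NNReal}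
    (hε₀ : 0 < ε₀) (hL : 0 ≤ L) (hR : 3 * L ≤ R)
    (hLip : LipschitzOnWith K G (Icc (-2) 2 ×ˢ Icc (-R) R ×ˢ Icc (-ε₀) ε₀))
    (hbd : ∀ p ∈ (Icc (-2) 2 ×ˢ Icc (-R) R ×ˢ Icc (-ε₀) ε₀ : Set (ℝ × ℝ × ℝ)), |G p| ≤ L) :
    ∃ r : ℝ → ℝ → ℝ, ∃ M : ℝ, 0 ≤ M ∧
      (∀ ε ∈ Icc 0 ε₀, r ε (-1) = 0 ∧ ∀ s ∈ Icc (-2 : ℝ) 2, |r ε s| ≤ R ∧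
        HasDerivWithinAt (r ε) (G (s, r ε s, ε)) (Icc (-2) 2) s) ∧
      ∀ ε ∈ Icc 0 ε₀, ∀ ε' ∈ Icc 0 ε₀, ∀ s ∈ Icc (-2 : ℝ) 2,
        |r ε s - r ε' s| ≤ M * |ε - ε'| := by
  have hR0 : -R ≤ R := by linarith
  have hE0 : -ε₀ ≤ ε₀ := by linarith
  set φ : ℝ × ℝ → ℝ × ℝ := fun x => ((projIcc (-R) R hR0 x.1 : ℝ), (projIcc (-ε₀) ε₀ hE0 x.2 : ℝ))
    with hφ
  have hφL : LipschitzWith 1 φ := by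
    have h1 : LipschitzWith 1 fun x : ℝ × ℝ => (projIcc (-R) R hR0 x.1 : ℝ) := by
      simpa using! (LipschitzWith.subtype_val _).comp
        ((LipschitzWith.projIcc hR0).comp LipschitzWith.prod_fst)
    have h2 : LipschitzWith 1 fun x : ℝ × ℝ => (projIcc (-ε₀) ε₀ hE0 x.2 : ℝ) := by
      simpa using! (LipschitzWith.subtype_val _).comp
        ((LipschitzWith.projIcc hE0).comp LipschitzWith.prod_snd)
    simpa using h1.prodMk h2
  have hmem : ∀ s ∈ Icc (-2 : ℝ) 2, ∀ x, (s, φ x) ∈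
      (Icc (-2) 2 ×ˢ Icc (-R) R ×ˢ Icc (-ε₀) ε₀ : Set (ℝ × ℝ × ℝ)) := fun s hs x =>
    ⟨hs, Subtype.property _, Subtype.property _⟩
  have hφid : ∀ x : ℝ × ℝ, x.1 ∈ Icc (-R) R → x.2 ∈ Icc (-ε₀) ε₀ → φ x = x := by
    intro x h1 h2
    simp only [hφ, projIcc_of_mem _ h1, projIcc_of_mem _ h2]
  set f : ℝ → ℝ × ℝ → ℝ × ℝ := fun s x => (G (s, φ x), 0) with hf
  have hm1 : (-1 : ℝ) ∈ Icc (-2 : ℝ) 2 := by norm_num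
  have hPL : IsPicardLindelof f (⟨-1, hm1⟩ : Icc (-2 : ℝ) 2) (0 : ℝ × ℝ)
      ((3 * L + ε₀).toNNReal) ε₀.toNNReal L.toNNReal K := by
    refine ⟨fun s hs => ?_, fun x _ => ?_, fun s hs x _ => ?_, ?_⟩
    · refine LipschitzOnWith.of_dist_le_mul fun x _ y _ => ?_
      have h1 := hLip.dist_le_mul _ (hmem s hs x) _ (hmem s hs y)
      have h2 := hφL.dist_le_mul x y
      simp only [hf, Prod.dist_eq (α := ℝ) (β := ℝ), dist_self]
      simp only [Prod.dist_eq (α := ℝ) (β := ℝ × ℝ), dist_self] at h1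
      rw [max_eq_left dist_nonneg]
      refine h1.trans ?_
      rw [max_eq_right dist_nonneg]
      gcongr
      simpa [Prod.dist_eq (α := ℝ) (β := ℝ)] using h2
    · have h1 : ContinuousOn (fun s : ℝ => G (s, φ x)) (Icc (-2) 2) :=
        hLip.continuousOn.comp (by fun_prop) fun s hs => hmem s hs x
      exact h1.prodMk continuousOn_const
    · rw [Real.coe_toNNReal _ hL, Prod.norm_def]
      simpa [hf, hL] using hbd _ (hmem s hs x)
    · rw [Real.coe_toNNReal _ hL, Real.coe_toNNReal _ hε₀.le,
        Real.coe_toNNReal _ (by positivity)]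
      norm_num
      linarith
  obtain ⟨α, hα, L', hL'⟩ :=
    hPL.exists_forall_mem_closedBall_eq_hasDerivWithinAt_lipschitzOnWith
  have hball : ∀ ε ∈ Icc 0 ε₀, ((0 : ℝ), ε) ∈ Metric.closedBall (0 : ℝ × ℝ) ε₀.toNNReal := by
    intro ε hε
    rw [Real.coe_toNNReal _ hε₀.le, mem_closedBall_zero_iff, Prod.norm_def]
    simp [abs_of_nonneg hε.1, hε.2, hε₀.le]
  refine ⟨fun ε s => (α (0, ε) s).1, L', L'.2, fun ε hε => ?_, fun ε hε ε' hε' s hs => ?_⟩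
  · obtain ⟨h0, hd⟩ := hα _ (hball ε hε)
    have hd1 : ∀ s ∈ Icc (-2 : ℝ) 2, HasDerivWithinAt (fun s => (α (0, ε) s).1)
        (G (s, φ (α (0, ε) s))) (Icc (-2) 2) s := fun s hs => (hd s hs).fst
    have hd2 : ∀ s ∈ Icc (-2 : ℝ) 2, HasDerivWithinAt (fun s => (α (0, ε) s).2)
        ((fun _ => 0) s) (Icc (-2) 2) s := fun s hs => (hd s hs).snd
    have hz1 : (α (0, ε) (-1)).1 = 0 := by simp [h0]
    have hz2 : (α (0, ε) (-1)).2 = ε := by simp [h0]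
    have hb : ∀ s ∈ Icc (-2 : ℝ) 2, |(α (0, ε) s).1| ≤ R := by
      intro s hs
      have := abs_sub_le_of_hasDerivWithinAt_Icc hd1 (fun s hs => hbd _ (hmem s hs _)) hs hm1
      rw [hz1, sub_zero] at this
      refine this.trans (le_trans ?_ hR)
      rw [mul_comm]
      gcongr
      rw [abs_le]; constructor <;> linarith [hs.1, hs.2]
    have he : ∀ s ∈ Icc (-2 : ℝ) 2, (α (0, ε) s).2 = ε := by
      intro s hs
      have := abs_sub_le_of_hasDerivWithinAt_Icc (C := 0) hd2 (fun s hs => by simp) hs hm1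
      rw [hz2, zero_mul] at this
      linarith [abs_nonpos_iff.mp this]
    refine ⟨hz1, fun s hs => ⟨hb s hs, ?_⟩⟩
    have := hd1 s hs
    rwa [hφid _ (abs_le.mp (hb s hs)) (by rw [he s hs]; exact ⟨by linarith [hε.1], hε.2⟩),
      show α (0, ε) s = ((α (0, ε) s).1, ε) from Prod.ext rfl (he s hs)] at this
  · have := (hL' s hs).dist_le_mul _ (hball ε hε) _ (hball ε' hε')
    have h2 := (le_max_left _ _).trans (Prod.dist_eq (α := ℝ) (β := ℝ) ▸ this)
    simpa [Prod.dist_eq, Real.dist_eq] using h2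

/-- The reciprocal of the variance-type factor `m (1 - m)` at `m = θ + x`. -/
noncomputable def weight (θ x : ℝ) : ℝ := 1 / ((θ + x) * (1 - θ - x))

/-- The rescaled vector field, as a function of `(s, r, ε)`. -/
noncomputable def scaledField (θ k : ℝ) (p : ℝ × ℝ × ℝ) : ℝ :=
  (1 - p.2.2 ^ 2 * p.2.1) * (2 * p.1 + p.2.2 * (2 * θ - 1) * p.2.1
    - k * p.2.2 * (1 - p.2.2 ^ 2 * p.2.1) * p.2.1 * (1 / (1 - θ - p.2.2 * p.1)))
    * weight θ (p.2.2 * p.1)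

/-- The box of triples `(s, r, ε)` on which the rescaled problem is studied. -/
def box (R ε : ℝ) : Set (ℝ × ℝ × ℝ) := Icc (-2) 2 ×ˢ Icc (-R) R ×ˢ Icc (-ε) ε

theorem isCompact_box (R ε : ℝ) : IsCompact (box R ε) :=
  isCompact_Icc.prod (isCompact_Icc.prod isCompact_Icc)

theorem convex_box (R ε : ℝ) : Convex ℝ (box R ε) :=
  (convex_Icc _ _).prod ((convex_Icc _ _).prod (convex_Icc _ _))

theorem pos_of_mem_box {θ R ε : ℝ} {p : ℝ × ℝ × ℝ} (h₁ : 4 * ε ≤ θ) (h₂ : 4 * ε ≤ 1 - θ)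
    (hθ : 0 < θ) (hθ' : θ < 1)
    (hp : p ∈ box R ε) : 0 < θ + p.2.2 * p.1 ∧ 0 < 1 - θ - p.2.2 * p.1 := by
  obtain ⟨hs, -, he⟩ := hp
  have h3 : |p.2.2 * p.1| ≤ ε * 2 := by
    rw [abs_mul]
    exact mul_le_mul (abs_le.2 he) (abs_le.2 hs) (abs_nonneg _) ((abs_nonneg _).trans (abs_le.2 he))
  rw [abs_le] at h3
  constructor <;> linarith [h3.1, h3.2]

theorem weight_expansion {θ x : ℝ} (hθ : 0 < θ) (hθ' : θ < 1) (h₁ : 0 < θ + x)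
    (h₂ : 0 < 1 - θ - x) :
    weight θ x = 1 / (θ * (1 - θ)) - x * (1 - 2 * θ) / (θ * (1 - θ)) ^ 2
      + x ^ 2 * ((θ * (1 - θ) + (1 - 2 * θ) ^ 2 - (1 - 2 * θ) * x) / (θ * (1 - θ)) ^ 2
        * weight θ x) := by
  have h3 : 1 - θ ≠ 0 := by linarith
  rw [weight]
  have := h₂.ne'
  field_simp
  ring

theorem inv_expansion {θ x : ℝ} (hθ' : θ < 1) (h₂ : 0 < 1 - θ - x) :
    1 / (1 - θ - x) = 1 / (1 - θ) + x * (1 / (1 - θ) * (1 / (1 - θ - x))) := by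
  have h3 : 1 - θ ≠ 0 := by linarith
  have := h₂.ne'
  field_simp
  ring

theorem exists_bound_of_continuousOn_box {R ε : ℝ} {H : ℝ × ℝ × ℝ → ℝ}
    (hH : ContinuousOn H (box R ε)) : ∃ C : ℝ, 0 ≤ C ∧ ∀ p ∈ box R ε, |H p| ≤ C := by
  obtain ⟨C, hC⟩ := (isCompact_box R ε).exists_bound_of_continuousOn hH
  exact ⟨max C 0, le_max_right _ _, fun p hp => (hC p hp).trans (le_max_left _ _)⟩

theorem contDiffOn_weight {θ R ε : ℝ} (h₁ : 4 * ε ≤ θ) (h₂ : 4 * ε ≤ 1 - θ)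
    (hθ : 0 < θ) (hθ' : θ < 1) :
    ContDiffOn ℝ 1 (fun p : ℝ × ℝ × ℝ => weight θ (p.2.2 * p.1)) (box R ε) := by
  unfold weight
  refine ContDiffOn.div (by fun_prop) (by fun_prop) fun p hp => ?_
  obtain ⟨h3, h4⟩ := pos_of_mem_box h₁ h₂ hθ hθ' hp
  positivity

theorem contDiffOn_one_div_one_sub {θ R ε : ℝ} (h₁ : 4 * ε ≤ θ) (h₂ : 4 * ε ≤ 1 - θ)
    (hθ : 0 < θ) (hθ' : θ < 1) :
    ContDiffOn ℝ 1 (fun p : ℝ × ℝ × ℝ => 1 / (1 - θ - p.2.2 * p.1)) (box R ε) := by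
  refine ContDiffOn.div (by fun_prop) (by fun_prop) fun p hp => ?_
  exact (pos_of_mem_box h₁ h₂ hθ hθ' hp).2.ne'

theorem contDiffOn_scaledField {θ k R ε : ℝ} (h₁ : 4 * ε ≤ θ) (h₂ : 4 * ε ≤ 1 - θ)
    (hθ : 0 < θ) (hθ' : θ < 1) : ContDiffOn ℝ 1 (scaledField θ k) (box R ε) := by
  have hA := contDiffOn_weight (R := R) h₁ h₂ hθ hθ'
  have hB := contDiffOn_one_div_one_sub (R := R) h₁ h₂ hθ hθ'
  unfold scaledField
  fun_prop

theorem scaledField_expansion (θ k R ε : ℝ) (h₁ : 4 * ε ≤ θ) (h₂ : 4 * ε ≤ 1 - θ)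
    (hθ : 0 < θ) (hθ' : θ < 1) :
    ∃ C : ℝ, 0 ≤ C ∧ ∀ p ∈ box R ε,
      |scaledField θ k p - 2 * p.1 / (θ * (1 - θ)) - p.2.2 * ((2 * θ - 1 - k / (1 - θ)) * p.2.1
        / (θ * (1 - θ)) + 2 * (2 * θ - 1) * p.1 ^ 2 / (θ * (1 - θ)) ^ 2)| ≤ C * p.2.2 ^ 2 := by
  have hA := (contDiffOn_weight (R := R) h₁ h₂ hθ hθ').continuousOn
  have hB := (contDiffOn_one_div_one_sub (R := R) h₁ h₂ hθ hθ').continuousOn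
  set κ := θ * (1 - θ) with hκ
  set η := 2 * θ - 1 with hη
  set A₂ : ℝ × ℝ × ℝ → ℝ := fun p => (κ + (1 - 2 * θ) ^ 2 - (1 - 2 * θ) * (p.2.2 * p.1)) / κ ^ 2
        * weight θ (p.2.2 * p.1) with hA₂
  have hA₂c : ContinuousOn A₂ (box R ε) := by fun_prop
  set B : ℝ × ℝ × ℝ → ℝ := fun p => 1 / (1 - θ - p.2.2 * p.1) with hBdef
  set Q : ℝ × ℝ × ℝ → ℝ := fun p => 2 * p.1 + p.2.2 * η * p.2.1
    - k * p.2.2 * (1 - p.2.2 ^ 2 * p.2.1) * p.2.1 * B p with hQ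
  have hQc : ContinuousOn Q (box R ε) := by fun_prop
  set H : ℝ × ℝ × ℝ → ℝ := fun p => - p.2.1 * Q p * weight θ (p.2.2 * p.1)
    + (k * p.2.2 * p.2.1 ^ 2 * B p - k * p.2.1 * p.1 * (1 / (1 - θ) * B p))
      * weight θ (p.2.2 * p.1)
    + (2 * p.1 + p.2.2 * (η - k / (1 - θ)) * p.2.1) * p.1 ^ 2 * A₂ p
    + (η - k / (1 - θ)) * p.2.1 * p.1 * η / κ ^ 2 with hH
  have hHc : ContinuousOn H (box R ε) := by fun_prop
  obtain ⟨C, hC0, hC⟩ := exists_bound_of_continuousOn_box hHc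
  refine ⟨C, hC0, fun p hp => ?_⟩
  obtain ⟨h3, h4⟩ := pos_of_mem_box h₁ h₂ hθ hθ' hp
  have e1 := weight_expansion hθ hθ' h3 h4
  have e2 := inv_expansion hθ' h4
  have key : scaledField θ k p - 2 * p.1 / κ - p.2.2 * ((η - k / (1 - θ)) * p.2.1
        / κ + 2 * η * p.1 ^ 2 / κ ^ 2) = p.2.2 ^ 2 * H p := by
    have e1' : weight θ (p.2.2 * p.1) = 1 / κ + p.2.2 * p.1 * η / κ ^ 2
        + (p.2.2 * p.1) ^ 2 * A₂ p := by
      rw [hA₂, hη]; linear_combination e1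
    have e2' : B p = 1 / (1 - θ) + p.2.2 * p.1 * (1 / (1 - θ) * B p) := e2
    have e3 : scaledField θ k p = (1 - p.2.2 ^ 2 * p.2.1) * Q p * weight θ (p.2.2 * p.1) := rfl
    rw [e3]
    simp only [hH]
    generalize hw : weight θ (p.2.2 * p.1) = w at *
    simp only [hQ] at *
    generalize A₂ p = a at *
    generalize B p = b at *
    linear_combination (2 * p.1 + p.2.2 * (η - k / (1 - θ)) * p.2.1) * e1'
      - k * p.2.2 * p.2.1 * w * e2'
  rw [key, abs_mul, abs_of_nonneg (sq_nonneg _), mul_comm]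
  gcongr
  exact hC p hp

theorem mul_weight_expansion (θ R ε : ℝ) (h₁ : 4 * ε ≤ θ) (h₂ : 4 * ε ≤ 1 - θ)
    (hθ : 0 < θ) (hθ' : θ < 1) :
    ∃ C : ℝ, 0 ≤ C ∧ ∀ p ∈ box R ε,
      |p.2.1 * weight θ (p.2.2 * p.1) - (p.2.1 / (θ * (1 - θ))
        + p.2.2 * ((2 * θ - 1) * p.1 * p.2.1 / (θ * (1 - θ)) ^ 2))| ≤ C * p.2.2 ^ 2 := by
  have hA := (contDiffOn_weight (R := R) h₁ h₂ hθ hθ').continuousOn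
  have hHc : ContinuousOn (fun p : ℝ × ℝ × ℝ => p.2.1 * p.1 ^ 2 *
      ((θ * (1 - θ) + (1 - 2 * θ) ^ 2 - (1 - 2 * θ) * (p.2.2 * p.1)) / (θ * (1 - θ)) ^ 2
        * weight θ (p.2.2 * p.1))) (box R ε) := by fun_prop
  obtain ⟨C, hC0, hC⟩ := exists_bound_of_continuousOn_box hHc
  refine ⟨C, hC0, fun p hp => ?_⟩
  obtain ⟨h3, h4⟩ := pos_of_mem_box h₁ h₂ hθ hθ' hp
  have e1 := weight_expansion hθ hθ' h3 h4
  refine le_trans (le_of_eq ?_) (mul_le_mul_of_nonneg_right (hC p hp) (sq_nonneg p.2.2))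
  rw [← abs_of_nonneg (sq_nonneg p.2.2), ← abs_mul]
  congr 1
  linear_combination p.2.1 * e1

set_option maxHeartbeats 1000000 in
/-- The scaled trajectories `r ε`, together with the primitives `ω ε` of `r ε * weight`, their
Lipschitz dependence on `ε`, and their expansion to second order in `ε`. -/
theorem exists_scaled_flow {θ k κ γ η : ℝ} (hθ : 0 < θ) (hθ' : θ < 1) (hκ : κ = θ * (1 - θ))
    (hη : η = 2 * θ - 1) (hγ : γ = η - k / (1 - θ)) :
    ∃ ε₀ C : ℝ, ∃ r ω : ℝ → ℝ → ℝ, 0 < ε₀ ∧ 0 ≤ C ∧ 4 * ε₀ ≤ θ ∧ 4 * ε₀ ≤ 1 - θ ∧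
      (∀ ε ∈ Icc 0 ε₀, r ε (-1) = 0 ∧ ω ε (-1) = 0 ∧ ∀ t ∈ Icc (-2 : ℝ) 2,
        ε ^ 2 * r ε t < 1 ∧
        HasDerivWithinAt (r ε) (scaledField θ k (t, r ε t, ε)) (Icc (-2) 2) t ∧
        HasDerivWithinAt (ω ε) (r ε t * weight θ (ε * t)) (Icc (-2) 2) t ∧
        |scaledField θ k (t, r ε t, ε)| ≤ C ∧
        |r ε t * weight θ (ε * t)| ≤ C * |r ε t| ∧
        |r ε t| ≤ C ∧
        |scaledField θ k (t, r ε t, ε) - 2 * t / κ| ≤ 1 / (8 * κ) ∧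
        |r ε t - (t ^ 2 - 1) / κ| ≤ C * ε ∧
        |r ε t - (t ^ 2 - 1) / κ| ≤ 1 / (2 * κ) ∧
        |ω ε t - ((t ^ 3 / 3 - t - 2 / 3) / κ ^ 2 + ε *
          (γ * (t ^ 4 / 12 - t ^ 2 / 2 - 2 * t / 3 - 1 / 4)
            + 2 * η / 3 * (t ^ 4 / 4 + t + 3 / 4)
            + η * (t ^ 4 / 4 - t ^ 2 / 2 + 1 / 4)) / κ ^ 3)| ≤ C * ε ^ 2) ∧
      ∀ ε ∈ Icc 0 ε₀, ∀ ε' ∈ Icc 0 ε₀, ∀ t ∈ Icc (-2 : ℝ) 2,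
        |r ε t - r ε' t| ≤ C * |ε - ε'| ∧ |ω ε t - ω ε' t| ≤ C * |ε - ε'| := by
  have hθ1 : 0 < 1 - θ := by linarith
  have hκ0 : 0 < κ := hκ ▸ mul_pos hθ hθ1
  set R : ℝ := 3 * (4 / κ + 1) with hR
  have hR0 : 0 < R := by positivity
  set ε₁ : ℝ := min θ (1 - θ) / 4 with hε₁
  have hε₁0 : 0 < ε₁ := by positivity
  have h₁ : 4 * ε₁ ≤ θ := by have := min_le_left θ (1 - θ); linarith
  have h₂ : 4 * ε₁ ≤ 1 - θ := by have := min_le_right θ (1 - θ); linarith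
  obtain ⟨C₁, hC₁0, hC₁⟩ := scaledField_expansion θ k R ε₁ h₁ h₂ hθ hθ'
  obtain ⟨C₅, hC₅0, hC₅⟩ := mul_weight_expansion θ R ε₁ h₁ h₂ hθ hθ'
  simp only [← hκ, ← hη, ← hγ] at hC₁ hC₅
  obtain ⟨A, hA0, hA⟩ := exists_bound_of_continuousOn_box
    (contDiffOn_weight (R := R) h₁ h₂ hθ hθ').continuousOn
  obtain ⟨D, hD0, hD⟩ := exists_bound_of_continuousOn_box (R := R) (ε := ε₁)
    (H := fun p => γ * p.2.1 / κ + 2 * η * p.1 ^ 2 / κ ^ 2) (by fun_prop)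
  obtain ⟨K, hK⟩ := (contDiffOn_scaledField (k := k) (R := R) h₁ h₂ hθ hθ').exists_lipschitzOnWith
    one_ne_zero (convex_box _ _) (isCompact_box _ _)
  have hPc : ContDiffOn ℝ 1 (fun p : ℝ × ℝ × ℝ => p.2.1 * weight θ (p.2.2 * p.1)) (box R ε₁) := by
    have := contDiffOn_weight (R := R) h₁ h₂ hθ hθ'
    fun_prop
  obtain ⟨K₂, hK₂⟩ := hPc.exists_lipschitzOnWith
    one_ne_zero (convex_box _ _) (isCompact_box _ _)
  set C₂ : ℝ := C₁ * ε₁ + D with hC₂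
  have hC₂0 : 0 ≤ C₂ := by positivity
  have hG : ∀ p ∈ box R ε₁, |scaledField θ k p - 2 * p.1 / κ| ≤ C₂ * |p.2.2| := by
    intro p hp
    have h3 := hC₁ p hp
    have h4 := hD p hp
    have h5 : |p.2.2| ≤ ε₁ := abs_le.2 hp.2.2
    have h6 := abs_add_le (scaledField θ k p - 2 * p.1 / κ
      - p.2.2 * (γ * p.2.1 / κ + 2 * η * p.1 ^ 2 / κ ^ 2))
      (p.2.2 * (γ * p.2.1 / κ + 2 * η * p.1 ^ 2 / κ ^ 2))
    rw [sub_add_cancel, abs_mul] at h6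
    have h7 : |p.2.2| * |γ * p.2.1 / κ + 2 * η * p.1 ^ 2 / κ ^ 2| ≤ |p.2.2| * D := by gcongr
    have h8 : C₁ * p.2.2 ^ 2 ≤ C₁ * (ε₁ * |p.2.2|) := by
      rw [← sq_abs, sq]; gcongr
    calc _ ≤ _ := h6
      _ ≤ C₁ * (ε₁ * |p.2.2|) + |p.2.2| * D := by linarith
      _ = _ := by rw [hC₂]; ring
  set S : ℝ := 1 + R + C₂ + 24 * κ * C₂ with hS
  have hS0 : 0 < S := by positivity
  set ε₀ : ℝ := min ε₁ (1 / S) with hε₀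
  have hε₀0 : 0 < ε₀ := by positivity
  have hε₀S : ε₀ * S ≤ 1 := by
    have := min_le_right ε₁ (1 / S)
    rwa [← hε₀, le_div_iff₀ hS0] at this
  have hε₀1 : ε₀ ≤ ε₁ := min_le_left _ _
  have hsub : box R ε₀ ⊆ box R ε₁ := by
    refine prod_mono le_rfl (prod_mono le_rfl (Icc_subset_Icc ?_ ?_)) <;> linarith
  have hprods : 0 ≤ ε₀ * R ∧ 0 ≤ ε₀ * C₂ ∧ 0 ≤ ε₀ * (24 * κ * C₂) :=
    ⟨by positivity, by positivity, by positivity⟩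
  have hexp : ε₀ * S = ε₀ + ε₀ * R + ε₀ * C₂ + ε₀ * (24 * κ * C₂) := by rw [hS]; ring
  have hi : C₂ * ε₀ ≤ 1 := by linarith [hprods.1, hprods.2.1, hprods.2.2]
  have hiii : C₂ * ε₀ ≤ 1 / (24 * κ) := by
    rw [le_div_iff₀ (by positivity)]; linarith [hprods.1, hprods.2.1, hprods.2.2]
  have hii : ε₀ * R < 1 := by linarith [hprods.1, hprods.2.1, hprods.2.2]
  have hε₀le : ε₀ ≤ 1 := by linarith [hprods.1, hprods.2.1, hprods.2.2]
  have hbd : ∀ p ∈ box R ε₀, |scaledField θ k p| ≤ 4 / κ + 1 := by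
    intro p hp
    have h3 := hG p (hsub hp)
    have h4 : |2 * p.1 / κ| ≤ 4 / κ := by
      rw [abs_div, abs_of_pos hκ0, abs_mul, abs_two]
      have : |p.1| ≤ 2 := abs_le.2 hp.1
      gcongr
      linarith
    have h5 : C₂ * |p.2.2| ≤ C₂ * ε₀ := by
      have : |p.2.2| ≤ ε₀ := abs_le.2 hp.2.2
      gcongr
    have h6 := abs_add_le (scaledField θ k p - 2 * p.1 / κ) (2 * p.1 / κ)
    rw [sub_add_cancel] at h6
    linarith
  obtain ⟨r, M, hM0, hr, hrL⟩ := exists_solution_family (R := R) (L := 4 / κ + 1) hε₀0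
    (by positivity) le_rfl (hK.mono hsub) hbd
  have hbox : ∀ ε ∈ Icc 0 ε₀, ∀ t ∈ Icc (-2 : ℝ) 2, (t, r ε t, ε) ∈ box R ε₀ := fun ε hε t ht =>
    ⟨ht, abs_le.1 ((hr ε hε).2 t ht).1, by linarith [hε.1], hε.2⟩
  have hω : ∀ ε ∈ Icc 0 ε₀, ∃ F : ℝ → ℝ, F (-1) = 0 ∧ ∀ t ∈ Icc (-2 : ℝ) 2,
      HasDerivWithinAt F (r ε t * weight θ (ε * t)) (Icc (-2) 2) t := by
    intro ε hε
    refine exists_hasDerivWithinAt_Icc (by norm_num) ?_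
    have hrc : ContinuousOn (r ε) (Icc (-2) 2) := fun t ht =>
      ((hr ε hε).2 t ht).2.continuousWithinAt
    have h3 : ContinuousOn (fun t : ℝ => (t, r ε t, ε)) (Icc (-2) 2) := by fun_prop
    exact (hPc.continuousOn.mono hsub).comp h3 (hbox ε hε)
  choose! ω hω0 hωd using hω
  have hm1 : (-1 : ℝ) ∈ Icc (-2 : ℝ) 2 := by norm_num
  have h3t : ∀ t ∈ Icc (-2 : ℝ) 2, |t - -1| ≤ 3 := by
    intro t ht; rw [abs_le]; constructor <;> linarith [ht.1, ht.2]
  -- first order comparison of `r`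
  have ha : ∀ ε ∈ Icc 0 ε₀, ∀ t ∈ Icc (-2 : ℝ) 2, |r ε t - (t ^ 2 - 1) / κ| ≤ 3 * C₂ * ε := by
    intro ε hε t ht
    have hd : ∀ t ∈ Icc (-2 : ℝ) 2, HasDerivWithinAt (fun t => r ε t - (t ^ 2 - 1) / κ)
        (scaledField θ k (t, r ε t, ε) - 2 * t / κ) (Icc (-2) 2) t := by
      intro t ht
      refine ((hr ε hε).2 t ht).2.sub ?_
      have := ((((hasDerivAt_id t).pow 2).sub_const 1).div_const κ).hasDerivWithinAt
        (s := Icc (-2) 2)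
      simpa using! this
    have hbound : ∀ t ∈ Icc (-2 : ℝ) 2,
        |scaledField θ k (t, r ε t, ε) - 2 * t / κ| ≤ C₂ * ε := by
      intro t ht
      have h4 := hG _ (hsub (hbox ε hε t ht))
      dsimp only at h4
      rwa [abs_of_nonneg hε.1] at h4
    have := abs_sub_le_of_hasDerivWithinAt_Icc hd hbound ht hm1
    rw [(hr ε hε).1] at this
    norm_num at this
    have h4 := h3t t ht
    rw [sub_neg_eq_add] at h4
    calc _ ≤ _ := this
      _ ≤ C₂ * ε * 3 := by have := hε.1; gcongr
      _ = _ := by ring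
  -- second order comparison of `r`
  set C₃ : ℝ := 3 * (C₁ + |γ| / κ * (3 * C₂)) with hC₃
  have hC₃0 : 0 ≤ C₃ := by positivity
  have hb : ∀ ε ∈ Icc 0 ε₀, ∀ t ∈ Icc (-2 : ℝ) 2, |r ε t - ((t ^ 2 - 1) / κ
      + ε * (γ * (t ^ 3 / 3 - t - 2 / 3) + 2 * η / 3 * (t ^ 3 + 1)) / κ ^ 2)| ≤ C₃ * ε ^ 2 := by
    intro ε hε t ht
    have hd : ∀ t ∈ Icc (-2 : ℝ) 2, HasDerivWithinAt (fun t => r ε t - ((t ^ 2 - 1) / κ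
        + ε * (γ * (t ^ 3 / 3 - t - 2 / 3) + 2 * η / 3 * (t ^ 3 + 1)) / κ ^ 2))
        (scaledField θ k (t, r ε t, ε) - (2 * t / κ
          + ε * (γ * (t ^ 2 - 1) + 2 * η * t ^ 2) / κ ^ 2)) (Icc (-2) 2) t := by
      intro t ht
      refine ((hr ε hε).2 t ht).2.sub (HasDerivAt.hasDerivWithinAt ?_)
      have h2 := (((hasDerivAt_pow 2 t).sub_const 1).div_const κ).add
        (((((((hasDerivAt_pow 3 t).div_const 3).sub (hasDerivAt_id' t)).sub_const (2 / 3)).const_mul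
          γ).add (((hasDerivAt_pow 3 t).add_const 1).const_mul (2 * η / 3))).const_mul ε
            |>.div_const (κ ^ 2))
      refine h2.congr_deriv ?_
      norm_num
      ring
    have hbound : ∀ t ∈ Icc (-2 : ℝ) 2, |scaledField θ k (t, r ε t, ε) - (2 * t / κ
          + ε * (γ * (t ^ 2 - 1) + 2 * η * t ^ 2) / κ ^ 2)| ≤
          (C₁ + |γ| / κ * (3 * C₂)) * ε ^ 2 := by
      intro t ht
      have h4 := hC₁ _ (hsub (hbox ε hε t ht))
      have h5 := ha ε hε t ht
      dsimp only at h4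
      have h6 : scaledField θ k (t, r ε t, ε) - (2 * t / κ
          + ε * (γ * (t ^ 2 - 1) + 2 * η * t ^ 2) / κ ^ 2) =
          (scaledField θ k (t, r ε t, ε) - 2 * t / κ - ε * (γ * r ε t / κ
            + 2 * η * t ^ 2 / κ ^ 2)) + ε * (γ / κ) * (r ε t - (t ^ 2 - 1) / κ) := by
        field_simp; ring
      rw [h6]
      refine (abs_add_le _ _).trans ?_
      have h7 : |ε * (γ / κ) * (r ε t - (t ^ 2 - 1) / κ)| ≤ ε * (|γ| / κ) * (3 * C₂ * ε) := by
        rw [abs_mul, abs_mul, abs_div, abs_of_pos hκ0, abs_of_nonneg hε.1]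
        have := hε.1
        gcongr
      calc _ ≤ C₁ * ε ^ 2 + ε * (|γ| / κ) * (3 * C₂ * ε) := add_le_add h4 h7
        _ = _ := by ring
    have := abs_sub_le_of_hasDerivWithinAt_Icc hd hbound ht hm1
    rw [(hr ε hε).1] at this
    norm_num at this
    have h4 := h3t t ht
    rw [sub_neg_eq_add] at h4
    calc _ ≤ _ := this
      _ ≤ (C₁ + |γ| / κ * (3 * C₂)) * ε ^ 2 * 3 := by gcongr
      _ = _ := by rw [hC₃]; ring
  -- comparison of `ω`
  set C₄ : ℝ := C₅ + C₃ / κ + 2 * |η| / κ ^ 2 * (3 * C₂) with hC₄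
  have hC₄0 : 0 ≤ C₄ := by positivity
  have hc : ∀ ε ∈ Icc 0 ε₀, ∀ t ∈ Icc (-2 : ℝ) 2,
      |ω ε t - ((t ^ 3 / 3 - t - 2 / 3) / κ ^ 2 + ε *
          (γ * (t ^ 4 / 12 - t ^ 2 / 2 - 2 * t / 3 - 1 / 4)
            + 2 * η / 3 * (t ^ 4 / 4 + t + 3 / 4)
            + η * (t ^ 4 / 4 - t ^ 2 / 2 + 1 / 4)) / κ ^ 3)| ≤ 3 * C₄ * ε ^ 2 := by
    intro ε hε t ht
    have hd : ∀ t ∈ Icc (-2 : ℝ) 2, HasDerivWithinAt (fun t => ω ε t -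
        ((t ^ 3 / 3 - t - 2 / 3) / κ ^ 2 + ε *
          (γ * (t ^ 4 / 12 - t ^ 2 / 2 - 2 * t / 3 - 1 / 4)
            + 2 * η / 3 * (t ^ 4 / 4 + t + 3 / 4)
            + η * (t ^ 4 / 4 - t ^ 2 / 2 + 1 / 4)) / κ ^ 3))
        (r ε t * weight θ (ε * t) - ((t ^ 2 - 1) / κ ^ 2
          + ε * (γ * (t ^ 3 / 3 - t - 2 / 3) + 2 * η / 3 * (t ^ 3 + 1)
            + η * (t ^ 3 - t)) / κ ^ 3)) (Icc (-2) 2) t := by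
      intro t ht
      refine (hωd ε hε t ht).sub (HasDerivAt.hasDerivWithinAt ?_)
      have p2 := hasDerivAt_pow 2 t
      have p3 := hasDerivAt_pow 3 t
      have p4 := hasDerivAt_pow 4 t
      have p1 := hasDerivAt_id' t
      have h2 := ((((p3.div_const 3).sub p1).sub_const (2 / 3)).div_const (κ ^ 2)).add
        ((((((((p4.div_const 12).sub (p2.div_const 2)).sub
          ((p1.const_mul 2).div_const 3)).sub_const (1 / 4)).const_mul γ).add
          ((((p4.div_const 4).add p1).add_const (3 / 4)).const_mul (2 * η / 3))).add
          ((((p4.div_const 4).sub (p2.div_const 2)).add_const (1 / 4)).const_mul η)).const_mul ε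
            |>.div_const (κ ^ 3))
      refine h2.congr_deriv ?_
      norm_num
      ring
    have hbound : ∀ t ∈ Icc (-2 : ℝ) 2, |r ε t * weight θ (ε * t) - ((t ^ 2 - 1) / κ ^ 2
          + ε * (γ * (t ^ 3 / 3 - t - 2 / 3) + 2 * η / 3 * (t ^ 3 + 1)
            + η * (t ^ 3 - t)) / κ ^ 3)| ≤ C₄ * ε ^ 2 := by
      intro t ht
      have h4 := hC₅ _ (hsub (hbox ε hε t ht))
      have h5 := ha ε hε t ht
      have h5' := hb ε hε t ht
      have hε0 := hε.1
      dsimp only at h4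
      have h6 : r ε t * weight θ (ε * t) - ((t ^ 2 - 1) / κ ^ 2
          + ε * (γ * (t ^ 3 / 3 - t - 2 / 3) + 2 * η / 3 * (t ^ 3 + 1)
            + η * (t ^ 3 - t)) / κ ^ 3) =
          (r ε t * weight θ (ε * t) - (r ε t / κ + ε * (η * t * r ε t / κ ^ 2)))
          + (r ε t - ((t ^ 2 - 1) / κ + ε * (γ * (t ^ 3 / 3 - t - 2 / 3)
            + 2 * η / 3 * (t ^ 3 + 1)) / κ ^ 2)) / κ
          + ε * (t * η / κ ^ 2) * (r ε t - (t ^ 2 - 1) / κ) := by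
        field_simp; ring
      rw [h6]
      refine (abs_add_three _ _ _).trans ?_
      have h7 : |ε * (t * η / κ ^ 2) * (r ε t - (t ^ 2 - 1) / κ)|
          ≤ ε * (2 * |η| / κ ^ 2) * (3 * C₂ * ε) := by
        rw [abs_mul, abs_mul, abs_div, abs_mul, abs_of_nonneg hε.1, abs_of_pos (pow_pos hκ0 2)]
        have : |t| ≤ 2 := abs_le.2 ht
        gcongr
      rw [abs_div _ κ, abs_of_pos hκ0]
      calc _ ≤ C₅ * ε ^ 2 + C₃ * ε ^ 2 / κ + ε * (2 * |η| / κ ^ 2) * (3 * C₂ * ε) := by gcongr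
        _ = _ := by rw [hC₄]; ring
    have := abs_sub_le_of_hasDerivWithinAt_Icc hd hbound ht hm1
    rw [hω0 ε hε] at this
    norm_num at this
    have h4 := h3t t ht
    rw [sub_neg_eq_add] at h4
    have h5 : C₄ * ε ^ 2 * |t + 1| ≤ C₄ * ε ^ 2 * 3 := by gcongr
    norm_num
    linarith
  -- Lipschitz dependence of `ω` on the parameter
  have hL : ∀ ε ∈ Icc 0 ε₀, ∀ ε' ∈ Icc 0 ε₀, ∀ t ∈ Icc (-2 : ℝ) 2,
      |ω ε t - ω ε' t| ≤ 3 * (K₂ * (M + 1)) * |ε - ε'| := by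
    intro ε hε ε' hε' t ht
    have hbound : ∀ t ∈ Icc (-2 : ℝ) 2,
        |r ε t * weight θ (ε * t) - r ε' t * weight θ (ε' * t)| ≤ K₂ * (M + 1) * |ε - ε'| := by
      intro t ht
      have h4 := hK₂.dist_le_mul _ (hsub (hbox ε hε t ht)) _ (hsub (hbox ε' hε' t ht))
      simp only [Prod.dist_eq, Real.dist_eq, sub_self, abs_zero] at h4
      refine h4.trans ?_
      rw [mul_assoc]
      gcongr
      have h5 := hrL ε hε ε' hε' t ht
      have h6 := abs_nonneg (ε - ε')
      have h7 := mul_nonneg hM0 h6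
      refine max_le (by positivity) (max_le ?_ ?_) <;> linarith
    have := abs_sub_le_of_hasDerivWithinAt_Icc
      (fun t ht => (hωd ε hε t ht).sub (hωd ε' hε' t ht)) hbound ht hm1
    simp only [Pi.sub_apply, hω0 ε hε, hω0 ε' hε', sub_zero] at this
    calc _ ≤ _ := this
      _ ≤ K₂ * (M + 1) * |ε - ε'| * 3 := by gcongr; exact h3t t ht
      _ = _ := by ring
  have hR' : 4 / κ + 1 ≤ R := by
    have : 0 < 4 / κ := by positivity
    rw [hR]; linarith
  have hq₁ : 0 ≤ 3 * (K₂ * (M + 1)) := by positivity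
  refine ⟨ε₀, R + A + 3 * C₂ + 3 * C₄ + M + 3 * (K₂ * (M + 1)), r, ω, hε₀0, by positivity,
    by linarith, by linarith, fun ε hε => ⟨(hr ε hε).1, hω0 ε hε, fun t ht => ?_⟩,
    fun ε hε ε' hε' t ht => ⟨(hrL ε hε ε' hε' t ht).trans ?_, (hL ε hε ε' hε' t ht).trans ?_⟩⟩
  · have hε0 := hε.1
    have hp := hbox ε hε t ht
    have hrR := ((hr ε hε).2 t ht).1
    have hgb := hG _ (hsub hp)
    have hCε : C₂ * ε ≤ C₂ * ε₀ := by have := hε.2; gcongr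
    dsimp only at hgb
    rw [abs_of_nonneg hε0] at hgb
    refine ⟨?_, ((hr ε hε).2 t ht).2, hωd ε hε t ht, ?_, ?_, ?_, ?_, ?_, ?_, ?_⟩
    · have h4 : ε ^ 2 * r ε t ≤ ε₀ * ε₀ * R := by
        rw [sq]
        have h5 := (le_abs_self _).trans hrR
        have h6 := hε.2
        have h7 : ε * ε ≤ ε₀ * ε₀ := by gcongr
        calc ε * ε * r ε t ≤ ε * ε * R := by gcongr
          _ ≤ _ := by gcongr
      have h8 : ε₀ * (ε₀ * R) ≤ 1 * (ε₀ * R) := by gcongr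
      linarith
    · refine (hbd _ hp).trans ?_
      linarith
    · rw [abs_mul, mul_comm]
      have h4 := hA _ (hsub hp)
      dsimp only at h4
      gcongr
      linarith
    · refine hrR.trans ?_
      linarith
    · refine hgb.trans (hCε.trans (hiii.trans ?_))
      gcongr; norm_num
    · refine (ha ε hε t ht).trans ?_
      gcongr
      linarith
    · refine (ha ε hε t ht).trans ?_
      have h4 : 3 * (1 / (24 * κ)) ≤ 1 / (2 * κ) := by
        rw [← mul_div_assoc, div_le_div_iff₀ (by positivity) (by positivity)]
        linarith
      linarith
    · refine (hc ε hε t ht).trans ?_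
      gcongr
      linarith
  · gcongr
    linarith
  · gcongr
    linarith

/-- Each scaled trajectory has a second zero, at which the primitive `ω` depends continuously on
`ε` and has an explicit first order expansion. -/
theorem exists_scaled_return {θ k κ : ℝ} (hθ : 0 < θ) (hθ' : θ < 1) (hκ : κ = θ * (1 - θ)) :
    ∃ ε₀ C : ℝ, ∃ (r ω : ℝ → ℝ → ℝ) (s : ℝ → ℝ),
      0 < ε₀ ∧ 0 ≤ C ∧ 4 * ε₀ ≤ θ ∧ 4 * ε₀ ≤ 1 - θ ∧
      (∀ ε ∈ Icc 0 ε₀, r ε (-1) = 0 ∧ ω ε (-1) = 0 ∧ (∀ t ∈ Icc (-2 : ℝ) 2,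
        ε ^ 2 * r ε t < 1 ∧
        HasDerivWithinAt (r ε) (scaledField θ k (t, r ε t, ε)) (Icc (-2) 2) t ∧
        HasDerivWithinAt (ω ε) (r ε t * weight θ (ε * t)) (Icc (-2) 2) t) ∧
        s ε ∈ Ioo (-1) 2 ∧ r ε (s ε) = 0 ∧
        |ω ε (s ε) - (-(4 / (3 * κ ^ 2)) + ε * (4 * k / (3 * (1 - θ) * κ ^ 3)))| ≤ C * ε ^ 2) ∧
      ContinuousOn (fun ε => ω ε (s ε)) (Icc 0 ε₀) := by
  have hθ1 : 0 < 1 - θ := by linarith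
  have hκ0 : 0 < κ := hκ ▸ mul_pos hθ hθ1
  obtain ⟨ε₀, C, r, ω, hε₀, hC, hε₁, hε₂, H, HL⟩ :=
    exists_scaled_flow (k := k) hθ hθ' hκ rfl rfl
  -- the trajectories increase at a definite rate past `1 / 2`
  have hmono : ∀ ε ∈ Icc 0 ε₀, ∀ t ∈ Icc (1 / 2 : ℝ) 2, ∀ t' ∈ Icc (1 / 2 : ℝ) 2,
      |t - t'| ≤ 2 * κ * |r ε t - r ε t'| := by
    intro ε hε
    have hsub : Icc (1 / 2 : ℝ) 2 ⊆ Icc (-2) 2 := Icc_subset_Icc (by norm_num) le_rfl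
    have hder : ∀ t ∈ Ioo (1 / 2 : ℝ) 2, HasDerivAt (r ε) (scaledField θ k (t, r ε t, ε)) t := by
      intro t ht
      exact ((H ε hε).2.2 t (hsub (Ioo_subset_Icc_self ht))).2.1.hasDerivAt
        (Icc_mem_nhds (by linarith [ht.1]) ht.2)
    have key := (convex_Icc (1 / 2 : ℝ) 2).mul_sub_le_image_sub_of_le_deriv (f := r ε)
      (C := 1 / (2 * κ))
      (fun t ht => ((H ε hε).2.2 t (hsub ht)).2.1.continuousWithinAt.mono hsub)
      (by
        rw [interior_Icc]
        exact fun t ht => (hder t ht).differentiableAt.differentiableWithinAt)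
      (by
        rw [interior_Icc]
        intro t ht
        rw [(hder t ht).deriv]
        have h1 := ((H ε hε).2.2 t (hsub (Ioo_subset_Icc_self ht))).2.2.2.2.2.2.1
        have h2 : 1 / κ ≤ 2 * t / κ := by
          gcongr; linarith [ht.1]
        have h3 : 1 / κ - 1 / (8 * κ) = 7 / (8 * κ) := by field_simp; norm_num
        have h4 : 1 / (2 * κ) ≤ 7 / (8 * κ) := by
          rw [div_le_div_iff₀ (by positivity) (by positivity)]; linarith
        linarith [(abs_le.1 h1).1])
    have key2 : ∀ t ∈ Icc (1 / 2 : ℝ) 2, ∀ t' ∈ Icc (1 / 2 : ℝ) 2, t ≤ t' →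
        |t - t'| ≤ 2 * κ * |r ε t - r ε t'| := by
      intro t ht t' ht' hle
      have h1 := key t ht t' ht' hle
      rw [abs_sub_comm, abs_sub_comm (r ε t), abs_of_nonneg (sub_nonneg.2 hle)]
      have h2 := h1.trans (le_abs_self _)
      rw [one_div, inv_mul_le_iff₀ (by positivity)] at h2
      exact h2
    intro t ht t' ht'
    rcases le_total t t' with h | h
    · exact key2 t ht t' ht' h
    · rw [abs_sub_comm, abs_sub_comm (r ε t)]
      exact key2 t' ht' t ht h
  have hzero : ∀ ε ∈ Icc 0 ε₀, ∃ s ∈ Icc (1 / 2 : ℝ) (3 / 2), r ε s = 0 := by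
    intro ε hε
    have hsub : Icc (1 / 2 : ℝ) (3 / 2) ⊆ Icc (-2) 2 :=
      Icc_subset_Icc (by norm_num) (by norm_num)
    have hcont : ContinuousOn (r ε) (Icc (1 / 2) (3 / 2)) := fun t ht =>
      ((H ε hε).2.2 t (hsub ht)).2.1.continuousWithinAt.mono hsub
    have h1 := ((H ε hε).2.2 (1 / 2) (by norm_num)).2.2.2.2.2.2.2.2.1
    have h2 := ((H ε hε).2.2 (3 / 2) (by norm_num)).2.2.2.2.2.2.2.2.1
    have h3 : ((1 / 2 : ℝ) ^ 2 - 1) / κ = -(3 / 4 * (1 / κ)) := by ring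
    have h4 : ((3 / 2 : ℝ) ^ 2 - 1) / κ = 5 / 4 * (1 / κ) := by ring
    have h5 : 1 / (2 * κ) = 1 / 2 * (1 / κ) := by field_simp
    have h6 : 0 < 1 / κ := by positivity
    rw [h3, h5] at h1
    rw [h4, h5] at h2
    exact intermediate_value_Icc (by norm_num) hcont
      ⟨by linarith [(abs_le.1 h1).2], by linarith [(abs_le.1 h2).1]⟩
  choose! s hs hs0 using hzero
  have hs2 : ∀ ε ∈ Icc 0 ε₀, s ε ∈ Icc (1 / 2 : ℝ) 2 := fun ε hε =>
    ⟨(hs ε hε).1, by linarith [(hs ε hε).2]⟩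
  have hsm : ∀ ε ∈ Icc 0 ε₀, s ε ∈ Icc (-2 : ℝ) 2 := fun ε hε =>
    ⟨by linarith [(hs ε hε).1], (hs2 ε hε).2⟩
  have h1m : (1 : ℝ) ∈ Icc (-2 : ℝ) 2 := by norm_num
  have hs1 : ∀ ε ∈ Icc 0 ε₀, |s ε - 1| ≤ 2 * κ * C * ε := by
    intro ε hε
    have h1 := hmono ε hε (s ε) (hs2 ε hε) 1 (by norm_num)
    have h2 := ((H ε hε).2.2 1 h1m).2.2.2.2.2.2.2.1
    rw [hs0 ε hε, zero_sub, abs_neg] at h1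
    norm_num at h2
    calc _ ≤ _ := h1
      _ ≤ 2 * κ * (C * ε) := by gcongr
      _ = _ := by ring
  have hω1 : ∀ ε ∈ Icc 0 ε₀, |ω ε (s ε) - ω ε 1| ≤ C * C * (2 * κ * C) ^ 2 * ε ^ 2 := by
    intro ε hε
    have hsub : uIcc 1 (s ε) ⊆ Icc (-2) 2 := by
      intro t ht
      rw [mem_uIcc] at ht
      have := hsm ε hε
      rcases ht with ht | ht
      · exact ⟨by linarith [ht.1], ht.2.trans this.2⟩
      · exact ⟨by linarith [this.1, ht.1], by linarith [ht.2]⟩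
    have h1 := abs_sub_le_of_hasDerivWithinAt_Icc (f := ω ε) (C := C * (C * |s ε - 1|))
      (a := min 1 (s ε)) (b := max 1 (s ε))
      (fun t ht => ((H ε hε).2.2 t (hsub ht)).2.2.1.mono hsub)
      (fun t ht => by
        refine ((H ε hε).2.2 t (hsub ht)).2.2.2.2.1.trans ?_
        have h2 := abs_sub_le_of_hasDerivWithinAt_Icc
          (fun t ht => ((H ε hε).2.2 t ht).2.1)
          (fun t ht => ((H ε hε).2.2 t ht).2.2.2.1) (hsub ht) (hsm ε hε)
        rw [hs0 ε hε, sub_zero] at h2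
        have h3 : |t - s ε| ≤ |s ε - 1| := by
          rw [abs_sub_comm]
          exact abs_sub_right_of_mem_uIcc ht
        gcongr
        exact h2.trans (by gcongr))
      right_mem_uIcc left_mem_uIcc
    have hε0 := hε.1
    have h2 := hs1 ε hε
    calc _ ≤ _ := h1
      _ ≤ C * (C * (2 * κ * C * ε)) * (2 * κ * C * ε) := by gcongr
      _ = _ := by ring
  refine ⟨ε₀, C + C * C * (2 * κ * C) ^ 2, r, ω, s, hε₀, by positivity, hε₁, hε₂,
    fun ε hε => ⟨(H ε hε).1, (H ε hε).2.1, fun t ht => ?_, ?_, hs0 ε hε, ?_⟩, ?_⟩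
  · have := (H ε hε).2.2 t ht
    exact ⟨this.1, this.2.1, this.2.2.1⟩
  · exact ⟨by linarith [(hs ε hε).1], by linarith [(hs ε hε).2]⟩
  · have h1 := ((H ε hε).2.2 1 h1m).2.2.2.2.2.2.2.2.2
    have h2 := hω1 ε hε
    have h3 : (((1 : ℝ) ^ 3 / 3 - 1 - 2 / 3) / κ ^ 2 + ε *
          ((2 * θ - 1 - k / (1 - θ)) * (1 ^ 4 / 12 - 1 ^ 2 / 2 - 2 * 1 / 3 - 1 / 4)
            + 2 * (2 * θ - 1) / 3 * (1 ^ 4 / 4 + 1 + 3 / 4)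
            + (2 * θ - 1) * (1 ^ 4 / 4 - 1 ^ 2 / 2 + 1 / 4)) / κ ^ 3)
        = -(4 / (3 * κ ^ 2)) + ε * (4 * k / (3 * (1 - θ) * κ ^ 3)) := by
      field_simp
      ring
    rw [h3] at h1
    have h4 := abs_sub_le (ω ε (s ε)) (ω ε 1)
      (-(4 / (3 * κ ^ 2)) + ε * (4 * k / (3 * (1 - θ) * κ ^ 3)))
    linarith
  · refine (LipschitzOnWith.of_dist_le_mul (K := (C * C * (2 * κ * C) + C).toNNReal)
      fun ε hε ε' hε' => ?_).continuousOn
    rw [Real.coe_toNNReal _ (by positivity), Real.dist_eq, Real.dist_eq]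
    have h1 : |s ε - s ε'| ≤ 2 * κ * (C * |ε - ε'|) := by
      have h2 := hmono ε hε (s ε) (hs2 ε hε) (s ε') (hs2 ε' hε')
      rw [hs0 ε hε, ← hs0 ε' hε'] at h2
      have h3 := (HL ε' hε' ε hε (s ε') (hsm ε' hε')).1
      rw [abs_sub_comm ε' ε] at h3
      exact h2.trans (by gcongr)
    have h2 := abs_sub_le_of_hasDerivWithinAt_Icc (C := C * C)
      (fun t ht => ((H ε hε).2.2 t ht).2.2.1)
      (fun t ht => ((H ε hε).2.2 t ht).2.2.2.2.1.trans (by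
        have := ((H ε hε).2.2 t ht).2.2.2.2.2.1
        gcongr)) (hsm ε hε) (hsm ε' hε')
    have h3 := (HL ε hε ε' hε' (s ε') (hsm ε' hε')).2
    have h4 := abs_sub_le (ω ε (s ε)) (ω ε (s ε')) (ω ε' (s ε'))
    have h5 : C * C * |s ε - s ε'| ≤ C * C * (2 * κ * (C * |ε - ε'|)) := by gcongr
    linarith

/-- A function with positive derivative on an open interval has a differentiable inverse, defined
on the open image of that interval. -/
theorem exists_inverse_of_hasDerivAt_pos {f f' : ℝ → ℝ} {a b : ℝ}
    (hf : ∀ t ∈ Ioo a b, HasDerivAt f (f' t) t) (hpos : ∀ t ∈ Ioo a b, 0 < f' t) :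
    StrictMonoOn f (Ioo a b) ∧ IsOpen (f '' Ioo a b) ∧ ∃ S : ℝ → ℝ,
      (∀ t ∈ Ioo a b, S (f t) = t) ∧
      ∀ y ∈ f '' Ioo a b, S y ∈ Ioo a b ∧ f (S y) = y ∧ HasDerivAt S (f' (S y))⁻¹ y := by
  have hcont : ContinuousOn f (Ioo a b) := fun t ht => (hf t ht).continuousAt.continuousWithinAt
  have hmono : StrictMonoOn f (Ioo a b) := by
    refine strictMonoOn_of_deriv_pos (convex_Ioo a b) hcont fun t ht => ?_
    rw [interior_Ioo] at ht
    rw [(hf t ht).deriv]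
    exact hpos t ht
  have hnhds : ∀ t ∈ Ioo a b, f '' Ioo a b ∈ nhds (f t) := by
    intro t ht
    obtain ⟨u, hu, hut⟩ := exists_between ht.1
    obtain ⟨v, htv, hv⟩ := exists_between ht.2
    have hsub : Icc u v ⊆ Ioo a b := fun x hx => ⟨hu.trans_le hx.1, hx.2.trans_lt hv⟩
    have hfu : f u < f t := hmono ⟨hu, hut.trans ht.2⟩ ht hut
    have hfv : f t < f v := hmono ht ⟨ht.1.trans htv, hv⟩ htv
    refine mem_of_superset (Icc_mem_nhds hfu hfv) ?_
    exact (intermediate_value_Icc (hut.trans htv).le (hcont.mono hsub)).trans (image_mono hsub)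
  have hopen : IsOpen (f '' Ioo a b) := by
    rw [isOpen_iff_mem_nhds]
    rintro _ ⟨t, ht, rfl⟩
    exact hnhds t ht
  have hleft : ∀ t ∈ Ioo a b, Function.invFunOn f (Ioo a b) (f t) = t := fun t ht =>
    hmono.injOn.leftInvOn_invFunOn ht
  refine ⟨hmono, hopen, Function.invFunOn f (Ioo a b), hleft, ?_⟩
  have hS : StrictMonoOn (Function.invFunOn f (Ioo a b)) (f '' Ioo a b) := by
    rintro _ ⟨t, ht, rfl⟩ _ ⟨u, hu, rfl⟩ h
    rw [hleft t ht, hleft u hu]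
    exact (hmono.lt_iff_lt ht hu).1 h
  rintro _ ⟨t, ht, rfl⟩
  have hSimage : Function.invFunOn f (Ioo a b) '' (f '' Ioo a b) ∈ nhds t := by
    refine mem_of_superset (isOpen_Ioo.mem_nhds ht) fun u hu => ?_
    exact ⟨f u, mem_image_of_mem f hu, hleft u hu⟩
  rw [hleft t ht]
  refine ⟨ht, rfl, ?_⟩
  refine HasDerivAt.of_local_left_inverse (f := f) ?_ ?_ (hpos t ht).ne' ?_
  · refine hS.continuousAt_of_image_mem_nhds (hnhds t ht) ?_
    rwa [hleft t ht]
  · rw [hleft t ht]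
    exact hf t ht
  · filter_upwards [hnhds t ht] with y hy
    obtain ⟨u, hu, rfl⟩ := hy
    rw [hleft u hu]

theorem contDiffOn_one_of_hasDerivAt {U : Set ℝ} {f f' : ℝ → ℝ} (hU : IsOpen U)
    (hf : ∀ y ∈ U, HasDerivAt f (f' y) y) (hf' : ContinuousOn f' U) : ContDiffOn ℝ 1 f U := by
  rw [show (1 : WithTop ℕ∞) = 0 + 1 by norm_num, contDiffOn_succ_iff_deriv_of_isOpen hU]
  refine ⟨fun y hy => (hf y hy).differentiableAt.differentiableWithinAt, by simp, ?_⟩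
  rw [contDiffOn_zero]
  exact hf'.congr fun y hy => (hf y hy).deriv

/-- A solution `(m, q)` of the first order system yields the solution `g = c m / (1 - m)` of the
second order equation. -/
theorem ode_of_system {θ k c : ℝ} {U : Set ℝ} {m q : ℝ → ℝ} (hU : IsOpen U) (hc : 0 < c)
    (hy : ∀ y ∈ U, 0 < y) (hm0 : ∀ y ∈ U, 0 < m y) (hm1 : ∀ y ∈ U, m y < 1)
    (hq1 : ∀ y ∈ U, q y < 1)
    (hm : ∀ y ∈ U, HasDerivAt m (m y * (1 - m y) / (y * (1 - q y))) y)
    (hq : ∀ y ∈ U, HasDerivAt q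
      ((2 * (m y - θ) + (2 * θ - 1) * q y - k * (1 - q y) * q y / (1 - m y)) / y) y) :
    ContDiffOn ℝ 2 (fun y => c * m y / (1 - m y)) U ∧ ∀ y ∈ U,
      deriv (fun y => c * m y / (1 - m y)) y = c * m y / (1 - m y) / (y * (1 - q y)) ∧
      deriv (deriv (fun y => c * m y / (1 - m y))) y
        = 2 * (deriv (fun y => c * m y / (1 - m y)) y) ^ 2 / (c + c * m y / (1 - m y))
          - 2 * θ * deriv (fun y => c * m y / (1 - m y)) y / y
          + k * (1 + c * m y / (1 - m y) / c)
            * (c * m y / (1 - m y) / y ^ 2 - deriv (fun y => c * m y / (1 - m y)) y / y) := by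
  have hm1' : ∀ y ∈ U, 1 - m y ≠ 0 := fun y h => (sub_pos.2 (hm1 y h)).ne'
  have hq1' : ∀ y ∈ U, 1 - q y ≠ 0 := fun y h => (sub_pos.2 (hq1 y h)).ne'
  have hyq : ∀ y ∈ U, y * (1 - q y) ≠ 0 := fun y h => mul_ne_zero (hy y h).ne' (hq1' y h)
  have hg : ∀ y ∈ U, HasDerivAt (fun y => c * m y / (1 - m y))
      (c * m y / (1 - m y) / (y * (1 - q y))) y := by
    intro y h
    refine (((hm y h).const_mul c).div ((hm y h).const_sub 1) (hm1' y h)).congr_deriv ?_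
    have h1 := hm1' y h
    have h2 := hq1' y h
    have h3 := (hy y h).ne'
    field_simp
    ring
  have hmc : ContinuousOn m U := fun y h => (hm y h).continuousAt.continuousWithinAt
  have hqc : ContinuousOn q U := fun y h => (hq y h).continuousAt.continuousWithinAt
  have hmC : ContDiffOn ℝ 1 m U := by
    refine contDiffOn_one_of_hasDerivAt hU hm ?_
    exact (hmc.mul (continuousOn_const.sub hmc)).div
      (continuousOn_id.mul (continuousOn_const.sub hqc)) hyq
  have hqC : ContDiffOn ℝ 1 q U := by
    refine contDiffOn_one_of_hasDerivAt hU hq ?_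
    refine ContinuousOn.div ?_ continuousOn_id fun y h => (hy y h).ne'
    refine ContinuousOn.sub (by fun_prop) (ContinuousOn.div (by fun_prop) (by fun_prop) hm1')
  constructor
  · rw [show (2 : WithTop ℕ∞) = 1 + 1 by norm_num, contDiffOn_succ_iff_deriv_of_isOpen hU]
    refine ⟨fun y h => (hg y h).differentiableAt.differentiableWithinAt, by simp, ?_⟩
    refine ContDiffOn.congr ?_ fun y h => (hg y h).deriv
    exact ((contDiffOn_const.mul hmC).div (contDiffOn_const.sub hmC) hm1').div
      (contDiffOn_id.mul (contDiffOn_const.sub hqC)) hyq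
  · intro y h
    have heq : deriv (fun y => c * m y / (1 - m y)) =ᶠ[nhds y]
        fun y => c * m y / (1 - m y) / (y * (1 - q y)) := by
      filter_upwards [hU.mem_nhds h] with z hz
      exact (hg z hz).deriv
    have h2 := (hg y h).div ((hasDerivAt_id y).mul ((hq y h).const_sub 1)) (hyq y h)
    refine ⟨(hg y h).deriv, ?_⟩
    rw [heq.deriv_eq, (hg y h).deriv]
    refine h2.deriv.trans ?_
    have h1 := hm1' y h
    have h2 := hq1' y h
    have h3 := (hy y h).ne'
    have h4 := (hm0 y h).ne'
    have h5 : c + c * m y / (1 - m y) = c / (1 - m y) := by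
      field_simp
      ring
    simp only [id, Pi.mul_apply]
    rw [h5]
    field_simp
    ring

theorem pos_of_mem_Icc {θ ε t : ℝ} (hθ : 0 < θ) (hθ' : θ < 1) (hε : 0 < ε) (h₁ : 4 * ε ≤ θ)
    (h₂ : 4 * ε ≤ 1 - θ) (ht : t ∈ Icc (-2 : ℝ) 2) : 0 < θ + ε * t ∧ 0 < 1 - θ - ε * t := by
  constructor <;> nlinarith [ht.1, ht.2]

/-- A scaled trajectory with its second zero yields a solution of the free boundary problem. -/
theorem exists_free_boundary_solution {θ k ε s c lam : ℝ} {r ω : ℝ → ℝ} (hθ : 0 < θ) (hθ' : θ < 1)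
    (hε : 0 < ε) (h₁ : 4 * ε ≤ θ) (h₂ : 4 * ε ≤ 1 - θ) (hr0 : r (-1) = 0) (hω0 : ω (-1) = 0)
    (hr : ∀ t ∈ Icc (-2 : ℝ) 2, ε ^ 2 * r t < 1 ∧
      HasDerivWithinAt r (scaledField θ k (t, r t, ε)) (Icc (-2) 2) t ∧
      HasDerivWithinAt ω (r t * weight θ (ε * t)) (Icc (-2) 2) t)
    (hs : s ∈ Ioo (-1 : ℝ) 2) (hrs : r s = 0) (hc : c = 1 / (θ - ε) - 1)
    (hlam : lam = 1 - exp (ε ^ 3 * ω s)) :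
    ∃ (sbar : ℝ) (g : ℝ → ℝ), 1 < sbar ∧
      (∀ y ∈ Icc 1 sbar, g y ∈ Icc 1 ((1 - lam) * sbar)) ∧
      ContDiffOn ℝ 2 g (Icc 1 sbar) ∧
      (∀ y ∈ Icc 1 sbar, deriv (deriv g) y
        = 2 * (deriv g y) ^ 2 / (c + g y) - 2 * θ * deriv g y / y
          + k * (1 + g y / c) * (g y / y ^ 2 - deriv g y / y)) ∧
      g 1 = 1 ∧ deriv g 1 = 1 ∧ g sbar = (1 - lam) * sbar ∧ deriv g sbar = 1 - lam := by
  have hθε : 0 < θ - ε := by linarith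
  have hc0 : 0 < c := by
    rw [hc, sub_pos, lt_div_iff₀ hθε]
    linarith
  have hpos := fun t (ht : t ∈ Icc (-2 : ℝ) 2) => pos_of_mem_Icc hθ hθ' hε h₁ h₂ ht
  have hsub : Ioo (-2 : ℝ) 2 ⊆ Icc (-2) 2 := Ioo_subset_Icc_self
  set Y : ℝ → ℝ := fun t => c * (θ + ε * t) / (1 - (θ + ε * t)) * exp (-(ε ^ 3 * ω t)) with hY
  set Y' : ℝ → ℝ := fun t => Y t * (ε * (1 - ε ^ 2 * r t) * weight θ (ε * t)) with hY'
  have hYpos : ∀ t ∈ Ioo (-2 : ℝ) 2, 0 < Y t := by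
    intro t ht
    obtain ⟨h3, h4⟩ := hpos t (hsub ht)
    have h5 : 0 < 1 - (θ + ε * t) := by linarith
    positivity
  have hYd : ∀ t ∈ Ioo (-2 : ℝ) 2, HasDerivAt Y (Y' t) t := by
    intro t ht
    obtain ⟨h3, h4⟩ := hpos t (hsub ht)
    have h5 : 1 - (θ + ε * t) ≠ 0 := by linarith
    have hω := (hr t (hsub ht)).2.2.hasDerivAt (Icc_mem_nhds ht.1 ht.2)
    have hm : HasDerivAt (fun t => θ + ε * t) ε t := by
      simpa using ((hasDerivAt_id t).const_mul ε).const_add θ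
    refine (((hm.const_mul c).div (hm.const_sub 1) h5).mul
      ((hω.const_mul (ε ^ 3)).neg.exp)).congr_deriv ?_
    simp only [hY', hY, weight, Pi.neg_apply, Pi.div_apply]
    have h6 : 1 - θ - ε * t ≠ 0 := h4.ne'
    rw [show 1 - (θ + ε * t) = 1 - θ - ε * t by ring]
    field_simp
    ring
  have hY'pos : ∀ t ∈ Ioo (-2 : ℝ) 2, 0 < Y' t := by
    intro t ht
    obtain ⟨h3, h4⟩ := hpos t (hsub ht)
    have h5 := sub_pos.2 (hr t (hsub ht)).1
    have h6 := hYpos t ht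
    simp only [hY', weight]
    positivity
  obtain ⟨hmono, hopen, S, hSY, hS⟩ := exists_inverse_of_hasDerivAt_pos hYd hY'pos
  have hm1 : (-1 : ℝ) ∈ Ioo (-2 : ℝ) 2 := by norm_num
  have hs2 : s ∈ Ioo (-2 : ℝ) 2 := ⟨by linarith [hs.1], hs.2⟩
  have hY1 : Y (-1) = 1 := by
    have h5 : 1 - (θ - ε) ≠ 0 := by linarith
    simp only [hY, hω0, mul_zero, neg_zero, exp_zero, mul_one, hc, mul_neg,
      ← sub_eq_add_neg]
    field_simp
  have hsbar : 1 < Y s := by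
    rw [← hY1]
    exact hmono hm1 hs2 hs.1
  have hYU : Icc 1 (Y s) ⊆ Y '' Ioo (-2) 2 := by
    rw [← hY1]
    have hsub' : Icc (-1) s ⊆ Ioo (-2 : ℝ) 2 := fun x hx =>
      ⟨by linarith [hx.1], hx.2.trans_lt hs.2⟩
    refine (intermediate_value_Icc hs.1.le fun t ht => ?_).trans (image_mono hsub')
    exact (hYd t (hsub' ht)).continuousAt.continuousWithinAt
  have hyY : ∀ y ∈ Y '' Ioo (-2) 2, 0 < y := by
    rintro _ ⟨t, ht, rfl⟩
    exact hYpos t ht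
  obtain ⟨hC2, hode⟩ := ode_of_system (θ := θ) (k := k) (m := fun y => θ + ε * S y)
    (q := fun y => ε ^ 2 * r (S y)) hopen hc0 hyY
    (fun y hy => (hpos _ (hsub (hS y hy).1)).1)
    (fun y hy => by linarith [(hpos _ (hsub (hS y hy).1)).2])
    (fun y hy => (hr _ (hsub (hS y hy).1)).1)
    (fun y hy => by
      obtain ⟨h3, h4⟩ := hpos _ (hsub (hS y hy).1)
      have h5 := (sub_pos.2 (hr _ (hsub (hS y hy).1)).1).ne'
      refine (((hS y hy).2.2.const_mul ε).const_add θ).congr_deriv ?_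
      have h6 := (hyY y hy).ne'
      simp only [hY', (hS y hy).2.1, weight]
      rw [show 1 - (θ + ε * S y) = 1 - θ - ε * S y by ring]
      field_simp)
    (fun y hy => by
      obtain ⟨h3, h4⟩ := hpos _ (hsub (hS y hy).1)
      have h5 := (sub_pos.2 (hr _ (hsub (hS y hy).1)).1).ne'
      have hrd := (hr _ (hsub (hS y hy).1)).2.1.hasDerivAt
        (Icc_mem_nhds (hS y hy).1.1 (hS y hy).1.2)
      refine ((hrd.comp y (hS y hy).2.2).const_mul (ε ^ 2)).congr_deriv ?_
      have h6 := (hyY y hy).ne'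
      simp only [hY', (hS y hy).2.1, weight, scaledField]
      rw [show 1 - (θ + ε * S y) = 1 - θ - ε * S y by ring]
      field_simp
      ring)
  have hg1 : c * (θ + ε * S 1) / (1 - (θ + ε * S 1)) = 1 := by
    have h3 := hSY _ hm1
    rw [hY1] at h3
    have h4 := hY1
    simp only [hY, hω0, mul_zero, neg_zero, exp_zero, mul_one] at h4
    rw [h3, h4]
  have hgs : c * (θ + ε * S (Y s)) / (1 - (θ + ε * S (Y s))) = (1 - lam) * Y s := by
    rw [hSY _ hs2, hlam]
    simp only [hY]
    rw [sub_sub_cancel, mul_comm (exp _), mul_assoc, ← exp_add]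
    simp
  have h1mem : (1 : ℝ) ∈ Icc 1 (Y s) := left_mem_Icc.2 hsbar.le
  have hsmem : Y s ∈ Icc 1 (Y s) := right_mem_Icc.2 hsbar.le
  refine ⟨Y s, _, hsbar, fun y hy => ?_, hC2.mono hYU, fun y hy => (hode y (hYU hy)).2, hg1, ?_,
    hgs, ?_⟩
  · have hSle : ∀ x ∈ Y '' Ioo (-2) 2, ∀ z ∈ Y '' Ioo (-2) 2, x ≤ z → S x ≤ S z := by
      intro x hx z hz hxz
      rwa [← hmono.le_iff_le (hS x hx).1 (hS z hz).1, (hS x hx).2.1, (hS z hz).2.1]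
    have hgle : ∀ x ∈ Y '' Ioo (-2) 2, ∀ z ∈ Y '' Ioo (-2) 2, x ≤ z →
        c * (θ + ε * S x) / (1 - (θ + ε * S x)) ≤ c * (θ + ε * S z) / (1 - (θ + ε * S z)) := by
      intro x hx z hz hxz
      have h3 := mul_le_mul_of_nonneg_left (hSle x hx z hz hxz) hε.le
      obtain ⟨h4, h5⟩ := hpos _ (hsub (hS x hx).1)
      obtain ⟨h6, h7⟩ := hpos _ (hsub (hS z hz).1)
      have h8 : 0 < 1 - (θ + ε * S z) := by linarith
      gcongr
    constructor
    · exact hg1.ge.trans (hgle 1 (hYU h1mem) y (hYU hy) hy.1)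
    · exact (hgle y (hYU hy) _ (hYU hsmem) hy.2).trans hgs.le
  · rw [(hode 1 (hYU h1mem)).1, hg1, ← hY1, hSY _ hm1, hr0]
    simp [hY1]
  · rw [(hode _ (hYU hsmem)).1, hgs, hSY _ hs2, hrs]
    have : Y s ≠ 0 := by linarith
    field_simp
    simp

theorem one_sub_exp_expansion {a b C : ℝ} (ha : 0 < a) (hb : 0 ≤ b) (hC : 0 ≤ C) :
    ∃ ε₁ K : ℝ, 0 < ε₁ ∧ ε₁ ≤ 1 ∧ 0 ≤ K ∧ ∀ ε ∈ Ioc 0 ε₁, ∀ w, |w - (-a + ε * b)| ≤ C * ε ^ 2 →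
      |1 - exp (ε ^ 3 * w) - ε ^ 3 * (a - ε * b)| ≤ K * ε ^ 5 ∧
      a / 2 * ε ^ 3 ≤ 1 - exp (ε ^ 3 * w) := by
  set M := a + b + C with hM
  set K := C + M ^ 2 with hK
  have hK0 : 0 ≤ K := by positivity
  set B := M + 1 + 2 / a * (b + K) with hB
  have hM0 : 0 ≤ M := by positivity
  have hBM : M + 1 ≤ B := le_add_of_nonneg_right (by positivity)
  have hB0 : 0 < B := by linarith
  refine ⟨1 / B, K, by positivity, ?_, hK0, fun ε hε w hw => ?_⟩
  · rw [div_le_one hB0]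
    linarith
  have hε0 := hε.1
  have hεB : ε * B ≤ 1 := (le_div_iff₀ hB0).1 hε.2
  have hε1 : ε ≤ 1 := by nlinarith
  have hεM : ε * M ≤ 1 := (mul_le_mul_of_nonneg_left (by linarith) hε0.le).trans hεB
  have hεK : ε * (b + K) ≤ a / 2 := by
    have h : ε * (2 / a * (b + K)) ≤ 1 :=
      (mul_le_mul_of_nonneg_left (by linarith) hε0.le).trans hεB
    rw [show ε * (2 / a * (b + K)) = ε * (b + K) / (a / 2) by field_simp,
      div_le_one (by positivity)] at h
    exact h
  have hε2 : ε ^ 2 ≤ 1 := pow_le_one₀ hε0.le hε1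
  have hwM : |w| ≤ M := by
    rw [abs_le] at hw ⊢
    have h1 : C * ε ^ 2 ≤ C := mul_le_of_le_one_right hC hε2
    have h2 : ε * b ≤ b := mul_le_of_le_one_left hb hε1
    have h3 : 0 ≤ ε * b := by positivity
    constructor <;> linarith [hw.1, hw.2]
  have hx : |ε ^ 3 * w| ≤ ε ^ 3 * M := by
    rw [abs_mul, abs_of_pos (pow_pos hε0 3)]
    gcongr
  have hx1 : |ε ^ 3 * w| ≤ 1 := by
    refine hx.trans ?_
    calc ε ^ 3 * M = ε ^ 2 * (ε * M) := by ring
      _ ≤ 1 := mul_le_one₀ hε2 (by positivity) hεM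
  have hexp := abs_exp_sub_one_sub_id_le hx1
  have hsq : (ε ^ 3 * w) ^ 2 ≤ M ^ 2 * ε ^ 5 := by
    rw [← sq_abs]
    calc |ε ^ 3 * w| ^ 2 ≤ (ε ^ 3 * M) ^ 2 := by gcongr
      _ = M ^ 2 * ε ^ 5 * ε := by ring
      _ ≤ M ^ 2 * ε ^ 5 := mul_le_of_le_one_right (by positivity) hε1
  have hw3 : |ε ^ 3 * (w - (-a + ε * b))| ≤ C * ε ^ 5 := by
    rw [abs_mul, abs_of_pos (pow_pos hε0 3)]
    calc ε ^ 3 * |w - (-a + ε * b)| ≤ ε ^ 3 * (C * ε ^ 2) := by gcongr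
      _ = C * ε ^ 5 := by ring
  have hmain : |1 - exp (ε ^ 3 * w) - ε ^ 3 * (a - ε * b)| ≤ K * ε ^ 5 := by
    rw [abs_le] at hexp hw3 ⊢
    constructor <;> linarith [hexp.1, hexp.2, hw3.1, hw3.2]
  refine ⟨hmain, ?_⟩
  have h1 := (abs_le.1 hmain).1
  have h2 : K * ε ^ 5 ≤ K * ε ^ 4 :=
    mul_le_mul_of_nonneg_left (pow_le_pow_of_le_one hε0.le hε1 (by norm_num)) hK0
  have h3 := mul_le_mul_of_nonneg_left hεK (pow_pos hε0 3).le
  linarith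

theorem abs_sub_mul_sq_le {x b D : ℝ} (hx : 0 ≤ x) (hb : 0 ≤ b) (h : |x ^ 3 - b ^ 3| ≤ D) :
    |x - b| * b ^ 2 ≤ D := by
  refine le_trans ?_ h
  rw [show x ^ 3 - b ^ 3 = (x - b) * (x ^ 2 + x * b + b ^ 2) by ring, abs_mul]
  refine mul_le_mul_of_nonneg_left ((le_abs_self _).trans' ?_) (abs_nonneg _)
  linarith [sq_nonneg x, mul_nonneg hx hb]

set_option maxHeartbeats 800000 in
theorem boundary_expansion {θ k κ K : ℝ} (hθ : 0 < θ) (hθ' : θ < 1) (hk : 0 ≤ k)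
    (hκ : κ = θ * (1 - θ)) (hK : 0 ≤ K) :
    ∃ K' : ℝ, 0 ≤ K' ∧ ∀ ε lam x : ℝ, 0 < ε → ε ≤ 1 → 4 * ε ≤ θ → ε * (k / ((1 - θ) * κ)) ≤ 1 →
      |lam - ε ^ 3 * (4 / (3 * κ ^ 2) - ε * (4 * k / (3 * (1 - θ) * κ ^ 3)))| ≤ K * ε ^ 5 →
      0 ≤ x → x ^ 3 = 6 / κ * lam →
      |1 / (θ - ε) - 1 / θ - ((1 - θ) / (2 * θ) * x
        + (k + 3 * (1 - θ) ^ 2) / (12 * θ) * x ^ 2)| ≤ K' * ε ^ 3 := by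
  have hθ1 : 0 < 1 - θ := by linarith
  have hκ0 : 0 < κ := hκ ▸ mul_pos hθ hθ1
  set β := k / ((1 - θ) * κ) with hβ
  have hβ0 : 0 ≤ β := by positivity
  set D := 6 / κ * K + 8 / κ ^ 3 * β ^ 2 with hD
  have hD0 : 0 ≤ D := by positivity
  set B := 2 / κ + D * κ ^ 2 with hB
  set p₁ := (1 - θ) / (2 * θ) with hp₁
  set p₂ := (k + 3 * (1 - θ) ^ 2) / (12 * θ) with hp₂
  have hp₁0 : 0 ≤ p₁ := by positivity
  have hp₂0 : 0 ≤ p₂ := by positivity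
  refine ⟨2 / θ ^ 4 + p₁ * (D * κ ^ 2) + p₂ * (D * κ ^ 2 * (2 * B)) + p₂ * (4 / κ ^ 2 * β),
    by positivity, fun ε lam x hε hε1 hεθ hεβ hlam hx hx3 => ?_⟩
  set b := 2 * ε / κ * (1 - ε * β / 3) with hb
  have hεβ0 : 0 ≤ ε * β := by positivity
  have hb1 : ε / κ ≤ b := by
    have h : 0 ≤ ε / κ := by positivity
    rw [hb, mul_div_assoc]
    nlinarith
  have hb2 : b ≤ 2 / κ * ε := by
    have h : 0 ≤ 2 / κ * ε := by positivity
    rw [hb, show 2 * ε / κ = 2 / κ * ε by ring]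
    nlinarith
  have hb0 : 0 ≤ b := hb1.trans' (by positivity)
  have hcube : |x ^ 3 - b ^ 3| ≤ D * ε ^ 5 := by
    have h1 : x ^ 3 - b ^ 3 = 6 / κ * (lam - ε ^ 3 * (4 / (3 * κ ^ 2)
        - ε * (4 * k / (3 * (1 - θ) * κ ^ 3))))
        - 8 / κ ^ 3 * ε ^ 3 * ((ε * β) ^ 2 / 3 - (ε * β) ^ 3 / 27) := by
      rw [hx3, hb, hβ]
      field_simp
      ring
    have h2 : |8 / κ ^ 3 * ε ^ 3 * ((ε * β) ^ 2 / 3 - (ε * β) ^ 3 / 27)|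
        ≤ 8 / κ ^ 3 * β ^ 2 * ε ^ 5 := by
      have h3 : 0 ≤ 8 / κ ^ 3 * ε ^ 3 := by positivity
      have h4 : |(ε * β) ^ 2 / 3 - (ε * β) ^ 3 / 27| ≤ (ε * β) ^ 2 := by
        have h5 : (ε * β) ^ 3 ≤ (ε * β) ^ 2 := pow_le_pow_of_le_one hεβ0 hεβ (by norm_num)
        have h6 : 0 ≤ (ε * β) ^ 3 := by positivity
        rw [abs_le]
        constructor <;> linarith
      rw [abs_mul, abs_of_nonneg h3]
      refine (mul_le_mul_of_nonneg_left h4 h3).trans (le_of_eq ?_)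
      ring
    rw [h1]
    refine (abs_sub _ _).trans ?_
    rw [abs_mul, abs_of_pos (show 0 < 6 / κ by positivity)]
    have h3 := mul_le_mul_of_nonneg_left hlam (show 0 ≤ 6 / κ by positivity)
    linarith
  have hxb : |x - b| ≤ D * κ ^ 2 * ε ^ 3 := by
    have h1 := abs_sub_mul_sq_le hx hb0 hcube
    have h2 : |x - b| * (ε / κ) ^ 2 ≤ D * ε ^ 5 :=
      (mul_le_mul_of_nonneg_left (by gcongr) (abs_nonneg _)).trans h1
    rw [← le_div_iff₀ (by positivity)] at h2
    refine h2.trans (le_of_eq ?_)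
    field_simp
  have hbB : b ≤ B := by
    have h1 : 2 / κ * ε ≤ 2 / κ := mul_le_of_le_one_right (by positivity) hε1
    have h2 : 0 ≤ D * κ ^ 2 := by positivity
    linarith
  have hxB : x ≤ B := by
    have h1 : 2 / κ * ε ≤ 2 / κ := mul_le_of_le_one_right (by positivity) hε1
    have h2 : D * κ ^ 2 * ε ^ 3 ≤ D * κ ^ 2 :=
      mul_le_of_le_one_right (by positivity) (pow_le_one₀ hε.le hε1)
    linarith [le_abs_self (x - b)]
  have hxb2 : |x ^ 2 - b ^ 2| ≤ D * κ ^ 2 * (2 * B) * ε ^ 3 := by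
    rw [show x ^ 2 - b ^ 2 = (x - b) * (x + b) by ring, abs_mul, abs_of_nonneg (add_nonneg hx hb0)]
    calc |x - b| * (x + b) ≤ D * κ ^ 2 * ε ^ 3 * (2 * B) := by
          gcongr
          linarith
      _ = D * κ ^ 2 * (2 * B) * ε ^ 3 := by ring
  have hθε : 0 < θ - ε := by linarith
  have hrem : |ε ^ 3 / (θ ^ 3 * (θ - ε))| ≤ 2 / θ ^ 4 * ε ^ 3 := by
    rw [abs_of_nonneg (by positivity), div_le_iff₀ (by positivity)]
    have h1 : 1 ≤ 2 / θ ^ 4 * (θ ^ 3 * (θ - ε)) := by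
      rw [show 2 / θ ^ 4 * (θ ^ 3 * (θ - ε)) = 2 * (θ - ε) / θ by field_simp, one_le_div hθ]
      linarith
    calc ε ^ 3 ≤ ε ^ 3 * (2 / θ ^ 4 * (θ ^ 3 * (θ - ε))) :=
          le_mul_of_one_le_right (by positivity) h1
      _ = _ := by ring
  have hrem2 : |4 / κ ^ 2 * ε ^ 2 * (2 * (ε * β) / 3 - (ε * β) ^ 2 / 9)|
      ≤ 4 / κ ^ 2 * β * ε ^ 3 := by
    have h3 : 0 ≤ 4 / κ ^ 2 * ε ^ 2 := by positivity
    have h4 : |2 * (ε * β) / 3 - (ε * β) ^ 2 / 9| ≤ ε * β := by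
      have h5 : (ε * β) ^ 2 ≤ ε * β := pow_le_of_le_one hεβ0 hεβ two_ne_zero
      have h6 : 0 ≤ (ε * β) ^ 2 := by positivity
      rw [abs_le]
      constructor <;> linarith
    rw [abs_mul, abs_of_nonneg h3]
    refine (mul_le_mul_of_nonneg_left h4 h3).trans (le_of_eq ?_)
    ring
  have hid : 1 / (θ - ε) - 1 / θ - (p₁ * x + p₂ * x ^ 2) = ε ^ 3 / (θ ^ 3 * (θ - ε))
      - p₁ * (x - b) - p₂ * (x ^ 2 - b ^ 2)
      + p₂ * (4 / κ ^ 2 * ε ^ 2 * (2 * (ε * β) / 3 - (ε * β) ^ 2 / 9)) := by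
    have h1 : 1 / (θ - ε) - 1 / θ - ε ^ 3 / (θ ^ 3 * (θ - ε)) = ε / θ ^ 2 + ε ^ 2 / θ ^ 3 := by
      have := hθε.ne'
      field_simp
      ring
    have h2 : ε / θ ^ 2 + ε ^ 2 / θ ^ 3 = p₁ * b + p₂ * b ^ 2
        + p₂ * (4 / κ ^ 2 * ε ^ 2 * (2 * (ε * β) / 3 - (ε * β) ^ 2 / 9)) := by
      rw [hb, hp₁, hp₂, hβ, hκ]
      field_simp
      ring
    linarith
  rw [hid]
  have e1 := mul_le_mul_of_nonneg_left hxb hp₁0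
  have e2 := mul_le_mul_of_nonneg_left hxb2 hp₂0
  have e3 := mul_le_mul_of_nonneg_left hrem2 hp₂0
  rw [← abs_of_nonneg hp₁0, ← abs_mul, abs_of_nonneg hp₁0] at e1
  rw [← abs_of_nonneg hp₂0, ← abs_mul, abs_of_nonneg hp₂0] at e2 e3
  rw [abs_le] at e1 e2 e3 hrem ⊢
  constructor <;> linarith [e1.1, e1.2, e2.1, e2.2, e3.1, e3.2, hrem.1, hrem.2]

/-- Asymptotic expansion of the free-boundary parameter `c(λ)`:
`c = c̄ + ((1-θ)/(2θ))(6/(θ(1-θ)))^{1/3} λ^{1/3}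
  + ((2δ/σ² + 3(1-θ)²)/(12θ))(6/(θ(1-θ)))^{2/3} λ^{2/3} + O(λ)`,
and in particular `c(λ) > c̄` for small `λ > 0`. -/
theorem c_expansion
    (μ σ δ θ cbar : ℝ) (hμ : 0 < μ) (hσ : 0 < σ) (hδ : 0 < δ)
    (hθdef : θ = μ / σ ^ 2) (hθ : θ ∈ Ioo (0:ℝ) 1)
    (hcbar : cbar = (1 - θ) / θ) :
    ∃ lam₀ > (0:ℝ), ∃ (c sbar : ℝ → ℝ) (g : ℝ → ℝ → ℝ),
      (∀ lam : ℝ, 0 < lam → lam < lam₀ →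
        cbar < c lam ∧ 1 < sbar lam ∧
        (∀ y ∈ Icc (1:ℝ) (sbar lam),
          g lam y ∈ Icc (1:ℝ) ((1 - lam) * sbar lam)) ∧
        ContDiffOn ℝ 2 (g lam) (Icc 1 (sbar lam)) ∧
        (∀ y ∈ Icc (1:ℝ) (sbar lam),
          deriv (deriv (g lam)) y
            = 2 * (deriv (g lam) y) ^ 2 / (c lam + g lam y)
              - 2 * θ * deriv (g lam) y / y
              + 2 * δ / σ ^ 2 * (1 + g lam y / c lam)
                  * (g lam y / y ^ 2 - deriv (g lam) y / y)) ∧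
        g lam 1 = 1 ∧ deriv (g lam) 1 = 1 ∧
        g lam (sbar lam) = (1 - lam) * sbar lam ∧
        deriv (g lam) (sbar lam) = 1 - lam) ∧
      (fun lam : ℝ => c lam
          - (cbar
            + (1 - θ) / (2 * θ) * (6 / (θ * (1 - θ))) ^ ((1:ℝ)/3) * lam ^ ((1:ℝ)/3)
            + (2 * δ / σ ^ 2 + 3 * (1 - θ) ^ 2) / (12 * θ)
                * (6 / (θ * (1 - θ))) ^ ((2:ℝ)/3) * lam ^ ((2:ℝ)/3)))
        =O[nhdsWithin 0 (Ioi 0)] (fun lam : ℝ => lam) := by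
  obtain ⟨hθ0, hθ1⟩ := hθ
  have hθ1' : 0 < 1 - θ := by linarith
  set k := 2 * δ / σ ^ 2 with hk
  have hk0 : 0 ≤ k := by positivity
  set κ := θ * (1 - θ) with hκ
  have hκ0 : 0 < κ := mul_pos hθ0 hθ1'
  obtain ⟨ε₀, C, r, ω, s, hε₀, hC, h₁, h₂, htraj, hcont⟩ :=
    exists_scaled_return (k := k) hθ0 hθ1 hκ
  set a := 4 / (3 * κ ^ 2) with ha
  have ha0 : 0 < a := by positivity
  obtain ⟨ε₁, K, hε₁, hε₁1, hK, hlam⟩ := one_sub_exp_expansion (a := a)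
    (b := 4 * k / (3 * (1 - θ) * κ ^ 3)) (C := C) ha0 (by positivity) hC
  obtain ⟨K', hK', hexpand⟩ := boundary_expansion hθ0 hθ1 hk0 hκ hK
  set β := k / ((1 - θ) * κ) with hβ
  have hβ0 : 0 ≤ β := by positivity
  set e₁ := min ε₀ (min ε₁ (1 / (β + 1))) with he₁
  have he₁0 : 0 < e₁ := lt_min hε₀ (lt_min hε₁ (by positivity))
  have hle₀ : e₁ ≤ ε₀ := min_le_left _ _
  have hle₁ : e₁ ≤ ε₁ := (min_le_right _ _).trans (min_le_left _ _)
  have hleβ : e₁ ≤ 1 / (β + 1) := (min_le_right _ _).trans (min_le_right _ _)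
  set L : ℝ → ℝ := fun ε => 1 - exp (ε ^ 3 * ω ε (s ε)) with hL
  have hLε : ∀ ε ∈ Ioc 0 e₁, |L ε - ε ^ 3 * (a - ε * (4 * k / (3 * (1 - θ) * κ ^ 3)))| ≤ K * ε ^ 5 ∧
      a / 2 * ε ^ 3 ≤ L ε := fun ε hε =>
    hlam ε ⟨hε.1, hε.2.trans hle₁⟩ _ (htraj ε ⟨hε.1.le, hε.2.trans hle₀⟩).2.2.2.2.2
  have hLcont : ContinuousOn L (Icc 0 e₁) := by
    have h := hcont.mono (Icc_subset_Icc_right hle₀)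
    exact continuousOn_const.sub ((continuousOn_id.pow 3).mul h).rexp
  have hL0 : L 0 = 0 := by simp [hL]
  have hLpos : 0 < L e₁ := lt_of_lt_of_le (by positivity) (hLε e₁ ⟨he₁0, le_rfl⟩).2
  have hsol : ∀ lam : ℝ, ∃ (ε sbar : ℝ) (g : ℝ → ℝ), 0 < lam → lam < L e₁ →
      ε ∈ Ioc 0 e₁ ∧ L ε = lam ∧ 1 < sbar ∧
      (∀ y ∈ Icc 1 sbar, g y ∈ Icc 1 ((1 - lam) * sbar)) ∧
      ContDiffOn ℝ 2 g (Icc 1 sbar) ∧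
      (∀ y ∈ Icc 1 sbar, deriv (deriv g) y
        = 2 * (deriv g y) ^ 2 / (1 / (θ - ε) - 1 + g y) - 2 * θ * deriv g y / y
          + k * (1 + g y / (1 / (θ - ε) - 1)) * (g y / y ^ 2 - deriv g y / y)) ∧
      g 1 = 1 ∧ deriv g 1 = 1 ∧ g sbar = (1 - lam) * sbar ∧ deriv g sbar = 1 - lam := by
    intro lam
    by_cases h : 0 < lam ∧ lam < L e₁
    · obtain ⟨ε, hε, hεL⟩ := intermediate_value_Icc he₁0.le hLcont ⟨hL0.trans_le h.1.le, h.2.le⟩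
      have hε0 : 0 < ε := by
        refine lt_of_le_of_ne hε.1 ?_
        rintro rfl
        linarith [h.1]
      have hε₀' := hε.2.trans hle₀
      obtain ⟨hr0, hω0, hr, hs, hrs, -⟩ := htraj ε ⟨hε0.le, hε₀'⟩
      obtain ⟨sbar, g, hg⟩ := exists_free_boundary_solution hθ0 hθ1 hε0 (by linarith) (by linarith)
        hr0 hω0 hr hs hrs rfl hεL.symm
      exact ⟨ε, sbar, g, fun _ _ => ⟨⟨hε0, hε.2⟩, hεL, hg⟩⟩
    · exact ⟨0, 0, 0, fun h3 h4 => absurd ⟨h3, h4⟩ h⟩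
  choose e sbar g hsol using hsol
  refine ⟨L e₁, hLpos, fun lam => 1 / (θ - e lam) - 1, sbar, g, fun lam h3 h4 => ?_, ?_⟩
  · obtain ⟨he, -, hrest⟩ := hsol lam h3 h4
    refine ⟨?_, hrest⟩
    have h5 : 0 < θ - e lam := by linarith [he.2]
    rw [hcbar, sub_div, div_self hθ0.ne']
    have := one_div_lt_one_div_of_lt h5 (sub_lt_self θ he.1)
    linarith
  · refine IsBigO.of_bound (K' * (2 / a)) ?_
    filter_upwards [Ioo_mem_nhdsGT hLpos] with lam hl
    obtain ⟨he, heL, -⟩ := hsol lam hl.1 hl.2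
    have h5 := hLε _ he
    rw [heL] at h5
    have hx : (6 / κ * lam) ^ ((1 : ℝ) / 3) = (6 / κ) ^ ((1 : ℝ) / 3) * lam ^ ((1 : ℝ) / 3) :=
      mul_rpow (by positivity) hl.1.le
    have h6κ : 0 ≤ 6 / κ * lam := mul_nonneg (by positivity) hl.1.le
    have hx2 : ((6 / κ * lam) ^ ((1 : ℝ) / 3)) ^ 2
        = (6 / κ) ^ ((2 : ℝ) / 3) * lam ^ ((2 : ℝ) / 3) := by
      rw [← mul_rpow (by positivity) hl.1.le, ← rpow_natCast, ← rpow_mul h6κ]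
      norm_num
    have hx3 : ((6 / κ * lam) ^ ((1 : ℝ) / 3)) ^ 3 = 6 / κ * lam := by
      rw [← rpow_natCast, ← rpow_mul h6κ]
      norm_num
    have heβ : e lam * β ≤ 1 := by
      have h6 := (le_div_iff₀ (by positivity)).1 (he.2.trans hleβ)
      linarith [he.1]
    have h6 := hexpand (e lam) lam _ he.1 (he.2.trans (hle₁.trans hε₁1)) (by linarith [he.2]) heβ
      h5.1 (rpow_nonneg h6κ _) hx3
    rw [hx2, hx] at h6
    rw [norm_eq_abs, norm_eq_abs, abs_of_pos hl.1]
    have h7 : K' * e lam ^ 3 ≤ K' * (2 / a) * lam := by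
      rw [mul_assoc]
      refine mul_le_mul_of_nonneg_left ?_ hK'
      rw [div_mul_eq_mul_div, le_div_iff₀ ha0]
      linarith [h5.2]
    refine le_trans (le_of_eq ?_) (h6.trans h7)
    congr 1
    rw [hcbar, sub_div, div_self hθ0.ne']
    ring
end

section
/- With the notation of the free boundary problem, the boundary point $\overline{s}=\overline{s}(\lambda)$ satisfies, as $\lambda\downarrow 0$: $\overline{s}=1+\left(\frac{6}{\theta(1-\theta)}\right)^{1/3}\lambda^{1/3}+\frac{1}{2}\left(\frac{6}{\theta(1-\theta)}\right)^{2/3}\lambda^{2/3}+O(\lambda)$. -/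
open Set Filter Asymptotics Real

open scoped Topology

/-- Integrating the bound `|f'| ≤ C tⁿ` from a zero of `f` at the origin. -/
lemma abs_le_mul_pow_succ_of_hasDerivAt {f f' : ℝ → ℝ} {C T : ℝ} {n : ℕ} (hC : 0 ≤ C)
    (h0 : f 0 = 0) (hf : ∀ t ∈ Icc 0 T, HasDerivAt f (f' t) t)
    (hb : ∀ t ∈ Icc 0 T, |f' t| ≤ C * t ^ n) :
    ∀ t ∈ Icc 0 T, |f t| ≤ C * t ^ (n + 1) := by
  intro t ht
  have hsub : ∀ s ∈ Icc 0 t, s ∈ Icc 0 T := fun s hs => ⟨hs.1, hs.2.trans ht.2⟩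
  have := (convex_Icc 0 t).norm_image_sub_le_of_norm_hasDerivWithin_le
    (f := f) (f' := f') (C := C * t ^ n)
    (fun s hs => (hf s (hsub s hs)).hasDerivWithinAt)
    (fun s hs => (hb s (hsub s hs)).trans
      (mul_le_mul_of_nonneg_left (pow_le_pow_left₀ hs.1 hs.2 n) hC))
    (left_mem_Icc.2 ht.1) (right_mem_Icc.2 ht.1)
  rw [h0, sub_zero, sub_zero, Real.norm_eq_abs, Real.norm_eq_abs, abs_of_nonneg ht.1] at this
  rw [pow_succ, ← mul_assoc]
  exact this

/-- Trapezoidal rule for an antiderivative of a function `v` vanishing at both ends, with the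
second derivative `f₂` of `v` at the midpoint close to `A`. -/
lemma abs_sub_add_cube_le {ρ v f₁ f₂ f₃ f₄ : ℝ → ℝ} {A M K w : ℝ} (hw : 0 ≤ w) (hK : 0 ≤ K)
    (hρ : ∀ x ∈ Icc 0 w, HasDerivAt ρ (v x) x) (hv : ∀ x ∈ Icc 0 w, HasDerivAt v (f₁ x) x)
    (h₁ : ∀ x ∈ Icc 0 w, HasDerivAt f₁ (f₂ x) x) (h₂ : ∀ x ∈ Icc 0 w, HasDerivAt f₂ (f₃ x) x)
    (h₃ : ∀ x ∈ Icc 0 w, HasDerivAt f₃ (f₄ x) x)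
    (b₂ : ∀ x ∈ Icc 0 w, |f₂ x| ≤ M) (b₃ : ∀ x ∈ Icc 0 w, |f₃ x| ≤ M)
    (b₄ : ∀ x ∈ Icc 0 w, |f₄ x| ≤ M)
    (hA : ∀ x ∈ Icc 0 w, |f₂ x - A| ≤ K * (|f₁ x| + |v x|))
    (v0 : v 0 = 0) (vw : v w = 0) :
    |ρ w - ρ 0 + A * w ^ 3 / 12| ≤ (2 * M + 2 * K * M) * w ^ 5 := by
  have hM : 0 ≤ M := (abs_nonneg _).trans (b₂ 0 ⟨le_rfl, hw⟩)
  obtain ⟨m, rfl⟩ : ∃ m, w = 2 * m := ⟨w / 2, by ring⟩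
  have hm : 0 ≤ m := by linarith
  have hp : ∀ t ∈ Icc 0 m, m + t ∈ Icc 0 (2 * m) :=
    fun t ht => ⟨by linarith [ht.1], by linarith [ht.2]⟩
  have hn : ∀ t ∈ Icc 0 m, m - t ∈ Icc 0 (2 * m) :=
    fun t ht => ⟨by linarith [ht.2], by linarith [ht.1]⟩
  have dp : ∀ {f f' : ℝ → ℝ}, (∀ x ∈ Icc 0 (2 * m), HasDerivAt f (f' x) x) →
      ∀ t ∈ Icc 0 m, HasDerivAt (fun t => f (m + t)) (f' (m + t)) t :=
    fun h t ht => (h _ (hp t ht)).comp_const_add m t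
  have dn : ∀ {f f' : ℝ → ℝ}, (∀ x ∈ Icc 0 (2 * m), HasDerivAt f (f' x) x) →
      ∀ t ∈ Icc 0 m, HasDerivAt (fun t => f (m - t)) (-f' (m - t)) t :=
    fun h t ht => (h _ (hn t ht)).comp_const_sub m t
  have mm : m ∈ Icc 0 m := ⟨hm, le_rfl⟩
  have two : ∀ f : ℝ → ℝ, (∀ x ∈ Icc 0 (2 * m), |f x| ≤ M) →
      ∀ t ∈ Icc 0 m, |f (m + t) + f (m - t)| ≤ 2 * M * t ^ 0 := fun f h t ht => by
    have := abs_add_le (f (m + t)) (f (m - t))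
    have := h _ (hp t ht)
    have := h _ (hn t ht)
    rw [pow_zero]; linarith
  have hC : 0 ≤ 2 * M := by linarith
  -- the odd differences of `f₁`, `f₂`, `f₃`
  have o₁ := abs_le_mul_pow_succ_of_hasDerivAt (f := fun t => f₁ (m + t) - f₁ (m - t))
    (f' := fun t => f₂ (m + t) + f₂ (m - t)) hC (by simp)
    (fun t ht => ((dp h₁ t ht).sub (dn h₁ t ht)).congr_deriv (by ring)) (two f₂ b₂)
  have o₂ := abs_le_mul_pow_succ_of_hasDerivAt (f := fun t => f₂ (m + t) - f₂ (m - t))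
    (f' := fun t => f₃ (m + t) + f₃ (m - t)) hC (by simp)
    (fun t ht => ((dp h₂ t ht).sub (dn h₂ t ht)).congr_deriv (by ring)) (two f₃ b₃)
  have o₃ := abs_le_mul_pow_succ_of_hasDerivAt (f := fun t => f₃ (m + t) - f₃ (m - t))
    (f' := fun t => f₄ (m + t) + f₄ (m - t)) hC (by simp)
    (fun t ht => ((dp h₃ t ht).sub (dn h₃ t ht)).congr_deriv (by ring)) (two f₄ b₄)
  have e₀ := abs_le_mul_pow_succ_of_hasDerivAt (f := fun t => v (m + t) + v (m - t) - 2 * v m)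
    hC (by simp; ring)
    (fun t ht => by
      simpa [sub_eq_add_neg] using ((dp hv t ht).add (dn hv t ht)).sub_const (2 * v m)) o₁ m mm
  have e₁ := abs_le_mul_pow_succ_of_hasDerivAt
    (f := fun t => f₁ (m + t) + f₁ (m - t) - 2 * f₁ m) hC (by simp; ring)
    (fun t ht => by
      simpa [sub_eq_add_neg] using ((dp h₁ t ht).add (dn h₁ t ht)).sub_const (2 * f₁ m)) o₂
  have e₂ := abs_le_mul_pow_succ_of_hasDerivAt
    (f := fun t => f₂ (m + t) + f₂ (m - t) - 2 * f₂ m) hC (by simp; ring)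
    (fun t ht => by
      simpa [sub_eq_add_neg] using ((dp h₂ t ht).add (dn h₂ t ht)).sub_const (2 * f₂ m)) o₃
  have q₁ := abs_le_mul_pow_succ_of_hasDerivAt
    (f := fun t => v (m + t) - v (m - t) - 2 * f₁ m * t) hC (by simp)
    (fun t ht => (((dp hv t ht).sub (dn hv t ht)).sub
      ((hasDerivAt_id t).const_mul (2 * f₁ m))).congr_deriv (by ring)) e₁ m mm
  have q₂ := abs_le_mul_pow_succ_of_hasDerivAt
    (f := fun t => f₁ (m + t) - f₁ (m - t) - 2 * f₂ m * t) hC (by simp)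
    (fun t ht => (((dp h₁ t ht).sub (dn h₁ t ht)).sub
      ((hasDerivAt_id t).const_mul (2 * f₂ m))).congr_deriv (by ring)) e₂
  have q₃ := abs_le_mul_pow_succ_of_hasDerivAt (n := 4)
    (f := fun t => ρ (m + t) - ρ (m - t) - t * (v (m + t) + v (m - t)) + 2 / 3 * f₂ m * t ^ 3)
    (f' := fun t => -t * (f₁ (m + t) - f₁ (m - t) - 2 * f₂ m * t)) hC (by simp)
    (fun t ht => by
      refine ((((dp hρ t ht).sub (dn hρ t ht)).sub
        ((hasDerivAt_id t).mul ((dp hv t ht).add (dn hv t ht)))).add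
        ((hasDerivAt_pow 3 t).const_mul (2 / 3 * f₂ m))).congr_deriv ?_
      simp only [id, Pi.add_apply]
      norm_num
      ring)
    (fun t ht => by
      rw [abs_mul, abs_neg, abs_of_nonneg ht.1]
      calc t * _ ≤ t * (2 * M * t ^ 3) := mul_le_mul_of_nonneg_left (q₂ t ht) ht.1
        _ = 2 * M * t ^ 4 := by ring) m mm
  simp only [sub_self, ← two_mul, v0, vw] at e₀ q₁ q₃
  have hAm := hA m ⟨hm, by linarith⟩
  have hvm : |v m| ≤ M * m ^ 2 := by
    have : |2 * v m| ≤ 2 * M * m ^ 2 := by simpa using e₀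
    rw [abs_mul, abs_of_pos (by norm_num : (0:ℝ) < 2)] at this
    linarith
  rcases hm.eq_or_lt with rfl | hm'
  · simp
  have hfm : |f₁ m| ≤ M * m ^ 2 := by
    have : |2 * f₁ m * m| ≤ 2 * M * m ^ 3 := by simpa using q₁
    rw [abs_mul, abs_mul, abs_of_pos (by norm_num : (0:ℝ) < 2), abs_of_pos hm'] at this
    refine le_of_mul_le_mul_right ?_ (by positivity : 0 < 2 * m)
    nlinarith
  have hd : |f₂ m - A| ≤ 2 * K * M * m ^ 2 :=
    hAm.trans (by nlinarith [mul_le_mul_of_nonneg_left (add_le_add hfm hvm) hK])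
  have hd' : |2 / 3 * m ^ 3 * (f₂ m - A)| ≤ 2 / 3 * m ^ 3 * (2 * K * M * m ^ 2) := by
    rw [abs_mul, abs_of_pos (by positivity : 0 < 2 / 3 * m ^ 3)]
    gcongr
  have key : ρ (2 * m) - ρ 0 + A * (2 * m) ^ 3 / 12 =
      (ρ (2 * m) - ρ 0 - m * (2 * 0) + 2 / 3 * f₂ m * m ^ 3) - 2 / 3 * m ^ 3 * (f₂ m - A) := by
    ring
  have q₃' : |ρ (2 * m) - ρ 0 - m * (2 * 0) + 2 / 3 * f₂ m * m ^ 3| ≤ 2 * M * m ^ 5 := by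
    convert q₃ using 3
  rw [key]
  refine (abs_sub _ _).trans ((add_le_add q₃' hd').trans ?_)
  have : 0 ≤ K * M * m ^ 5 := by positivity
  have : 0 ≤ M * m ^ 5 := by positivity
  nlinarith

/-- Local flow of a `C¹` vector field, confined to a prescribed neighbourhood. -/
lemma exists_local_flow {E : Type*} [NormedAddCommGroup E] [NormedSpace ℝ E] [CompleteSpace E]
    {X : E → E} {z : E} (hX : ContDiffAt ℝ 1 X z) {N : Set E} (hN : N ∈ 𝓝 z) :
    ∃ r > (0 : ℝ), ∃ τ > (0 : ℝ), ∃ γ : E × ℝ → E,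
      (∀ x ∈ Metric.closedBall z r, γ (x, 0) = x ∧ ∀ t ∈ Ioo (-τ) τ,
        HasDerivAt (fun t => γ (x, t)) (X (γ (x, t))) t ∧ γ (x, t) ∈ N) ∧
      ContinuousOn γ (Metric.closedBall z r ×ˢ Ioo (-τ) τ) := by
  obtain ⟨ε, hε, a, r, L, K, hr, hpl⟩ := IsPicardLindelof.of_contDiffAt_one hX
  obtain ⟨γ, hγ, hc⟩ :=
    (hpl 0).exists_forall_mem_closedBall_eq_hasDerivWithinAt_continuousOn
  simp only [zero_sub, zero_add] at hγ hc
  have hnhds : Metric.closedBall z (r : ℝ) ×ˢ Icc (-ε) ε ∈ 𝓝 (z, (0 : ℝ)) :=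
    prod_mem_nhds (Metric.closedBall_mem_nhds z hr) (Icc_mem_nhds (by linarith) hε)
  have hz : γ (z, 0) = z := (hγ z (Metric.mem_closedBall_self hr.le)).1
  have hpre : γ ⁻¹' N ∈ 𝓝 (z, (0 : ℝ)) :=
    (hc.continuousAt hnhds).preimage_mem_nhds (by rwa [hz])
  obtain ⟨η, hη, hball⟩ := Metric.mem_nhds_iff.1 hpre
  have hsub : ∀ x ∈ Metric.closedBall z (min r (η / 2)),
      x ∈ Metric.closedBall z (r : ℝ) ∧ dist x z < η := fun x hx => by
    have := Metric.mem_closedBall.1 hx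
    exact ⟨this.trans (min_le_left _ _), this.trans_lt ((min_le_right _ _).trans_lt (by linarith))⟩
  have hsub' : ∀ t ∈ Ioo (-(min ε η)) (min ε η), t ∈ Ioo (-ε) ε ∧ |t| < η := fun t ht => by
    have h := abs_lt.2 ht
    exact ⟨abs_lt.1 (h.trans_le (min_le_left _ _)), h.trans_le (min_le_right _ _)⟩
  refine ⟨min r (η / 2), lt_min hr (by linarith), min ε η, lt_min hε hη, γ,
    fun x hx => ⟨(hγ x (hsub x hx).1).1, fun t ht => ⟨?_, ?_⟩⟩, ?_⟩
  · have h := (hsub' t ht).1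
    exact ((hγ x (hsub x hx).1).2 t (Ioo_subset_Icc_self h)).hasDerivAt (Icc_mem_nhds h.1 h.2)
  · refine hball ?_
    rw [Metric.mem_ball, Prod.dist_eq, max_lt_iff]
    exact ⟨(hsub x hx).2, by simpa using (hsub' t ht).2⟩
  · exact hc.mono (prod_mono (fun x hx => (hsub x hx).1)
      fun t ht => Ioo_subset_Icc_self (hsub' t ht).1)

/-- A strictly convex function which starts at `0` with nonpositive slope `d` and ends up positive
has a last zero `w`, and it is negative before `w` and positive after `w`. -/
lemma exists_zero_of_strictConvexOn {v : ℝ → ℝ} {d T : ℝ} (hT : 0 < T)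
    (hv : StrictConvexOn ℝ (Icc 0 T) v) (hc : ContinuousOn v (Icc 0 T)) (h0 : v 0 = 0)
    (hd : HasDerivAt v d 0) (hd0 : d ≤ 0) (hvT : 0 < v T) :
    ∃ w ∈ Ico 0 T, v w = 0 ∧ (d < 0 → 0 < w) ∧ (d = 0 → w = 0) ∧
      (∀ x ∈ Ioo 0 w, v x < 0) ∧ ∀ x ∈ Ioc w T, 0 < v x := by
  have h0T : (0 : ℝ) ∈ Icc 0 T := left_mem_Icc.2 hT.le
  rcases hd0.lt_or_eq with hneg | rfl
  · have hev : ∀ᶠ t in 𝓝[>] (0 : ℝ), t⁻¹ • (v (0 + t) - v 0) < 0 :=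
      hd.tendsto_slope_zero_right.eventually (gt_mem_nhds hneg)
    obtain ⟨t, ht, ht0, htT⟩ := (hev.and (Ioo_mem_nhdsGT hT)).exists
    have hvt : v t < 0 := by
      rw [zero_add, h0, sub_zero, smul_eq_mul] at ht
      by_contra! h
      exact absurd ht (not_lt.2 (mul_nonneg (inv_nonneg.2 ht0.le) h))
    obtain ⟨w, hw, hvw⟩ := intermediate_value_Icc htT.le
      (hc.mono (Icc_subset_Icc_left ht0.le)) ⟨hvt.le, hvT.le⟩
    have hw0 : 0 < w := ht0.trans_le hw.1
    have hwT : w < T := hw.2.lt_of_ne fun h => by rw [← h, hvw] at hvT; exact lt_irrefl _ hvT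
    refine ⟨w, ⟨hw0.le, hwT⟩, hvw, fun _ => hw0, fun h => absurd h hneg.ne,
      fun x hx => ?_, fun x hx => ?_⟩
    · have := hv.secant_strict_mono h0T (x := x) (y := w) ⟨hx.1.le, hx.2.le.trans hwT.le⟩
        ⟨hw0.le, hwT.le⟩ hx.1.ne' hw0.ne' hx.2
      rw [hvw, h0, sub_zero, sub_zero, zero_sub, neg_zero, zero_div] at this
      by_contra! h
      exact absurd this (not_lt.2 (div_nonneg h hx.1.le))
    · have hx0 := hw0.trans hx.1
      have := hv.secant_strict_mono h0T (x := w) (y := x) ⟨hw0.le, hwT.le⟩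
        ⟨hx0.le, hx.2⟩ hw0.ne' hx0.ne' hx.1
      rw [hvw, h0, sub_zero, sub_zero, sub_zero, zero_div, sub_zero] at this
      exact (div_pos_iff_of_pos_right hx0).1 this
  · refine ⟨0, ⟨le_rfl, hT⟩, h0, fun h => absurd h (lt_irrefl _), fun _ => rfl,
      fun x hx => absurd (hx.1.trans hx.2) (lt_irrefl _), fun x hx => ?_⟩
    have := hv.lt_slope_of_hasDerivAt h0T ⟨hx.1.le, hx.2⟩ hx.1 hd
    rw [slope_def_field, h0, sub_zero, sub_zero] at this
    exact (div_pos_iff_of_pos_right hx.1).1 this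

/-- The location of a sign change depends continuously on a parameter. -/
lemma continuousOn_of_sign_change {V : ℝ → ℝ → ℝ} {w : ℝ → ℝ} {S : Set ℝ} {T : ℝ}
    (hw : ∀ ε ∈ S, w ε ∈ Ico 0 T) (hneg : ∀ ε ∈ S, ∀ x ∈ Ioo 0 (w ε), V ε x < 0)
    (hpos : ∀ ε ∈ S, ∀ x ∈ Ioc (w ε) T, 0 < V ε x)
    (hV : ∀ x ∈ Icc 0 T, ContinuousOn (fun ε => V ε x) S) : ContinuousOn w S := by
  intro ε₀ h₀
  have hw₀ := hw ε₀ h₀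
  refine tendsto_order.2 ⟨fun a ha => ?_, fun b hb => ?_⟩
  · rcases lt_or_ge a 0 with ha0 | ha0
    · filter_upwards [self_mem_nhdsWithin] with ε hε using ha0.trans_le (hw ε hε).1
    · obtain ⟨x, hx1, hx2⟩ := exists_between ha
      have hx : x ∈ Icc 0 T := ⟨ha0.trans hx1.le, (hx2.trans hw₀.2).le⟩
      filter_upwards [self_mem_nhdsWithin, (hV x hx ε₀ h₀).eventually
        (gt_mem_nhds (hneg ε₀ h₀ x ⟨ha0.trans_lt hx1, hx2⟩))] with ε hε hlt
      by_contra! h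
      exact lt_asymm hlt (hpos ε hε x ⟨h.trans_lt hx1, hx.2⟩)
  · obtain ⟨x, hx1, hx2⟩ := exists_between (lt_min hb hw₀.2)
    have hx : x ∈ Icc 0 T := ⟨hw₀.1.trans hx1.le, (hx2.trans_le (min_le_right _ _)).le⟩
    filter_upwards [self_mem_nhdsWithin, (hV x hx ε₀ h₀).eventually
      (lt_mem_nhds (hpos ε₀ h₀ x ⟨hx1, hx.2⟩))] with ε hε hlt
    by_contra! h
    exact lt_asymm hlt (hneg ε hε x
      ⟨hw₀.1.trans_lt hx1, (hx2.trans_le (min_le_left _ _)).trans_le h⟩)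

/-- If `κ lam = w³ + O(w⁵)`, then `exp w` agrees with its second order expansion in
`(κ lam) ^ (1 / 3)` up to `O(lam)`. -/
lemma abs_exp_sub_le {κ lam w B : ℝ} (hκ : 0 < κ) (hlam : 0 < lam) (hw : 0 < w) (hw1 : w ≤ 1)
    (hB : 0 ≤ B) (hBw : B * w ^ 2 ≤ 1 / 2) (h : |κ * lam - w ^ 3| ≤ B * w ^ 5) :
    |exp w - (1 + κ ^ ((1:ℝ)/3) * lam ^ ((1:ℝ)/3)
      + 1 / 2 * κ ^ ((2:ℝ)/3) * lam ^ ((2:ℝ)/3))| ≤ (1 + B + B * (2 + B)) * (2 * κ) * lam := by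
  set a := (κ * lam) ^ ((1:ℝ)/3) with ha
  have hκl : 0 < κ * lam := mul_pos hκ hlam
  have ha0 : 0 < a := rpow_pos_of_pos hκl _
  have ha1 : κ ^ ((1:ℝ)/3) * lam ^ ((1:ℝ)/3) = a := (mul_rpow hκ.le hlam.le).symm
  have ha2 : κ ^ ((2:ℝ)/3) * lam ^ ((2:ℝ)/3) = a ^ 2 := by
    rw [← mul_rpow hκ.le hlam.le, ha, ← rpow_natCast, ← rpow_mul hκl.le]
    norm_num
  have ha3 : a ^ 3 = κ * lam := by
    rw [ha, ← rpow_natCast, ← rpow_mul hκl.le]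
    norm_num
  rw [mul_assoc (1 / 2 : ℝ), ha1, ha2]
  rw [← ha3] at h
  have hw3 : 0 < w ^ 3 := by positivity
  have hsmall : w ^ 3 ≤ 2 * κ * lam := by
    have := (abs_le.1 h).1
    have : B * w ^ 2 * w ^ 3 ≤ 1 / 2 * w ^ 3 := by gcongr
    nlinarith
  have hdiff : |a - w| ≤ B * w ^ 3 := by
    have hfac : a ^ 3 - w ^ 3 = (a - w) * (a ^ 2 + a * w + w ^ 2) := by ring
    rw [hfac, abs_mul, abs_of_pos (by positivity : 0 < a ^ 2 + a * w + w ^ 2)] at h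
    have : |a - w| * w ^ 2 ≤ |a - w| * (a ^ 2 + a * w + w ^ 2) := by
      gcongr
      nlinarith [mul_pos ha0 hw]
    refine le_of_mul_le_mul_right ?_ (by positivity : 0 < w ^ 2)
    nlinarith
  have hsum : a + w ≤ 2 + B := by
    have := (abs_le.1 hdiff).2
    have : B * w ^ 3 ≤ B * 1 := by gcongr; exact pow_le_one₀ hw.le hw1
    linarith
  have hsq : |a ^ 2 - w ^ 2| ≤ B * (2 + B) * w ^ 3 := by
    have hfac : a ^ 2 - w ^ 2 = (a - w) * (a + w) := by ring
    rw [hfac, abs_mul, abs_of_pos (add_pos ha0 hw)]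
    calc |a - w| * (a + w) ≤ B * w ^ 3 * (2 + B) := by gcongr
      _ = B * (2 + B) * w ^ 3 := by ring
  have hexp : |exp w - (1 + w + w ^ 2 / 2)| ≤ w ^ 3 := by
    have := Real.exp_bound (x := w) (by rwa [abs_of_pos hw]) (n := 3) (by norm_num)
    rw [abs_of_pos hw] at this
    norm_num [Finset.sum_range_succ, Nat.factorial] at this
    exact this.trans (by linarith)
  calc |exp w - (1 + a + 1 / 2 * a ^ 2)|
      = |(exp w - (1 + w + w ^ 2 / 2)) - (a - w) - (a ^ 2 - w ^ 2) / 2| := by congr 1; ring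
    _ ≤ |exp w - (1 + w + w ^ 2 / 2)| + |a - w| + |(a ^ 2 - w ^ 2) / 2| :=
        (abs_sub _ _).trans (add_le_add_left (abs_sub _ _) _)
    _ ≤ w ^ 3 + B * w ^ 3 + B * (2 + B) * w ^ 3 := by
        rw [abs_div, abs_of_pos (by norm_num : (0:ℝ) < 2)]
        have := abs_nonneg (a ^ 2 - w ^ 2)
        linarith
    _ = (1 + B + B * (2 + B)) * w ^ 3 := by ring
    _ ≤ (1 + B + B * (2 + B)) * (2 * κ * lam) := by gcongr
    _ = _ := by ring

/-- If `ρ = -A w³ / 12 + O(w⁵)`, then `1 - exp ρ = A w³ / 12 + O(w⁵)`. -/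
lemma abs_one_sub_exp_sub_le {ρ A C w : ℝ} (hA : 0 ≤ A) (hC : 0 ≤ C) (hw : 0 ≤ w) (hw1 : w ≤ 1)
    (hsmall : (A / 12 + C) * w ≤ 1) (h : |ρ + A * w ^ 3 / 12| ≤ C * w ^ 5) :
    |1 - exp ρ - A * w ^ 3 / 12| ≤ (C + (A / 12 + C) ^ 2) * w ^ 5 := by
  have h53 : w ^ 5 ≤ w ^ 3 := pow_le_pow_of_le_one hw hw1 (by norm_num)
  have h31 : w ^ 3 ≤ w := by simpa using pow_le_pow_of_le_one hw hw1 (by norm_num : 1 ≤ 3)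
  have h65 : w ^ 6 ≤ w ^ 5 := pow_le_pow_of_le_one hw hw1 (by norm_num)
  have hAw : 0 ≤ A * w ^ 3 / 12 := by positivity
  have hρ : |ρ| ≤ (A / 12 + C) * w ^ 3 := by
    have h1 : |ρ| ≤ |ρ + A * w ^ 3 / 12| + |A * w ^ 3 / 12| := by
      have := abs_sub (ρ + A * w ^ 3 / 12) (A * w ^ 3 / 12)
      rwa [add_sub_cancel_right] at this
    rw [abs_of_nonneg hAw] at h1
    nlinarith [mul_le_mul_of_nonneg_left h53 hC]
  have hρ1 : |ρ| ≤ 1 :=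
    hρ.trans ((mul_le_mul_of_nonneg_left h31 (by positivity)).trans hsmall)
  have hq : ρ ^ 2 ≤ (A / 12 + C) ^ 2 * w ^ 5 := by
    calc ρ ^ 2 = |ρ| ^ 2 := (sq_abs ρ).symm
      _ ≤ ((A / 12 + C) * w ^ 3) ^ 2 := by gcongr
      _ = (A / 12 + C) ^ 2 * w ^ 6 := by ring
      _ ≤ _ := by gcongr
  calc |1 - exp ρ - A * w ^ 3 / 12| = |(exp ρ - 1 - ρ) + (ρ + A * w ^ 3 / 12)| := by
        rw [← abs_neg]; congr 1; ring
    _ ≤ ρ ^ 2 + C * w ^ 5 :=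
        (abs_add_le _ _).trans (add_le_add (Real.abs_exp_sub_one_sub_id_le hρ1) h)
    _ ≤ _ := by linarith

/-- The acceleration of `v` for the free boundary problem in logarithmic variables. -/
noncomputable def drift (θ D : ℝ) (z : ℝ × ℝ) : ℝ :=
  -z.2 - z.2 ^ 2 + 2 * (1 + z.2) ^ 2 * sigmoid z.1 - 2 * θ * (1 + z.2)
    - D * z.2 * (1 + exp z.1)

/-- The autonomous vector field of the free boundary problem in logarithmic variables. -/
noncomputable def driftField (θ D : ℝ) (z : ℝ × ℝ) : ℝ × ℝ := (1 + z.2, drift θ D z)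

/-- Derivative of a scalar function along a vector field. -/
noncomputable def derivAlong (X : ℝ × ℝ → ℝ × ℝ) (φ : ℝ × ℝ → ℝ) (z : ℝ × ℝ) : ℝ :=
  fderiv ℝ φ z (X z)

lemma contDiff_drift (θ D : ℝ) : ContDiff ℝ (⊤ : ℕ∞) (drift θ D) := by
  have hS : ContDiff ℝ (⊤ : ℕ∞) (fun z : ℝ × ℝ => sigmoid z.1) :=
    (contDiff_sigmoid.of_le le_top).comp contDiff_fst
  unfold drift
  fun_prop

lemma contDiff_driftField (θ D : ℝ) : ContDiff ℝ (⊤ : ℕ∞) (driftField θ D) := by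
  have := contDiff_drift θ D
  unfold driftField
  fun_prop

lemma contDiff_derivAlong {X : ℝ × ℝ → ℝ × ℝ} {φ : ℝ × ℝ → ℝ} (hX : ContDiff ℝ (⊤ : ℕ∞) X)
    (hφ : ContDiff ℝ (⊤ : ℕ∞) φ) : ContDiff ℝ (⊤ : ℕ∞) (derivAlong X φ) :=
  (hφ.fderiv_right (m := (⊤ : ℕ∞)) (by simp)).clm_apply hX

lemma hasDerivAt_comp_derivAlong {X : ℝ × ℝ → ℝ × ℝ} {φ : ℝ × ℝ → ℝ} {γ : ℝ → ℝ × ℝ} {t : ℝ}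
    (hφ : ContDiff ℝ (⊤ : ℕ∞) φ) (hγ : HasDerivAt γ (X (γ t)) t) :
    HasDerivAt (fun s => φ (γ s)) (derivAlong X φ (γ t)) t :=
  ((hφ.differentiable (by simp)) (γ t)).hasFDerivAt.comp_hasDerivAt t hγ

lemma derivAlong_drift (θ D : ℝ) (z : ℝ × ℝ) :
    derivAlong (driftField θ D) (drift θ D) z =
      (2 * (1 + z.2) ^ 2 * (sigmoid z.1 * (1 - sigmoid z.1)) - D * z.2 * exp z.1) * (1 + z.2)
        + (-1 - 2 * z.2 + 4 * (1 + z.2) * sigmoid z.1 - 2 * θ - D * (1 + exp z.1))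
          * drift θ D z := by
  obtain ⟨a, b⟩ := z
  set d := drift θ D (a, b) with hd
  have hq : HasDerivAt (fun t : ℝ => a + (1 + b) * t) (1 + b) 0 := by
    simpa using ((hasDerivAt_id (0:ℝ)).const_mul (1 + b)).const_add a
  have hv : HasDerivAt (fun t : ℝ => b + d * t) d 0 := by
    simpa using ((hasDerivAt_id (0:ℝ)).const_mul d).const_add b
  have hc := ((contDiff_drift θ D).differentiable (by simp)
    (a + (1 + b) * 0, b + d * 0)).hasFDerivAt.comp_hasDerivAt (0:ℝ) (hq.prodMk hv)
  have hS : HasDerivAt (fun t : ℝ => sigmoid (a + (1 + b) * t)) _ 0 :=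
    (hasDerivAt_sigmoid _).comp (0:ℝ) hq
  have h1 := hv.const_add 1
  have hexpl := ((((hv.neg.sub (hv.pow 2)).add (((h1.pow 2).const_mul 2).mul hS)).sub
    (h1.const_mul (2 * θ))).sub ((hv.const_mul D).mul (hq.exp.const_add 1)))
  have := hc.unique hexpl
  simp only [mul_zero, add_zero] at this
  rw [derivAlong, driftField, this]
  simp
  ring

/-- Near the base point, the second derivative of `v` is controlled by `v` and its derivative. -/
lemma exists_abs_derivAlong_drift_sub_le (θ D : ℝ) {S : Set (ℝ × ℝ)} (hS : IsCompact S) :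
    ∃ K, 0 ≤ K ∧ ∀ z ∈ S, |derivAlong (driftField θ D) (drift θ D) z - 2 * θ * (1 - θ)| ≤
      K * (|drift θ D z| + |z.2|) := by
  have hsig : Continuous (fun z : ℝ × ℝ => sigmoid z.1) :=
    differentiable_sigmoid.continuous.comp continuous_fst
  let h : ℝ × ℝ → ℝ := fun z =>
    -1 - z.2 + (4 + 2 * z.2) * sigmoid z.1 - 2 * θ - D * (1 + exp z.1)
  let P : ℝ × ℝ → ℝ := fun z => 1 - sigmoid z.1 - θ
    + (-1 - 2 * z.2 + 4 * (1 + z.2) * sigmoid z.1 - 2 * θ - D * (1 + exp z.1))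
  let Q : ℝ × ℝ → ℝ := fun z => -h z * (1 - sigmoid z.1 - θ)
    + 2 * (3 + 3 * z.2 + z.2 ^ 2) * (sigmoid z.1 * (1 - sigmoid z.1))
    - D * exp z.1 * (1 + z.2)
  have hP : Continuous P := by fun_prop
  have hQ : Continuous Q := by fun_prop
  obtain ⟨p, hp⟩ := hS.exists_bound_of_continuousOn hP.continuousOn
  obtain ⟨q, hq⟩ := hS.exists_bound_of_continuousOn hQ.continuousOn
  refine ⟨max 0 (max p q), le_max_left _ _, fun z hz => ?_⟩
  have hPz : |P z| ≤ max 0 (max p q) :=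
    (hp z hz).trans ((le_max_left _ _).trans (le_max_right _ _))
  have hQz : |Q z| ≤ max 0 (max p q) :=
    (hq z hz).trans ((le_max_right _ _).trans (le_max_right _ _))
  have key : derivAlong (driftField θ D) (drift θ D) z - 2 * θ * (1 - θ)
      = P z * drift θ D z + Q z * z.2 := by
    rw [derivAlong_drift]
    simp only [P, Q, h, drift]
    ring
  rw [key, mul_add]
  refine (abs_add_le _ _).trans (add_le_add ?_ ?_) <;> rw [abs_mul] <;> gcongr

/-- A solution `(q, v)` of the free boundary problem in logarithmic variables. -/
structure IsTrajectory (θ D τ q₀ : ℝ) (q v : ℝ → ℝ) : Prop where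
  q_zero : q 0 = q₀
  v_zero : v 0 = 0
  hasDerivAt_q : ∀ x ∈ Ioo (-τ) τ, HasDerivAt q (1 + v x) x
  hasDerivAt_v : ∀ x ∈ Ioo (-τ) τ, HasDerivAt v (drift θ D (q x, v x)) x
  abs_v_lt : ∀ x ∈ Ioo (-τ) τ, |v x| < 1

/-- Trajectories started slightly below the equilibrium, with their return time `w` to `v = 0`. -/
lemma exists_returning_family {θ : ℝ} (D : ℝ) (hθ : θ ∈ Ioo (0:ℝ) 1) {q₁ : ℝ}
    (hq₁ : sigmoid q₁ = θ) :
    ∃ C, 0 ≤ C ∧ ∃ τ > (0:ℝ), ∀ T, 0 < T → T < τ → ∃ e > (0:ℝ), ∃ (q v : ℝ → ℝ → ℝ) (w : ℝ → ℝ),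
      ContinuousOn (fun ε => q ε (w ε) - q ε 0 - w ε) (Icc 0 e) ∧ w 0 = 0 ∧
      ∀ ε ∈ Icc 0 e, IsTrajectory θ D τ (q₁ - ε) (q ε) (v ε) ∧ w ε ∈ Ico 0 T ∧
        (0 < ε → 0 < w ε) ∧ v ε (w ε) = 0 ∧
        |q ε (w ε) - q ε 0 - w ε + 2 * θ * (1 - θ) * w ε ^ 3 / 12| ≤ C * w ε ^ 5 := by
  have hA : 0 < 2 * θ * (1 - θ) := mul_pos (mul_pos two_pos hθ.1) (sub_pos.2 hθ.2)
  set X := driftField θ D with hXdef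
  have hX := contDiff_driftField θ D
  have c₁ := contDiff_drift θ D
  have c₂ := contDiff_derivAlong hX c₁
  have c₃ := contDiff_derivAlong hX c₂
  have c₄ := contDiff_derivAlong hX c₃
  set F₂ := derivAlong X (drift θ D) with hF₂
  set F₃ := derivAlong X F₂ with hF₃
  set F₄ := derivAlong X F₃ with hF₄
  set z₁ : ℝ × ℝ := (q₁, 0) with hz₁
  set S := Metric.closedBall z₁ 1
  have hS : IsCompact S := isCompact_closedBall _ _
  obtain ⟨M₂, hM₂⟩ := hS.exists_bound_of_continuousOn c₂.continuous.continuousOn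
  obtain ⟨M₃, hM₃⟩ := hS.exists_bound_of_continuousOn c₃.continuous.continuousOn
  obtain ⟨M₄, hM₄⟩ := hS.exists_bound_of_continuousOn c₄.continuous.continuousOn
  obtain ⟨K, hK, hKb⟩ := exists_abs_derivAlong_drift_sub_le θ D hS
  set M := max M₂ (max M₃ M₄)
  have hF₂z : F₂ z₁ = 2 * θ * (1 - θ) := by
    rw [hF₂, hXdef, derivAlong_drift]
    simp only [hz₁, drift, hq₁]
    ring
  set N : Set (ℝ × ℝ) := {z | |z.2| < 1} ∩ {z | 0 < F₂ z} ∩ S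
  have hN : N ∈ 𝓝 z₁ := by
    refine inter_mem (inter_mem ?_ ?_) (Metric.closedBall_mem_nhds _ one_pos)
    · exact (isOpen_lt continuous_snd.abs continuous_const).mem_nhds (by simp [hz₁])
    · exact (isOpen_lt continuous_const c₂.continuous).mem_nhds
        (by rw [mem_ofPred_eq, hF₂z]; exact hA)
  obtain ⟨r, hr, τ, hτ, γ, hγ, hγc⟩ :=
    exists_local_flow ((hX.of_le (by simp)).contDiffAt (x := z₁)) hN
  have hstart : ∀ ε ∈ Icc 0 r, (q₁ - ε, (0:ℝ)) ∈ Metric.closedBall z₁ r := fun ε hε => by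
    simp only [hz₁, Metric.mem_closedBall, Prod.dist_eq, dist_self, Real.dist_eq]
    rw [show q₁ - ε - q₁ = -ε by ring, abs_neg, abs_of_nonneg hε.1]
    exact max_le hε.2 hr.le
  set q : ℝ → ℝ → ℝ := fun ε x => (γ ((q₁ - ε, 0), x)).1 with hq
  set v : ℝ → ℝ → ℝ := fun ε x => (γ ((q₁ - ε, 0), x)).2 with hv
  have htraj : ∀ ε ∈ Icc 0 r, IsTrajectory θ D τ (q₁ - ε) (q ε) (v ε) := fun ε hε => by
    obtain ⟨h0, h⟩ := hγ _ (hstart ε hε)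
    refine ⟨by simp [hq, h0], by simp [hv, h0], fun x hx => ?_, fun x hx => ?_, fun x hx => ?_⟩
    · exact (hasFDerivAt_fst (𝕜 := ℝ)).comp_hasDerivAt x (h x hx).1
    · exact (hasFDerivAt_snd (𝕜 := ℝ)).comp_hasDerivAt x (h x hx).1
    · exact (h x hx).2.1.1
  have hF₂pos : ∀ ε ∈ Icc 0 r, ∀ x ∈ Ioo (-τ) τ, 0 < F₂ (q ε x, v ε x) :=
    fun ε hε x hx => ((hγ _ (hstart ε hε)).2 x hx).2.1.2
  have hmemS : ∀ ε ∈ Icc 0 r, ∀ x ∈ Ioo (-τ) τ, (q ε x, v ε x) ∈ S :=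
    fun ε hε x hx => ((hγ _ (hstart ε hε)).2 x hx).2.2
  have hchain : ∀ φ : ℝ × ℝ → ℝ, ContDiff ℝ (⊤ : ℕ∞) φ → ∀ ε ∈ Icc 0 r, ∀ x ∈ Ioo (-τ) τ,
      HasDerivAt (fun x => φ (q ε x, v ε x)) (derivAlong X φ (q ε x, v ε x)) x :=
    fun φ hφ ε hε x hx => hasDerivAt_comp_derivAlong hφ ((hγ _ (hstart ε hε)).2 x hx).1
  have hjoint : ContinuousOn (fun p : ℝ × ℝ => γ ((q₁ - p.1, 0), p.2)) (Icc 0 r ×ˢ Ioo (-τ) τ) :=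
    hγc.comp (by fun_prop) fun p hp => ⟨hstart p.1 hp.1, hp.2⟩
  refine ⟨2 * M + 2 * K * M, ?_, τ, hτ, fun T hT hTτ => ?_⟩
  · have : 0 ≤ M := (norm_nonneg _).trans ((hM₂ z₁ (Metric.mem_closedBall_self zero_le_one)).trans
      (le_max_left _ _))
    positivity
  have hsub : Icc 0 T ⊆ Ioo (-τ) τ := fun x hx => ⟨by linarith [hx.1], hx.2.trans_lt hTτ⟩
  have hconv : ∀ ε ∈ Icc 0 r, StrictConvexOn ℝ (Icc 0 T) (v ε) ∧ ContinuousOn (v ε) (Icc 0 T) :=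
    fun ε hε => by
      have hcv : ContinuousOn (v ε) (Icc 0 T) := fun x hx =>
        ((htraj ε hε).hasDerivAt_v x (hsub hx)).continuousAt.continuousWithinAt
      refine ⟨strictConvexOn_of_deriv2_pos' (convex_Icc 0 T) hcv fun x hx => ?_, hcv⟩
      have hev : deriv (v ε) =ᶠ[𝓝 x] fun x => drift θ D (q ε x, v ε x) := by
        filter_upwards [isOpen_Ioo.mem_nhds (hsub hx)] with y hy
        exact ((htraj ε hε).hasDerivAt_v y hy).deriv
      rw [Function.iterate_succ_apply, Function.iterate_one, hev.deriv_eq,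
        (hchain _ c₁ ε hε x (hsub hx)).deriv]
      exact hF₂pos ε hε x (hsub hx)
  have hcε : ∀ x ∈ Icc 0 T, ContinuousOn (fun ε => v ε x) (Icc 0 r) := fun x hx =>
    (continuous_snd.comp_continuousOn hjoint).comp (f := fun ε => (ε, x)) (by fun_prop)
      fun ε hε => ⟨hε, hsub hx⟩
  have h0r : (0:ℝ) ∈ Icc 0 r := left_mem_Icc.2 hr.le
  have hd0 : ∀ ε ∈ Icc 0 r, HasDerivAt (v ε) (2 * (sigmoid (q₁ - ε) - sigmoid q₁)) 0 :=
    fun ε hε => by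
      refine ((htraj ε hε).hasDerivAt_v 0 (hsub (left_mem_Icc.2 hT.le))).congr_deriv ?_
      rw [(htraj ε hε).q_zero, (htraj ε hε).v_zero, drift, hq₁]
      ring
  have hvT : 0 < v 0 T := by
    have := (hconv 0 h0r).1.lt_slope_of_hasDerivAt (left_mem_Icc.2 hT.le) (right_mem_Icc.2 hT.le)
      hT (hd0 0 h0r)
    rw [slope_def_field, (htraj 0 h0r).v_zero, sub_zero, sub_zero, sub_zero, sub_self,
      mul_zero] at this
    exact (div_pos_iff_of_pos_right hT).1 this
  obtain ⟨e, he, her, hevT⟩ : ∃ e > 0, e ≤ r ∧ ∀ ε ∈ Icc 0 e, 0 < v ε T := by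
    have h1 := (hcε T (right_mem_Icc.2 hT.le) 0 h0r).eventually (lt_mem_nhds hvT)
    obtain ⟨δ, hδ, hb⟩ := Metric.mem_nhdsWithin_iff.1 h1
    refine ⟨min r (δ / 2), lt_min hr (by linarith), min_le_left _ _, fun ε hε => hb ⟨?_, ?_⟩⟩
    · have := hε.2.trans (min_le_right _ _)
      rw [Metric.mem_ball, Real.dist_eq, sub_zero, abs_of_nonneg hε.1]
      linarith
    · exact ⟨hε.1, hε.2.trans (min_le_left _ _)⟩
  have hIcc : Icc 0 e ⊆ Icc 0 r := Icc_subset_Icc_right her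
  have hzero : ∀ ε, ∃ w, ε ∈ Icc 0 e → w ∈ Ico 0 T ∧ v ε w = 0 ∧ (0 < ε → 0 < w) ∧
      (ε = 0 → w = 0) ∧ (∀ x ∈ Ioo 0 w, v ε x < 0) ∧ ∀ x ∈ Ioc w T, 0 < v ε x := fun ε => by
    by_cases hε : ε ∈ Icc 0 e
    · have hε' := hIcc hε
      obtain ⟨w, h1, h2, h3, h4, h5⟩ := exists_zero_of_strictConvexOn hT (hconv ε hε').1
        (hconv ε hε').2 (htraj ε hε').v_zero (hd0 ε hε')
        (by have := sigmoid_monotone (sub_le_self q₁ hε.1); linarith) (hevT ε hε)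
      refine ⟨w, fun _ => ⟨h1, h2, fun h => h3 ?_, fun h => h4 ?_, h5⟩⟩
      · have := sigmoid_strictMono (sub_lt_self q₁ h)
        linarith
      · rw [h, sub_zero, sub_self, mul_zero]
    · exact ⟨0, fun h => absurd h hε⟩
  choose w hw using hzero
  have hwc : ContinuousOn w (Icc 0 e) := continuousOn_of_sign_change
    (fun ε hε => (hw ε hε).1) (fun ε hε => (hw ε hε).2.2.2.2.1)
    (fun ε hε => (hw ε hε).2.2.2.2.2) fun x hx => (hcε x hx).mono hIcc
  have hqc : ∀ u : ℝ → ℝ, ContinuousOn u (Icc 0 e) → (∀ ε ∈ Icc 0 e, u ε ∈ Icc 0 T) →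
      ContinuousOn (fun ε => q ε (u ε)) (Icc 0 e) := fun u hu hm =>
    (continuous_fst.comp_continuousOn hjoint).comp (f := fun ε => (ε, u ε))
      (continuousOn_id.prodMk hu) fun ε hε => ⟨hIcc hε, hsub (hm ε hε)⟩
  refine ⟨e, he, q, v, w, ?_, (hw 0 (left_mem_Icc.2 he.le)).2.2.2.1 rfl, fun ε hε => ?_⟩
  · exact ((hqc w hwc fun ε hε => Ico_subset_Icc_self (hw ε hε).1).sub
      (hqc (fun _ => 0) continuousOn_const fun ε hε => left_mem_Icc.2 hT.le)).sub hwc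
  have hε' := hIcc hε
  obtain ⟨hwT, hvw, hwpos, -, -, -⟩ := hw ε hε
  refine ⟨htraj ε hε', hwT, hwpos, hvw, ?_⟩
  have hsubw : ∀ x ∈ Icc 0 (w ε), x ∈ Ioo (-τ) τ := fun x hx => hsub ⟨hx.1, hx.2.trans hwT.2.le⟩
  have := abs_sub_add_cube_le (ρ := fun x => q ε x - x) (v := v ε)
    (f₁ := fun x => drift θ D (q ε x, v ε x)) (f₂ := fun x => F₂ (q ε x, v ε x))
    (f₃ := fun x => F₃ (q ε x, v ε x)) (f₄ := fun x => F₄ (q ε x, v ε x))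
    (A := 2 * θ * (1 - θ)) (M := M) (K := K) hwT.1 hK
    (fun x hx => (((htraj ε hε').hasDerivAt_q x (hsubw x hx)).sub (hasDerivAt_id x)).congr_deriv
      (by ring))
    (fun x hx => (htraj ε hε').hasDerivAt_v x (hsubw x hx))
    (fun x hx => hchain _ c₁ ε hε' x (hsubw x hx))
    (fun x hx => hchain _ c₂ ε hε' x (hsubw x hx))
    (fun x hx => hchain _ c₃ ε hε' x (hsubw x hx))
    (fun x hx => (hM₂ _ (hmemS ε hε' x (hsubw x hx))).trans (le_max_left _ _))
    (fun x hx => (hM₃ _ (hmemS ε hε' x (hsubw x hx))).trans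
      ((le_max_left _ _).trans (le_max_right _ _)))
    (fun x hx => (hM₄ _ (hmemS ε hε' x (hsubw x hx))).trans
      ((le_max_right _ _).trans (le_max_right _ _)))
    (fun x hx => hKb _ (hmemS ε hε' x (hsubw x hx)))
    (htraj ε hε').v_zero hvw
  rw [show q ε (w ε) - q ε 0 - w ε = q ε (w ε) - w ε - (q ε 0 - 0) by ring]
  exact this

namespace IsTrajectory

variable {θ D τ q₀ : ℝ} {q v : ℝ → ℝ}

lemma hasDerivAt_exp_log (h : IsTrajectory θ D τ q₀ q v) {y : ℝ} (hy : 0 < y)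
    (hlog : log y ∈ Ioo (-τ) τ) :
    HasDerivAt (fun y => exp (q (log y) - q 0)) (exp (q (log y) - q 0) * (1 + v (log y)) / y) y := by
  have hl := hasDerivAt_log hy.ne'
  have hq : HasDerivAt (fun y => q (log y)) _ y := (h.hasDerivAt_q _ hlog).comp y hl
  convert (hq.sub_const (q 0)).exp using 1
  ring

lemma eventually_deriv_exp_log (h : IsTrajectory θ D τ q₀ q v) {y : ℝ} (hy : 0 < y)
    (hlog : log y ∈ Ioo (-τ) τ) :
    deriv (fun y => exp (q (log y) - q 0)) =ᶠ[𝓝 y]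
      fun y => exp (q (log y) - q 0) * (1 + v (log y)) / y := by
  filter_upwards [lt_mem_nhds hy, (continuousAt_log hy.ne').preimage_mem_nhds
    (isOpen_Ioo.mem_nhds hlog)] with z hz hz'
  exact (h.hasDerivAt_exp_log hz hz').deriv

lemma hasDerivAt_deriv_exp_log (h : IsTrajectory θ D τ q₀ q v) {y : ℝ} (hy : 0 < y)
    (hlog : log y ∈ Ioo (-τ) τ) :
    HasDerivAt (deriv (fun y => exp (q (log y) - q 0)))
      (exp (q (log y) - q 0) * ((1 + v (log y)) ^ 2 + drift θ D (q (log y), v (log y))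
        - (1 + v (log y))) / y ^ 2) y := by
  refine HasDerivAt.congr_of_eventuallyEq ?_ (h.eventually_deriv_exp_log hy hlog)
  have hl := hasDerivAt_log hy.ne'
  have hv : HasDerivAt (fun y => 1 + v (log y)) _ y :=
    ((h.hasDerivAt_v _ hlog).comp y hl).const_add 1
  have hd := ((h.hasDerivAt_exp_log hy hlog).fun_mul hv).fun_div (hasDerivAt_id' y) hy.ne'
  refine hd.congr_deriv ?_
  field_simp

lemma contDiffOn_exp_log (h : IsTrajectory θ D τ q₀ q v) :
    ContDiffOn ℝ 2 (fun y => exp (q (log y) - q 0)) (Ioo (exp (-τ)) (exp τ)) := by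
  have hpos : ∀ y ∈ Ioo (exp (-τ)) (exp τ), 0 < y := fun y hy => (exp_pos _).trans hy.1
  have hlog : ∀ y ∈ Ioo (exp (-τ)) (exp τ), log y ∈ Ioo (-τ) τ := fun y hy =>
    ⟨(lt_log_iff_exp_lt (hpos y hy)).2 hy.1, (log_lt_iff_lt_exp (hpos y hy)).2 hy.2⟩
  rw [show (2 : WithTop ℕ∞) = 0 + 1 + 1 by norm_num,
    contDiffOn_succ_iff_deriv_of_isOpen isOpen_Ioo]
  refine ⟨fun y hy => (h.hasDerivAt_exp_log (hpos y hy)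
    (hlog y hy)).differentiableAt.differentiableWithinAt, by simp, ?_⟩
  rw [contDiffOn_succ_iff_deriv_of_isOpen isOpen_Ioo]
  refine ⟨fun y hy => (h.hasDerivAt_deriv_exp_log (hpos y hy)
    (hlog y hy)).differentiableAt.differentiableWithinAt, by simp, ?_⟩
  rw [contDiffOn_zero]
  have hcl : ContinuousOn log (Ioo (exp (-τ)) (exp τ)) := fun y hy =>
    (continuousAt_log (hpos y hy).ne').continuousWithinAt
  have hcq : ContinuousOn (fun y => q (log y)) (Ioo (exp (-τ)) (exp τ)) :=
    ContinuousOn.comp (fun x hx => (h.hasDerivAt_q x hx).continuousAt.continuousWithinAt) hcl hlog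
  have hcv : ContinuousOn (fun y => v (log y)) (Ioo (exp (-τ)) (exp τ)) :=
    ContinuousOn.comp (fun x hx => (h.hasDerivAt_v x hx).continuousAt.continuousWithinAt) hcl hlog
  have hcd : ContinuousOn (fun y => drift θ D (q (log y), v (log y))) (Ioo (exp (-τ)) (exp τ)) :=
    (contDiff_drift θ D).continuous.comp_continuousOn (hcq.prodMk hcv)
  refine ContinuousOn.congr (f := fun y => exp (q (log y) - q 0) * ((1 + v (log y)) ^ 2
    + drift θ D (q (log y), v (log y)) - (1 + v (log y))) / y ^ 2) ?_
    fun y hy => (h.hasDerivAt_deriv_exp_log (hpos y hy) (hlog y hy)).deriv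
  refine ContinuousOn.div (ContinuousOn.mul (hcq.sub continuousOn_const).rexp
    ((((continuousOn_const.add hcv).pow 2).add hcd).sub (continuousOn_const.add hcv))) (by fun_prop) fun y hy => (pow_pos (hpos y hy) 2).ne'

/-- The second order equation of the free boundary problem in the original variables. -/
lemma deriv_deriv_exp_log (h : IsTrajectory θ D τ q₀ q v) {y : ℝ} (hy : 0 < y)
    (hlog : log y ∈ Ioo (-τ) τ) :
    deriv (deriv (fun y => exp (q (log y) - q 0))) y
      = 2 * (deriv (fun y => exp (q (log y) - q 0)) y) ^ 2
          / (exp (-q₀) + exp (q (log y) - q 0))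
        - 2 * θ * deriv (fun y => exp (q (log y) - q 0)) y / y
        + D * (1 + exp (q (log y) - q 0) / exp (-q₀))
            * (exp (q (log y) - q 0) / y ^ 2
              - deriv (fun y => exp (q (log y) - q 0)) y / y) := by
  rw [(h.hasDerivAt_deriv_exp_log hy hlog).deriv, (h.hasDerivAt_exp_log hy hlog).deriv, drift,
    h.q_zero, sigmoid_def]
  simp only [exp_sub, exp_neg]
  generalize v (log y) = p
  have hE := exp_pos (q (log y))
  have hF := exp_pos q₀
  generalize exp (q (log y)) = E at *
  generalize exp q₀ = F at *
  field_simp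
  ring

lemma exp_log_mem_Icc (h : IsTrajectory θ D τ q₀ q v) {w : ℝ} (hwτ : w < τ) {y : ℝ}
    (hy : y ∈ Icc 1 (exp w)) :
    exp (q (log y) - q 0) ∈ Icc 1 (exp (q w - q 0)) := by
  have hpos : ∀ {z}, z ∈ Icc 1 (exp w) → 0 < z := fun hz => one_pos.trans_le hz.1
  have hw : 0 ≤ w := one_le_exp_iff.1 (hy.1.trans hy.2)
  have hlog : ∀ z ∈ Icc 1 (exp w), log z ∈ Icc 0 w := fun z hz =>
    ⟨log_nonneg hz.1, (log_le_iff_le_exp (hpos hz)).2 hz.2⟩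
  have hmono : MonotoneOn q (Icc 0 w) := by
    have hI : ∀ x ∈ Icc 0 w, x ∈ Ioo (-τ) τ := fun x hx => ⟨by linarith [hx.1], by linarith [hx.2]⟩
    refine monotoneOn_of_hasDerivWithinAt_nonneg (convex_Icc 0 w)
      (fun x hx => (h.hasDerivAt_q x (hI x hx)).continuousAt.continuousWithinAt)
      (fun x hx => (h.hasDerivAt_q x (hI x (interior_subset hx))).hasDerivWithinAt)
      (fun x hx => ?_)
    linarith [(abs_lt.1 (h.abs_v_lt x (hI x (interior_subset hx)))).1]
  have hy' := hlog y hy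
  refine ⟨one_le_exp ?_, exp_le_exp.2 ?_⟩
  · linarith [hmono (left_mem_Icc.2 hw) hy' hy'.1]
  · linarith [hmono hy' (right_mem_Icc.2 hw) hy'.2]

end IsTrajectory

/-- Asymptotic expansion of the free boundary `s̄(λ)`:
`s̄ = 1 + (6/(θ(1-θ)))^{1/3} λ^{1/3} + (1/2)(6/(θ(1-θ)))^{2/3} λ^{2/3} + O(λ)`. -/
theorem sbar_expansion
    (μ σ δ θ cbar : ℝ) (hμ : 0 < μ) (hσ : 0 < σ) (hδ : 0 < δ)
    (hθdef : θ = μ / σ ^ 2) (hθ : θ ∈ Ioo (0:ℝ) 1)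
    (hcbar : cbar = (1 - θ) / θ) :
    ∃ lam₀ > (0:ℝ), ∃ (c sbar : ℝ → ℝ) (g : ℝ → ℝ → ℝ),
      (∀ lam : ℝ, 0 < lam → lam < lam₀ →
        cbar < c lam ∧ 1 < sbar lam ∧
        (∀ y ∈ Icc (1:ℝ) (sbar lam),
          g lam y ∈ Icc (1:ℝ) ((1 - lam) * sbar lam)) ∧
        ContDiffOn ℝ 2 (g lam) (Icc 1 (sbar lam)) ∧
        (∀ y ∈ Icc (1:ℝ) (sbar lam),
          deriv (deriv (g lam)) y
            = 2 * (deriv (g lam) y) ^ 2 / (c lam + g lam y)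
              - 2 * θ * deriv (g lam) y / y
              + 2 * δ / σ ^ 2 * (1 + g lam y / c lam)
                  * (g lam y / y ^ 2 - deriv (g lam) y / y)) ∧
        g lam 1 = 1 ∧ deriv (g lam) 1 = 1 ∧
        g lam (sbar lam) = (1 - lam) * sbar lam ∧
        deriv (g lam) (sbar lam) = 1 - lam) ∧
      (fun lam : ℝ => sbar lam
          - (1
            + (6 / (θ * (1 - θ))) ^ ((1:ℝ)/3) * lam ^ ((1:ℝ)/3)
            + 1 / 2 * (6 / (θ * (1 - θ))) ^ ((2:ℝ)/3) * lam ^ ((2:ℝ)/3)))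
        =O[nhdsWithin 0 (Ioi 0)] (fun lam : ℝ => lam) := by
  have hA : 0 < 2 * θ * (1 - θ) := by have := hθ.1; have := hθ.2; nlinarith
  obtain ⟨q₁, hq₁⟩ : ∃ q₁, sigmoid q₁ = θ := by
    rwa [← Set.mem_range, range_sigmoid]
  obtain ⟨C, hC, τ, hτ, hfam⟩ := exists_returning_family (2 * δ / σ ^ 2) hθ hq₁
  set A := 2 * θ * (1 - θ) with hAdef
  have hκA : 6 / (θ * (1 - θ)) = 12 / A := by
    have hne : θ * (1 - θ) ≠ 0 := (mul_pos hθ.1 (sub_pos.2 hθ.2)).ne'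
    rw [div_eq_div_iff hne hA.ne', hAdef]
    ring
  rw [hκA]
  set κ := 12 / A with hκdef
  have hκ : 0 < κ := by positivity
  set B := κ * (C + (A / 12 + C) ^ 2) with hBdef
  have hB : 0 ≤ B := by positivity
  obtain ⟨e, he, q, v, w, hcont, hw0, hfam⟩ := hfam (min (τ / 2) (1 / (2 + 2 * B + A + C)))
    (by positivity) ((min_le_left _ _).trans_lt (by linarith))
  have hwτ : ∀ ε ∈ Icc 0 e, w ε < τ := fun ε hε =>
    (((hfam ε hε).2.1.2).trans_le (min_le_left _ _)).trans (by linarith)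
  have hwsmall : ∀ ε ∈ Icc 0 e, w ε * (2 + 2 * B + A + C) ≤ 1 := fun ε hε =>
    ((lt_div_iff₀ (by positivity)).1 (((hfam ε hε).2.1.2).trans_le (min_le_right _ _))).le
  have hw1 : ∀ ε ∈ Icc 0 e, w ε ≤ 1 := fun ε hε => by
    nlinarith [hwsmall ε hε, (hfam ε hε).2.1.1,
      mul_nonneg (hfam ε hε).2.1.1 (by positivity : 0 ≤ 1 + 2 * B + A + C)]
  have hBw : ∀ ε ∈ Icc 0 e, B * w ε ^ 2 ≤ 1 / 2 := fun ε hε => by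
    have h1 := hw1 ε hε
    have h0 := (hfam ε hε).2.1.1
    nlinarith [hwsmall ε hε, mul_nonneg h0 (by positivity : 0 ≤ 2 + A + C),
      mul_nonneg (mul_nonneg hB h0) (sub_nonneg.2 h1)]
  have hACw : ∀ ε ∈ Icc 0 e, (A / 12 + C) * w ε ≤ 1 := fun ε hε => by
    have h0 := (hfam ε hε).2.1.1
    nlinarith [hwsmall ε hε, mul_nonneg h0 (by positivity : 0 ≤ 2 + 2 * B + 11 * A / 12)]
  set Λ : ℝ → ℝ := fun ε => 1 - exp (q ε (w ε) - q ε 0 - w ε) with hΛ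
  have hΛw : ∀ ε ∈ Icc 0 e, |κ * Λ ε - w ε ^ 3| ≤ B * w ε ^ 5 := fun ε hε => by
    have := abs_one_sub_exp_sub_le hA.le hC (hfam ε hε).2.1.1 (hw1 ε hε) (hACw ε hε)
      (hfam ε hε).2.2.2.2
    have hid : κ * Λ ε - w ε ^ 3 = κ * (Λ ε - A * w ε ^ 3 / 12) := by
      rw [hκdef]; field_simp
    rw [hid, abs_mul, abs_of_pos hκ, hBdef, mul_assoc κ]
    exact mul_le_mul_of_nonneg_left this hκ.le
  have hΛcont : ContinuousOn Λ (Icc 0 e) :=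
    continuousOn_const.sub (continuous_exp.comp_continuousOn hcont)
  have hΛ0 : Λ 0 = 0 := by simp [hΛ, hw0]
  have hΛe : 0 < Λ e := by
    have hmem := right_mem_Icc.2 he.le
    have hwe := (hfam e hmem).2.2.1 he
    have h1 := (abs_le.1 (hΛw e hmem)).1
    have h2 := mul_le_mul_of_nonneg_left (hBw e hmem) (pow_pos hwe 3).le
    have h3 : B * w e ^ 5 = w e ^ 3 * (B * w e ^ 2) := by ring
    refine pos_of_mul_pos_right (a := κ) ?_ hκ.le
    linarith [pow_pos hwe 3]
  have hex : ∀ lam : ℝ, ∃ ε, 0 < lam → lam < Λ e → ε ∈ Icc 0 e ∧ 0 < ε ∧ Λ ε = lam := by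
    intro lam
    by_cases hl : 0 < lam ∧ lam < Λ e
    · obtain ⟨ε, hε, hΛε⟩ := intermediate_value_Icc he.le hΛcont
        (show lam ∈ Icc (Λ 0) (Λ e) from ⟨hΛ0.trans_le hl.1.le, hl.2.le⟩)
      refine ⟨ε, fun _ _ => ⟨hε, lt_of_le_of_ne hε.1 ?_, hΛε⟩⟩
      rintro rfl
      linarith [hl.1]
    · exact ⟨0, fun h1 h2 => (hl ⟨h1, h2⟩).elim⟩
  choose ε hε using hex
  refine ⟨Λ e, hΛe, fun lam => exp (-(q₁ - ε lam)), fun lam => exp (w (ε lam)),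
    fun lam y => exp (q (ε lam) (log y) - q (ε lam) 0), fun lam hl hl' => ?_, ?_⟩
  · obtain ⟨hmem, hpos, hlam⟩ := hε lam hl hl'
    obtain ⟨htraj, -, hwpos, hvw, -⟩ := hfam _ hmem
    have hwpos := hwpos hpos
    have hwlt := hwτ _ hmem
    have hend : exp (q (ε lam) (w (ε lam)) - q (ε lam) 0) = (1 - lam) * exp (w (ε lam)) := by
      have h1 : 1 - lam = exp (q (ε lam) (w (ε lam)) - q (ε lam) 0 - w (ε lam)) := by
        linarith only [hlam]
      rw [h1, ← exp_add, sub_add_cancel]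
    have hy0 : ∀ y ∈ Icc 1 (exp (w (ε lam))), 0 < y := fun y hy => one_pos.trans_le hy.1
    have hlog : ∀ y ∈ Icc 1 (exp (w (ε lam))), log y ∈ Ioo (-τ) τ := fun y hy =>
      ⟨(neg_lt_zero.2 hτ).trans_le (log_nonneg hy.1),
        ((log_le_iff_le_exp (hy0 y hy)).2 hy.2).trans_lt hwlt⟩
    have hs : 1 < exp (w (ε lam)) := one_lt_exp_iff.2 hwpos
    refine ⟨?_, hs, fun y hy => hend ▸ htraj.exp_log_mem_Icc hwlt hy,
      htraj.contDiffOn_exp_log.mono fun y hy => ⟨?_, hy.2.trans_lt (exp_lt_exp.2 hwlt)⟩,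
      fun y hy => htraj.deriv_deriv_exp_log (hy0 y hy) (hlog y hy), by simp, ?_, ?_, ?_⟩
    · have hc : exp (-q₁) = cbar := by
        rw [hcbar, ← hq₁, sigmoid_def]
        field_simp
        ring
      rw [← hc]
      exact exp_lt_exp.2 (by linarith)
    · exact (exp_lt_one_iff.2 (neg_lt_zero.2 hτ)).trans_le hy.1
    · have h1 := left_mem_Icc.2 hs.le
      rw [(htraj.hasDerivAt_exp_log one_pos (hlog 1 h1)).deriv]
      simp [htraj.v_zero]
    · simpa using hend
    · have h1 := right_mem_Icc.2 hs.le
      rw [(htraj.hasDerivAt_exp_log (exp_pos _) (hlog _ h1)).deriv, log_exp, hvw, hend]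
      field_simp
      ring
  · refine IsBigO.of_bound ((1 + B + B * (2 + B)) * (2 * κ)) ?_
    filter_upwards [Ioo_mem_nhdsGT hΛe] with lam hl
    obtain ⟨hmem, hpos, hlam⟩ := hε lam hl.1 hl.2
    rw [norm_eq_abs, norm_eq_abs, abs_of_pos hl.1]
    exact abs_exp_sub_le hκ hl.1 ((hfam _ hmem).2.2.1 hpos) (hw1 _ hmem) hB (hBw _ hmem)
      (by simpa only [hlam] using hΛw _ hmem)
end
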